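/- Let k be a field and G a connected algebraic group over k. Then every normal G-variety X over k is covered by open G-stable subvarieties that are quasi-projective over k. -/

import Mathlib

open AlgebraicGeometry CategoryTheory CategoryTheory.Limits Opposite

universe u

noncomputable section

/-- The spectrum of the field `k`, the base of all schemes considered. -/
abbrev Spk (k : Type u) [Field k] : Scheme.{u} := Spec (CommRingCat.of k)

/-- A scheme over the field `k`: a scheme together with a structure morphism to `Spec k`. -/
structure SchemeOver (k : Type u) [Field k] : Type (u + 1) where
  carrier : Scheme.{u}
  str : carrier ⟶ Spk k

variable (k : Type u) [Field k]

/-- A group scheme over `k`, presented via its functor of points: for every scheme `T`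
and every pair of `T`-points lying over the same `T`-point of `Spec k`, a product point,
together with unit and inverse, satisfying the group axioms functorially. -/
structure GroupSchemeOver extends SchemeOver k where
  mul : ∀ {T : Scheme.{u}} (a b : T ⟶ carrier), a ≫ str = b ≫ str → (T ⟶ carrier)
  one : Spk k ⟶ carrier
  inv : ∀ {T : Scheme.{u}}, (T ⟶ carrier) → (T ⟶ carrier)
  mul_str : ∀ {T : Scheme.{u}} (a b : T ⟶ carrier) (h), mul a b h ≫ str = a ≫ str
  one_str : one ≫ str = 𝟙 (Spk k)
  inv_str : ∀ {T : Scheme.{u}} (a : T ⟶ carrier), inv a ≫ str = a ≫ str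
  mul_natural : ∀ {T' T : Scheme.{u}} (g : T' ⟶ T) (a b : T ⟶ carrier) (h h'),
    g ≫ mul a b h = mul (g ≫ a) (g ≫ b) h'
  inv_natural : ∀ {T' T : Scheme.{u}} (g : T' ⟶ T) (a : T ⟶ carrier),
    g ≫ inv a = inv (g ≫ a)
  mul_assoc : ∀ {T : Scheme.{u}} (a b c : T ⟶ carrier) (h₁ h₂ h₃ h₄),
    mul (mul a b h₁) c h₂ = mul a (mul b c h₃) h₄
  one_mul : ∀ {T : Scheme.{u}} (a : T ⟶ carrier) (h), mul (a ≫ str ≫ one) a h = a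
  mul_one : ∀ {T : Scheme.{u}} (a : T ⟶ carrier) (h), mul a (a ≫ str ≫ one) h = a
  inv_mul : ∀ {T : Scheme.{u}} (a : T ⟶ carrier) (h), mul (inv a) a h = a ≫ str ≫ one

variable {k}

theorem GroupSchemeOver.mul_congr (G : GroupSchemeOver k) {T : Scheme.{u}}
    {a a' b b' : T ⟶ G.carrier} (ha : a = a') (hb : b = b') (h h') :
    G.mul a b h = G.mul a' b' h' := by subst ha; subst hb; rfl

/-- A homomorphism of group schemes over `k`. -/
structure GroupHom (G H : GroupSchemeOver k) where
  hom : G.carrier ⟶ H.carrier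
  hom_str : hom ≫ H.str = G.str
  hom_one : G.one ≫ hom = H.one
  hom_mul : ∀ {T : Scheme.{u}} (a b : T ⟶ G.carrier) (h h'),
    G.mul a b h ≫ hom = H.mul (a ≫ hom) (b ≫ hom) h'

/-- An action of a group scheme `G` over `k` on a scheme `X` over `k`, presented via
its functor of points. -/
structure ActionOver (G : GroupSchemeOver k) (X : SchemeOver k) where
  act : ∀ {T : Scheme.{u}} (g : T ⟶ G.carrier) (x : T ⟶ X.carrier),
    g ≫ G.str = x ≫ X.str → (T ⟶ X.carrier)
  act_str : ∀ {T : Scheme.{u}} (g : T ⟶ G.carrier) (x : T ⟶ X.carrier) (h),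
    act g x h ≫ X.str = x ≫ X.str
  act_natural : ∀ {T' T : Scheme.{u}} (f : T' ⟶ T) (g : T ⟶ G.carrier)
    (x : T ⟶ X.carrier) (h h'), f ≫ act g x h = act (f ≫ g) (f ≫ x) h'
  one_act : ∀ {T : Scheme.{u}} (x : T ⟶ X.carrier) (h), act (x ≫ X.str ≫ G.one) x h = x
  mul_act : ∀ {T : Scheme.{u}} (g g' : T ⟶ G.carrier) (x : T ⟶ X.carrier) (h₁ h₂ h₃ h₄),
    act (G.mul g g' h₁) x h₂ = act g (act g' x h₃) h₄

theorem ActionOver.act_congr {G : GroupSchemeOver k} {X : SchemeOver k}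
    (α : ActionOver G X) {T : Scheme.{u}} {g g' : T ⟶ G.carrier} {x x' : T ⟶ X.carrier}
    (hg : g = g') (hx : x = x') (h h') : α.act g x h = α.act g' x' h' := by
  subst hg; subst hx; rfl

/-- The action of a group scheme on itself by left translations. -/
def GroupSchemeOver.selfAction (G : GroupSchemeOver k) : ActionOver G G.toSchemeOver where
  act g x h := G.mul g x h
  act_str g x h := (G.mul_str g x h).trans h
  act_natural f g x h h' := G.mul_natural f g x h h'
  one_act x h := G.one_mul x h
  mul_act g g' x h₁ h₂ h₃ h₄ := G.mul_assoc g g' x h₁ h₂ h₃ h₄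

/-- Restriction of an action along a homomorphism of group schemes. -/
def ActionOver.res {G H : GroupSchemeOver k} {X : SchemeOver k} (φ : GroupHom H G)
    (α : ActionOver G X) : ActionOver H X where
  act g x h := α.act (g ≫ φ.hom) x (by rw [Category.assoc, φ.hom_str, h])
  act_str g x h := α.act_str _ _ _
  act_natural f g x h h' := by
    refine (α.act_natural f (g ≫ φ.hom) x _ ?_).trans (α.act_congr ?_ rfl _ _)
    · simp only [Category.assoc, φ.hom_str, ← h']
    · simp only [Category.assoc]
  one_act x h := by
    refine (α.act_congr ?_ rfl _ ?_).trans (α.one_act x ?_)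
    · simp only [Category.assoc, φ.hom_one]
    · simp only [Category.assoc, G.one_str, Category.comp_id]
    · simp only [Category.assoc, G.one_str, Category.comp_id]
  mul_act g g' x h₁ h₂ h₃ h₄ := by
    have hg : g ≫ H.str = x ≫ X.str := (H.mul_str g g' h₁).symm.trans h₂
    have hg' : g' ≫ H.str = x ≫ X.str := h₁.symm.trans hg
    have p1 : (g ≫ φ.hom) ≫ G.str = (g' ≫ φ.hom) ≫ G.str := by
      simp only [Category.assoc, φ.hom_str]; exact h₁
    have p3 : (g' ≫ φ.hom) ≫ G.str = x ≫ X.str := by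
      simp only [Category.assoc, φ.hom_str]; exact hg'
    refine (α.act_congr (φ.hom_mul g g' h₁ p1) rfl _ ?_).trans
      (α.mul_act (g ≫ φ.hom) (g' ≫ φ.hom) x p1 ?_ p3 ?_)
    · rw [G.mul_str]
      simp only [Category.assoc, φ.hom_str]; exact hg
    · rw [G.mul_str]
      simp only [Category.assoc, φ.hom_str]; exact hg
    · rw [α.act_str]
      simp only [Category.assoc, φ.hom_str]; exact hg
/-! ### Vector bundles and line bundles, geometrically -/

/-- The data underlying a (geometric) vector bundle on a scheme `X`: a total space `π : tot ⟶ X`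
together with a fiberwise `Γ(T, ⊤)`-module structure on the `T`-points of `tot` over a fixed
`T`-point of `X`, functorially in `T`. -/
structure VecBundleData (X : Scheme.{u}) : Type (u + 1) where
  tot : Scheme.{u}
  π : tot ⟶ X
  zero : X ⟶ tot
  zero_π : zero ≫ π = 𝟙 X
  add : ∀ {T : Scheme.{u}} (a b : T ⟶ tot), a ≫ π = b ≫ π → (T ⟶ tot)
  smul : ∀ {T : Scheme.{u}} (f : Γ(T, ⊤)) (a : T ⟶ tot), T ⟶ tot
  add_π : ∀ {T : Scheme.{u}} (a b : T ⟶ tot) (h), add a b h ≫ π = a ≫ π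
  smul_π : ∀ {T : Scheme.{u}} (f : Γ(T, ⊤)) (a : T ⟶ tot), smul f a ≫ π = a ≫ π
  add_natural : ∀ {T' T : Scheme.{u}} (g : T' ⟶ T) (a b : T ⟶ tot) (h h'),
    g ≫ add a b h = add (g ≫ a) (g ≫ b) h'
  smul_natural : ∀ {T' T : Scheme.{u}} (g : T' ⟶ T) (f : Γ(T, ⊤)) (a : T ⟶ tot),
    g ≫ smul f a = smul (g.appTop f) (g ≫ a)
  add_comm : ∀ {T : Scheme.{u}} (a b : T ⟶ tot) (h h'), add a b h = add b a h'
  add_assoc : ∀ {T : Scheme.{u}} (a b c : T ⟶ tot) (h₁ h₂ h₃ h₄),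
    add (add a b h₁) c h₂ = add a (add b c h₃) h₄
  zero_add : ∀ {T : Scheme.{u}} (a : T ⟶ tot) (h), add ((a ≫ π) ≫ zero) a h = a
  one_smul : ∀ {T : Scheme.{u}} (a : T ⟶ tot), smul 1 a = a
  mul_smul : ∀ {T : Scheme.{u}} (f g : Γ(T, ⊤)) (a : T ⟶ tot), smul (f * g) a = smul f (smul g a)
  smul_add : ∀ {T : Scheme.{u}} (f : Γ(T, ⊤)) (a b : T ⟶ tot) (h h'),
    smul f (add a b h) = add (smul f a) (smul f b) h'
  add_smul : ∀ {T : Scheme.{u}} (f g : Γ(T, ⊤)) (a : T ⟶ tot) (h),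
    smul (f + g) a = add (smul f a) (smul g a) h
  zero_smul : ∀ {T : Scheme.{u}} (a : T ⟶ tot), smul 0 a = (a ≫ π) ≫ zero
  smul_zero : ∀ {T : Scheme.{u}} (f : Γ(T, ⊤)) (x : T ⟶ X), smul f (x ≫ zero) = x ≫ zero

namespace VecBundleData

variable {X : Scheme.{u}} (E : VecBundleData X)

theorem add_congr {T : Scheme.{u}} {a a' b b' : T ⟶ E.tot} (ha : a = a') (hb : b = b')
    (h h') : E.add a b h = E.add a' b' h' := by subst ha; subst hb; rfl

/-- The fiber of a vector bundle over a `T`-point of the base. -/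
abbrev Fiber {T : Scheme.{u}} (x : T ⟶ X) : Type u := { a : T ⟶ E.tot // a ≫ E.π = x }

instance fiberZero {T : Scheme.{u}} (x : T ⟶ X) : Zero (E.Fiber x) :=
  ⟨⟨x ≫ E.zero, by rw [Category.assoc, E.zero_π, Category.comp_id]⟩⟩

instance fiberAdd {T : Scheme.{u}} (x : T ⟶ X) : Add (E.Fiber x) :=
  ⟨fun a b => ⟨E.add a.1 b.1 (a.2.trans b.2.symm), (E.add_π _ _ _).trans a.2⟩⟩

instance fiberSMul {T : Scheme.{u}} (x : T ⟶ X) : SMul Γ(T, ⊤) (E.Fiber x) :=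
  ⟨fun f a => ⟨E.smul f a.1, (E.smul_π _ _).trans a.2⟩⟩

@[simp] theorem coe_fiber_zero {T : Scheme.{u}} (x : T ⟶ X) :
    ((0 : E.Fiber x) : T ⟶ E.tot) = x ≫ E.zero := rfl

@[simp] theorem coe_fiber_add {T : Scheme.{u}} (x : T ⟶ X) (a b : E.Fiber x) :
    ((a + b : E.Fiber x) : T ⟶ E.tot) = E.add a.1 b.1 (a.2.trans b.2.symm) := rfl

@[simp] theorem coe_fiber_smul {T : Scheme.{u}} (x : T ⟶ X) (f : Γ(T, ⊤)) (a : E.Fiber x) :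
    ((f • a : E.Fiber x) : T ⟶ E.tot) = E.smul f a.1 := rfl

instance {T : Scheme.{u}} (x : T ⟶ X) : AddCommMonoid (E.Fiber x) where
  add_assoc a b c := Subtype.ext (E.add_assoc _ _ _ _ _ _ _)
  add_comm a b := Subtype.ext (E.add_comm _ _ _ _)
  zero_add a := Subtype.ext (by
    have hz : ((a.1 ≫ E.π) ≫ E.zero) ≫ E.π = a.1 ≫ E.π := by
      rw [Category.assoc, E.zero_π, Category.comp_id]
    show E.add (x ≫ E.zero) a.1 _ = a.1
    exact (E.add_congr (by rw [a.2]) rfl _ hz).trans (E.zero_add a.1 hz))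
  add_zero a := Subtype.ext (by
    have hz : ((a.1 ≫ E.π) ≫ E.zero) ≫ E.π = a.1 ≫ E.π := by
      rw [Category.assoc, E.zero_π, Category.comp_id]
    have hz' : (x ≫ E.zero) ≫ E.π = a.1 ≫ E.π := by
      rw [Category.assoc, E.zero_π, Category.comp_id, a.2]
    show E.add a.1 (x ≫ E.zero) _ = a.1
    exact (E.add_comm _ _ _ hz').trans
      ((E.add_congr (by rw [a.2]) rfl _ hz).trans (E.zero_add a.1 hz)))
  nsmul := nsmulRec
  nsmul_zero _ := rfl
  nsmul_succ _ _ := rfl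

instance {T : Scheme.{u}} (x : T ⟶ X) : Module Γ(T, ⊤) (E.Fiber x) where
  one_smul a := Subtype.ext (E.one_smul a.1)
  mul_smul f g a := Subtype.ext (E.mul_smul f g a.1)
  smul_zero f := Subtype.ext (E.smul_zero f x)
  smul_add f a b := Subtype.ext (E.smul_add f a.1 b.1 _ _)
  add_smul f g a := Subtype.ext (E.add_smul f g a.1 _)
  zero_smul a := Subtype.ext ((E.zero_smul a.1).trans (by rw [a.2]; rfl))

/-- A family of `n` local sections of `E` over an open subset `U` is a frame if every point
of the total space over `U` is, in a unique way, a linear combination of these sections. -/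
def IsFrame {n : ℕ} (U : X.Opens) (s : Fin n → (U.toScheme ⟶ E.tot)) : Prop :=
  ∃ hs : ∀ i, s i ≫ E.π = U.ι,
    ∀ {T : Scheme.{u}} (x : T ⟶ U.toScheme),
      Function.Bijective (fun f : Fin n → Γ(T, ⊤) =>
        (∑ i, f i • (⟨x ≫ s i, by rw [Category.assoc, hs i]⟩ : E.Fiber (x ≫ U.ι))))

/-- A family of `n` global sections of `E` is a global frame if every point of the total
space is, in a unique way, a linear combination of these sections. -/
def IsGlobalFrame {n : ℕ} (s : Fin n → (X ⟶ E.tot)) : Prop :=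
  ∃ hs : ∀ i, s i ≫ E.π = 𝟙 X,
    ∀ {T : Scheme.{u}} (x : T ⟶ X),
      Function.Bijective (fun f : Fin n → Γ(T, ⊤) =>
        (∑ i, f i • (⟨x ≫ s i, by rw [Category.assoc, hs i, Category.comp_id]⟩ : E.Fiber x)))

end VecBundleData

/-- A (geometric) vector bundle of rank `n` on `X`: bundle data which is locally trivial,
i.e. admits local frames around every point of `X`. -/
structure VecBundle (n : ℕ) (X : Scheme.{u}) extends VecBundleData X where
  locTriv : ∀ x : X, ∃ (U : X.Opens) (s : Fin n → (U.toScheme ⟶ tot)),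
    x ∈ U ∧ toVecBundleData.IsFrame U s

/-- A (geometric) line bundle on a scheme. -/
abbrev LineBundle (X : Scheme.{u}) := VecBundle 1 X

/-- A morphism of total spaces of vector bundles over `X` is linear if it commutes with the
projections, the fiberwise additions and the fiberwise scalar multiplications. -/
def IsLinearHom {X : Scheme.{u}} (E F : VecBundleData X) (φ : E.tot ⟶ F.tot) : Prop :=
  (φ ≫ F.π = E.π) ∧
  (∀ {T : Scheme.{u}} (a b : T ⟶ E.tot) (h h'), E.add a b h ≫ φ = F.add (a ≫ φ) (b ≫ φ) h') ∧
  (∀ {T : Scheme.{u}} (f : Γ(T, ⊤)) (a : T ⟶ E.tot), E.smul f a ≫ φ = F.smul f (a ≫ φ))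

/-- Two vector bundles on `X` are isomorphic if there is a linear isomorphism between them. -/
def VBIso {X : Scheme.{u}} {n m : ℕ} (E : VecBundle n X) (F : VecBundle m X) : Prop :=
  ∃ φ : E.tot ⟶ F.tot, IsLinearHom E.toVecBundleData F.toVecBundleData φ ∧ IsIso φ

/-- `F` is a pullback of the vector bundle `E` along `g : Y ⟶ X`. -/
def IsPullbackBundle {Y X : Scheme.{u}} (g : Y ⟶ X) {n : ℕ} (E : VecBundle n X)
    (F : VecBundle n Y) : Prop :=
  ∃ τ : F.tot ⟶ E.tot,
    (τ ≫ E.π = F.π ≫ g) ∧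
    (∀ {T : Scheme.{u}} (a b : T ⟶ F.tot) (h h'), F.add a b h ≫ τ = E.add (a ≫ τ) (b ≫ τ) h') ∧
    (∀ {T : Scheme.{u}} (f : Γ(T, ⊤)) (a : T ⟶ F.tot), F.smul f a ≫ τ = E.smul f (a ≫ τ)) ∧
    (∀ {T : Scheme.{u}} (y : T ⟶ Y) (a : T ⟶ E.tot), a ≫ E.π = y ≫ g →
      ∃! b : T ⟶ F.tot, b ≫ F.π = y ∧ b ≫ τ = a)

/-- A vector bundle is trivial if it admits a global frame. -/
def IsTrivialBundle {X : Scheme.{u}} {n : ℕ} (E : VecBundle n X) : Prop :=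
  ∃ s : Fin n → (X ⟶ E.tot), E.toVecBundleData.IsGlobalFrame s

/-- `N` is a tensor product of the line bundles `L` and `M`: witnessed by a fiberwise
bilinear pairing taking local frames to local frames. -/
def IsTensor {X : Scheme.{u}} (L M N : LineBundle X) : Prop :=
  ∃ β : ∀ {T : Scheme.{u}} (a : T ⟶ L.tot) (b : T ⟶ M.tot), a ≫ L.π = b ≫ M.π → (T ⟶ N.tot),
    (∀ {T : Scheme.{u}} (a : T ⟶ L.tot) (b : T ⟶ M.tot) (h), β a b h ≫ N.π = a ≫ L.π) ∧
    (∀ {T' T : Scheme.{u}} (g : T' ⟶ T) (a : T ⟶ L.tot) (b : T ⟶ M.tot) (h h'),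
      g ≫ β a b h = β (g ≫ a) (g ≫ b) h') ∧
    (∀ {T : Scheme.{u}} (a a' : T ⟶ L.tot) (b : T ⟶ M.tot) (h₁ h₂ h₃ h₄ h₅),
      β (L.add a a' h₁) b h₂ = N.add (β a b h₃) (β a' b h₄) h₅) ∧
    (∀ {T : Scheme.{u}} (a : T ⟶ L.tot) (b b' : T ⟶ M.tot) (h₁ h₂ h₃ h₄ h₅),
      β a (M.add b b' h₁) h₂ = N.add (β a b h₃) (β a b' h₄) h₅) ∧
    (∀ {T : Scheme.{u}} (f : Γ(T, ⊤)) (a : T ⟶ L.tot) (b : T ⟶ M.tot) (h₁ h₂),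
      β (L.smul f a) b h₁ = N.smul f (β a b h₂)) ∧
    (∀ {T : Scheme.{u}} (f : Γ(T, ⊤)) (a : T ⟶ L.tot) (b : T ⟶ M.tot) (h₁ h₂),
      β a (M.smul f b) h₁ = N.smul f (β a b h₂)) ∧
    (∀ (U : X.Opens) (sL : Fin 1 → (U.toScheme ⟶ L.tot)) (sM : Fin 1 → (U.toScheme ⟶ M.tot)),
      L.toVecBundleData.IsFrame U sL → M.toVecBundleData.IsFrame U sM →
      ∀ (h : sL 0 ≫ L.π = sM 0 ≫ M.π),
        N.toVecBundleData.IsFrame (n := 1) U (fun _ => β (sL 0) (sM 0) h))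

/-- `N` is an `m`-th tensor power of the line bundle `L`. -/
def IsTensorPow {X : Scheme.{u}} (L : LineBundle X) : ℕ → LineBundle X → Prop
  | 0, N => IsTrivialBundle N
  | m + 1, N => ∃ M : LineBundle X, IsTensorPow L m M ∧ IsTensor M L N

/-- A line bundle is ample if the base is quasi-compact and quasi-separated and the
non-vanishing loci of global sections of positive tensor powers give an affine open cover. -/
def IsAmple {X : Scheme.{u}} (L : LineBundle X) : Prop :=
  CompactSpace X ∧ QuasiSeparatedSpace X ∧
  ∀ x : X, ∃ (m : ℕ), 0 < m ∧ ∃ (N : LineBundle X), IsTensorPow L m N ∧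
    ∃ (s : X ⟶ N.tot), s ≫ N.π = 𝟙 X ∧
      ∃ U : X.Opens, IsAffineOpen U ∧ x ∈ U ∧
        (U : Set X) = {y : X | s.base y ≠ N.zero.base y}
/-! ### Properties of schemes and group schemes over `k` -/

/-- An algebraic group over `k` is a group scheme of finite type over `k`. -/
def GroupSchemeOver.IsAlgebraic {k : Type u} [Field k] (G : GroupSchemeOver k) : Prop :=
  LocallyOfFiniteType G.str ∧ QuasiCompact G.str

/-- A scheme of finite type over `k`. -/
def SchemeOver.IsFiniteType {k : Type u} [Field k] (X : SchemeOver k) : Prop :=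
  LocallyOfFiniteType X.str ∧ QuasiCompact X.str

/-- A variety over `k`: an integral separated scheme of finite type over `k`. -/
def SchemeOver.IsVariety {k : Type u} [Field k] (X : SchemeOver k) : Prop :=
  IsIntegral X.carrier ∧ AlgebraicGeometry.IsSeparated X.str ∧ X.IsFiniteType

/-- A scheme is normal if all its local rings are integrally closed domains. -/
def IsNormalScheme (X : Scheme.{u}) : Prop :=
  ∀ x : X, IsDomain (X.presheaf.stalk x) ∧ IsIntegrallyClosed (X.presheaf.stalk x)

/-- The base change of a scheme over `k` to the algebraic closure of `k`. -/
def SchemeOver.geomFiber {k : Type u} [Field k] (X : SchemeOver k) : Scheme.{u} :=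
  pullback X.str (Spec.map (CommRingCat.ofHom (algebraMap k (AlgebraicClosure k))))

/-- A scheme over `k` is geometrically integral if its base change to an algebraic
closure of `k` is integral. -/
def SchemeOver.IsGeomIntegral {k : Type u} [Field k] (X : SchemeOver k) : Prop :=
  IsIntegral X.geomFiber

/-- A scheme over `k` is geometrically connected if its base change to an algebraic
closure of `k` is connected. -/
def SchemeOver.IsGeomConnected {k : Type u} [Field k] (X : SchemeOver k) : Prop :=
  ConnectedSpace X.geomFiber

/-- A scheme over `k` is geometrically irreducible if its base change to an algebraic
closure of `k` is irreducible. -/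
def SchemeOver.IsGeomIrreducible {k : Type u} [Field k] (X : SchemeOver k) : Prop :=
  IrreducibleSpace X.geomFiber

/-- An open subscheme of a scheme over `k`, as a scheme over `k`. -/
def SchemeOver.ofOpens {k : Type u} [Field k] (X : SchemeOver k) (U : X.carrier.Opens) :
    SchemeOver k :=
  ⟨U.toScheme, U.ι ≫ X.str⟩

/-- A scheme over `k` is quasi-projective if it is separated, of finite type, and carries
an ample line bundle. -/
def SchemeOver.IsQuasiProjective {k : Type u} [Field k] (X : SchemeOver k) : Prop :=
  AlgebraicGeometry.IsSeparated X.str ∧ X.IsFiniteType ∧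
    ∃ L : LineBundle X.carrier, IsAmple L

/-- An open subset of `X` is stable under an action of `G` if the action preserves its
`T`-points, for all `T`. -/
def ActionOver.Stable {k : Type u} [Field k] {G : GroupSchemeOver k} {X : SchemeOver k}
    (α : ActionOver G X) (U : X.carrier.Opens) : Prop :=
  ∀ {T : Scheme.{u}} (g : T ⟶ G.carrier) (x : T ⟶ X.carrier) (h),
    Set.range x.base ⊆ (U : Set X.carrier) →
      Set.range (α.act g x h).base ⊆ (U : Set X.carrier)

/-- A `G`-linearization of a vector bundle `E` on a `G`-scheme `X`: an action of `G` on the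
total space of `E`, lifting the action on `X` and acting linearly on the fibers (equivalently,
an action of `G × 𝔾ₘ` on `E` for which the projection is equivariant and `𝔾ₘ` acts by
multiplication on the fibers). -/
structure LinearizationData {k : Type u} [Field k] {G : GroupSchemeOver k} {X : SchemeOver k}
    (α : ActionOver G X) {n : ℕ} (E : VecBundle n X.carrier) where
  lact : ∀ {T : Scheme.{u}} (g : T ⟶ G.carrier) (e : T ⟶ E.tot),
    g ≫ G.str = (e ≫ E.π) ≫ X.str → (T ⟶ E.tot)
  lact_π : ∀ {T : Scheme.{u}} (g : T ⟶ G.carrier) (e : T ⟶ E.tot) (h h'),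
    lact g e h ≫ E.π = α.act g (e ≫ E.π) h'
  lact_natural : ∀ {T' T : Scheme.{u}} (f : T' ⟶ T) (g : T ⟶ G.carrier) (e : T ⟶ E.tot) (h h'),
    f ≫ lact g e h = lact (f ≫ g) (f ≫ e) h'
  one_lact : ∀ {T : Scheme.{u}} (e : T ⟶ E.tot) (h), lact (((e ≫ E.π) ≫ X.str) ≫ G.one) e h = e
  mul_lact : ∀ {T : Scheme.{u}} (g g' : T ⟶ G.carrier) (e : T ⟶ E.tot) (h₁ h₂ h₃ h₄),
    lact (G.mul g g' h₁) e h₂ = lact g (lact g' e h₃) h₄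
  lact_add : ∀ {T : Scheme.{u}} (g : T ⟶ G.carrier) (a b : T ⟶ E.tot) (h₁ h₂ h₃ h₄ h₅),
    lact g (E.add a b h₁) h₂ = E.add (lact g a h₃) (lact g b h₄) h₅
  lact_smul : ∀ {T : Scheme.{u}} (g : T ⟶ G.carrier) (f : Γ(T, ⊤)) (a : T ⟶ E.tot) (h₁ h₂),
    lact g (E.smul f a) h₁ = E.smul f (lact g a h₂)

/-- A vector bundle is `G`-linearized (linearizable) if it admits a linearization. -/
def ActionOver.IsLinearized {k : Type u} [Field k] {G : GroupSchemeOver k} {X : SchemeOver k}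
    (α : ActionOver G X) {n : ℕ} (E : VecBundle n X.carrier) : Prop :=
  Nonempty (LinearizationData α E)

/-- Equivariance of a morphism relative to a homomorphism of group schemes. -/
def IsEquivariantRel {k : Type u} [Field k] {G H : GroupSchemeOver k} {X Y : SchemeOver k}
    (φ : GroupHom G H) (α : ActionOver G X) (β : ActionOver H Y)
    (f : X.carrier ⟶ Y.carrier) : Prop :=
  f ≫ Y.str = X.str ∧
  ∀ {T : Scheme.{u}} (g : T ⟶ G.carrier) (x : T ⟶ X.carrier) (h h'),
    α.act g x h ≫ f = β.act (g ≫ φ.hom) (x ≫ f) h'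

/-- Equivariance of a morphism of `G`-schemes. -/
def IsEquivariant {k : Type u} [Field k] {G : GroupSchemeOver k} {X Y : SchemeOver k}
    (α : ActionOver G X) (β : ActionOver G Y) (f : X.carrier ⟶ Y.carrier) : Prop :=
  f ≫ Y.str = X.str ∧
  ∀ {T : Scheme.{u}} (g : T ⟶ G.carrier) (x : T ⟶ X.carrier) (h h'),
    α.act g x h ≫ f = β.act g (x ≫ f) h'

/-- A `T`-point of `G` acts trivially if it acts trivially on all points of `X` over `T`. -/
def ActionOver.ActsTrivially {k : Type u} [Field k] {G : GroupSchemeOver k}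
    {X : SchemeOver k} (α : ActionOver G X) {T : Scheme.{u}} (g : T ⟶ G.carrier) : Prop :=
  ∀ {T' : Scheme.{u}} (t : T' ⟶ T) (x : T' ⟶ X.carrier) (h), α.act (t ≫ g) x h = x

/-- An action is almost faithful if its kernel is finite, i.e. all trivially acting points
factor through a fixed closed subscheme of `G` which is finite over `k`. -/
def ActionOver.IsAlmostFaithful {k : Type u} [Field k] {G : GroupSchemeOver k}
    {X : SchemeOver k} (α : ActionOver G X) : Prop :=
  ∃ (K : Scheme.{u}) (ι : K ⟶ G.carrier), IsClosedImmersion ι ∧ IsFinite (ι ≫ G.str) ∧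
    ∀ {T : Scheme.{u}} (g : T ⟶ G.carrier), α.ActsTrivially g → ∃ g' : T ⟶ K, g' ≫ ι = g

/-- An abelian variety over `k` is a smooth connected proper algebraic group over `k`. -/
def GroupSchemeOver.IsAbelianVariety {k : Type u} [Field k] (G : GroupSchemeOver k) : Prop :=
  G.IsAlgebraic ∧ IsSmooth G.str ∧ ConnectedSpace G.carrier ∧ IsProper G.str

noncomputable section

/-- A multiplicative cocycle along a down-closed family of opens covering `Z`. -/
structure Coc (Z : Scheme.{u}) where
  J : Z.Opens → Prop
  lower : ∀ {V V' : Z.Opens}, V ≤ V' → J V' → J V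
  covers : ∀ z : Z, ∃ V, J V ∧ z ∈ V
  u : ∀ (V V' : Z.Opens), J V → J V' → V ≤ V' → Γ(V.toScheme, ⊤)
  u_unit : ∀ (V V' : Z.Opens) (h h') (e : V ≤ V'), IsUnit (u V V' h h' e)
  u_id : ∀ (V : Z.Opens) (h h' e), u V V h h' e = 1
  u_comp : ∀ (V V' V'' : Z.Opens) (h h' h'') (e : V ≤ V') (e' : V' ≤ V'') (e''),
    u V V'' h h'' e'' = u V V' h h' e * (Z.homOfLE e).appTop (u V' V'' h' h'' e')

namespace Coc
variable {Z : Scheme.{u}} (C : Coc Z)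

def cov : Z.OpenCover where
  I₀ := {V : Z.Opens // C.J V}
  X U := U.1.toScheme
  f U := U.1.ι
  mem₀ := by
    rw [Scheme.presieve₀_mem_precoverage_iff]
    refine ⟨fun x ↦ ?_, inferInstance⟩
    obtain ⟨V, h, hx⟩ := C.covers x
    exact ⟨⟨V, h⟩, by simpa using hx⟩

instance : Preorder C.cov.I₀ := inferInstanceAs <| Preorder {V : Z.Opens // C.J V}

instance : Small.{u} C.cov.I₀ := inferInstanceAs <| Small.{u} {V : Z.Opens // C.J V}

theorem homOfLE_self (V : Z.Opens) (e : V ≤ V) : Z.homOfLE e = 𝟙 V.toScheme := by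
  rw [← cancel_mono V.ι, Scheme.homOfLE_ι, Category.id_comp]

theorem homOfLE_trans (V V' V'' : Z.Opens) (e : V ≤ V') (e' : V' ≤ V'') (e'' : V ≤ V'') :
    Z.homOfLE e'' = Z.homOfLE e ≫ Z.homOfLE e' := by
  simp

theorem directed_aux (V V' : Z.Opens) (x : (pullback V.ι V'.ι :)) (h) :
    ∃ y : (V ⊓ V').toScheme, pullback.lift (Z.homOfLE (inf_le_left : V ⊓ V' ≤ V))
      (Z.homOfLE (inf_le_right : V ⊓ V' ≤ V')) h y = x := by
  have hx1 : (pullback.fst V.ι V'.ι ≫ V.ι) x ∈ V :=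
    (pullback.fst V.ι V'.ι x).2
  have hx2 : (pullback.fst V.ι V'.ι ≫ V.ι) x ∈ V' := by
    rw [pullback.condition]
    exact (pullback.snd V.ι V'.ι x).2
  have hx : (pullback.fst V.ι V'.ι ≫ V.ι) x ∈ V ⊓ V' := ⟨hx1, hx2⟩
  obtain ⟨y, hy⟩ : ∃ y : (V ⊓ V').toScheme, (V ⊓ V').ι y = (pullback.fst V.ι V'.ι ≫ V.ι) x := ⟨⟨_, hx⟩, rfl⟩
  refine ⟨y, ?_⟩
  apply (pullback.fst V.ι V'.ι ≫ V.ι).isOpenEmbedding.injective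
  rw [← Scheme.Hom.comp_apply, pullback.lift_fst_assoc, Scheme.homOfLE_ι, hy]

instance : Scheme.Cover.LocallyDirected C.cov where
  trans {i j} hij := Z.homOfLE (leOfHom hij : i.1 ≤ j.1)
  trans_id i := homOfLE_self _ _
  trans_comp {i j k} hij hjk := homOfLE_trans _ _ _ _ _ _
  w {i j} hij := Scheme.homOfLE_ι _ _
  directed {i j} x := 
    ⟨⟨i.1 ⊓ j.1, C.lower inf_le_left i.2⟩, homOfLE (inf_le_left : i.1 ⊓ j.1 ≤ i.1),
      homOfLE (inf_le_right : i.1 ⊓ j.1 ≤ j.1), directed_aux i.1 j.1 x _⟩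
  property_trans {i j} hij := inferInstanceAs (IsOpenImmersion (Z.homOfLE (leOfHom hij : i.1 ≤ j.1)))

theorem appTop_comp_apply {A B D : Scheme.{u}} (g : A ⟶ B) (a : B ⟶ D) (s : Γ(D, ⊤)) :
    (g ≫ a).appTop s = g.appTop (a.appTop s) := by
  rw [Scheme.Hom.comp_appTop]; rfl

abbrev AA (V : Z.Opens) : Scheme.{u} := 𝔸(PUnit.{u+1}; V.toScheme)

abbrev pt {V : Z.Opens} {S : Scheme.{u}} (y : S ⟶ V.toScheme) (f : Γ(S, ⊤)) : S ⟶ AA V :=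
  AffineSpace.homOfVector y (fun _ => f)

abbrev crd (V : Z.Opens) : Γ(AA V, ⊤) := AffineSpace.coord V.toScheme PUnit.unit

abbrev prj (V : Z.Opens) : AA V ⟶ V.toScheme := AA V ↘ V.toScheme

theorem AA_ext {V : Z.Opens} {S : Scheme.{u}} {a b : S ⟶ AA V} (h : a ≫ prj V = b ≫ prj V)
    (h' : a.appTop (crd V) = b.appTop (crd V)) : a = b :=
  AffineSpace.hom_ext h (fun _ => h')

theorem pt_prj {V : Z.Opens} {S : Scheme.{u}} (y : S ⟶ V.toScheme) (f : Γ(S, ⊤)) :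
    pt y f ≫ prj V = y := AffineSpace.homOfVector_over _ _

theorem pt_crd {V : Z.Opens} {S : Scheme.{u}} (y : S ⟶ V.toScheme) (f : Γ(S, ⊤)) :
    (pt y f).appTop (crd V) = f := AffineSpace.homOfVector_appTop_coord _ _ _

theorem comp_crd {V : Z.Opens} {S S' : Scheme.{u}} (g : S' ⟶ S) (a : S ⟶ AA V) :
    (g ≫ a).appTop (crd V) = g.appTop (a.appTop (crd V)) := appTop_comp_apply _ _ _

/-- transition map -/
def tr (V V' : Z.Opens) (h : C.J V) (h' : C.J V') (e : V ≤ V') : AA V ⟶ AA V' :=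
  pt (prj V ≫ Z.homOfLE e) ((prj V).appTop (C.u V V' h h' e) * crd V)

theorem tr_prj (V V' : Z.Opens) (h h') (e : V ≤ V') :
    C.tr V V' h h' e ≫ prj V' = prj V ≫ Z.homOfLE e := pt_prj _ _

theorem comp_tr_crd (V V' : Z.Opens) (h h') (e : V ≤ V') {S : Scheme.{u}} (a : S ⟶ AA V) :
    (a ≫ C.tr V V' h h' e).appTop (crd V') =
      (a ≫ prj V).appTop (C.u V V' h h' e) * a.appTop (crd V) := by
  rw [comp_crd, tr, pt_crd, map_mul, appTop_comp_apply]

theorem tr_id (V : Z.Opens) (h h') (e : V ≤ V) : C.tr V V h h' e = 𝟙 _ := by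
  apply AA_ext
  · rw [tr_prj]; simp
  · rw [tr, pt_crd, C.u_id]; simp

theorem tr_comp (V V' V'' : Z.Opens) (h h' h'') (e : V ≤ V') (e' : V' ≤ V'') (e'') :
    C.tr V V'' h h'' e'' = C.tr V V' h h' e ≫ C.tr V' V'' h' h'' e' := by
  apply AA_ext
  · rw [tr_prj, Category.assoc, tr_prj, ← Category.assoc, tr_prj]; simp
  · rw [comp_tr_crd, tr, tr, pt_crd, pt_crd, pt_prj, C.u_comp V V' V'' h h' h'' e e' e'', map_mul]
    simp only [Scheme.Hom.comp_appTop, CommRingCat.comp_apply]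
    ring

theorem tr_isPullback (V V' : Z.Opens) (h h') (e : V ≤ V') :
    IsPullback (C.tr V V' h h' e) (prj V) (prj V') (Z.homOfLE e) := by
  refine ⟨⟨C.tr_prj V V' h h' e⟩, ⟨PullbackCone.IsLimit.mk _ (fun s => pt s.snd
    (s.snd.appTop (((C.u_unit V V' h h' e).unit⁻¹ : _) : Γ(V.toScheme, ⊤)) * s.fst.appTop (crd V')))
    ?_ ?_ ?_⟩⟩
  · intro s
    apply AA_ext
    · rw [Category.assoc, tr_prj, ← Category.assoc, pt_prj, s.condition]
    · rw [comp_tr_crd, pt_prj, pt_crd, ← mul_assoc, ← map_mul]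
      rw [IsUnit.mul_val_inv]; simp
  · intro s
    exact pt_prj _ _
  · intro s m h1 h2
    apply AA_ext
    · rw [h2, pt_prj]
    · rw [pt_crd, ← h1, comp_tr_crd, h2, ← mul_assoc, ← map_mul, IsUnit.val_inv_mul]; simp

def glu : C.cov.RelativeGluingData where
  functor :=
    { obj := fun i => AA i.1
      map := fun {i j} hij => C.tr i.1 j.1 i.2 j.2 (leOfHom hij)
      map_id := fun i => C.tr_id _ _ _ _
      map_comp := fun _ _ => C.tr_comp _ _ _ _ _ _ _ _ _ }
  natTrans :=
    { app := fun i => prj i.1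
      naturality := fun {i j} hij => C.tr_prj i.1 j.1 i.2 j.2 (leOfHom hij) }
  equifibered := fun {i j} hij => C.tr_isPullback i.1 j.1 i.2 j.2 (leOfHom hij)

def tot : Scheme.{u} := C.glu.glued
def pi : C.tot ⟶ Z := C.glu.toBase
def inc (V : Z.Opens) (h : C.J V) : AA V ⟶ C.tot := colimit.ι C.glu.functor ⟨V, h⟩

theorem inc_isPullback (V : Z.Opens) (h : C.J V) :
    IsPullback (prj V) (C.inc V h) V.ι C.pi :=
  C.glu.isPullback_natTrans_ι_toBase ⟨V, h⟩

theorem tr_inc (V V' : Z.Opens) (h h') (e : V ≤ V') :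
    C.tr V V' h h' e ≫ C.inc V' h' = C.inc V h :=
  colimit.w C.glu.functor (homOfLE e : (⟨V, h⟩ : {V : Z.Opens // C.J V}) ⟶ ⟨V', h'⟩)

end Coc
end

noncomputable section
namespace Coc
variable {Z : Scheme.{u}} (C : Coc Z)

def coord (V : Z.Opens) (h : C.J V) {S : Scheme.{u}} (a : S ⟶ C.tot) (y : S ⟶ V.toScheme)
    (H : y ≫ V.ι = a ≫ C.pi) : Γ(S, ⊤) :=
  ((C.inc_isPullback V h).lift y a H).appTop (crd V)

theorem coord_natural (V : Z.Opens) (h : C.J V) {S S' : Scheme.{u}} (g : S' ⟶ S) (a : S ⟶ C.tot)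
    (y : S ⟶ V.toScheme) (H : y ≫ V.ι = a ≫ C.pi) (H') :
    C.coord V h (g ≫ a) (g ≫ y) H' = g.appTop (C.coord V h a y H) := by
  rw [coord, coord, ← appTop_comp_apply]
  congr 3
  apply (C.inc_isPullback V h).hom_ext <;> simp

theorem coord_congr (V : Z.Opens) (h : C.J V) {S : Scheme.{u}} {a a' : S ⟶ C.tot}
    {y y' : S ⟶ V.toScheme} (ea : a = a') (ey : y = y') (H : y ≫ V.ι = a ≫ C.pi) (H') :
    C.coord V h a y H = C.coord V h a' y' H' := by
  subst ea; subst ey; rfl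

theorem inc_pi (V : Z.Opens) (h : C.J V) : C.inc V h ≫ C.pi = prj V ≫ V.ι :=
  (C.inc_isPullback V h).w.symm

theorem pt_inc_pi (V : Z.Opens) (h : C.J V) {S : Scheme.{u}} (y : S ⟶ V.toScheme) (f : Γ(S, ⊤)) :
    (pt y f ≫ C.inc V h) ≫ C.pi = y ≫ V.ι := by
  rw [Category.assoc, inc_pi, ← Category.assoc, pt_prj]

theorem coord_pt (V : Z.Opens) (h : C.J V) {S : Scheme.{u}} (y : S ⟶ V.toScheme) (f : Γ(S, ⊤)) (H) :
    C.coord V h (pt y f ≫ C.inc V h) y H = f := by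
  rw [coord]
  have : (C.inc_isPullback V h).lift y (pt y f ≫ C.inc V h) H = pt y f := by
    apply (C.inc_isPullback V h).hom_ext
    · rw [IsPullback.lift_fst, pt_prj]
    · rw [IsPullback.lift_snd]
  rw [this, pt_crd]

theorem eq_pt (V : Z.Opens) (h : C.J V) {S : Scheme.{u}} (a : S ⟶ C.tot) (y : S ⟶ V.toScheme)
    (H : y ≫ V.ι = a ≫ C.pi) : a = pt y (C.coord V h a y H) ≫ C.inc V h := by
  have : (C.inc_isPullback V h).lift y a H = pt y (C.coord V h a y H) := by
    apply AA_ext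
    · rw [IsPullback.lift_fst, pt_prj]
    · rw [pt_crd]; rfl
  rw [← this, IsPullback.lift_snd]

theorem pt_tr (V V' : Z.Opens) (h h') (e : V ≤ V') {S : Scheme.{u}} (y : S ⟶ V.toScheme)
    (f : Γ(S, ⊤)) :
    pt y f ≫ C.tr V V' h h' e = pt (y ≫ Z.homOfLE e) (y.appTop (C.u V V' h h' e) * f) := by
  apply AA_ext
  · rw [Category.assoc, tr_prj, ← Category.assoc, pt_prj, pt_prj]
  · rw [comp_tr_crd, pt_crd, pt_crd, pt_prj]

theorem coord_tr (V V' : Z.Opens) (h h') (e : V ≤ V') {S : Scheme.{u}} (a : S ⟶ C.tot)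
    (y : S ⟶ V.toScheme) (H : y ≫ V.ι = a ≫ C.pi) (H') :
    C.coord V' h' a (y ≫ Z.homOfLE e) H' =
      y.appTop (C.u V V' h h' e) * C.coord V h a y H := by
  have h1 := C.eq_pt V h a y H
  rw [← C.tr_inc V V' h h' e, ← Category.assoc, pt_tr] at h1
  rw [← C.coord_pt V' h' (y ≫ Z.homOfLE e) (y.appTop (C.u V V' h h' e) * C.coord V h a y H)
    (by rw [← h1, H'])]
  exact C.coord_congr V' h' h1 rfl _ _

/-- a compatible family of coordinates over a point `x` of the base -/
structure Fam {T : Scheme.{u}} (x : T ⟶ Z) where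
  φ : ∀ (V : Z.Opens) (_ : C.J V) {S : Scheme.{u}} (g : S ⟶ T) (y : S ⟶ V.toScheme),
    y ≫ V.ι = g ≫ x → Γ(S, ⊤)
  nat : ∀ (V : Z.Opens) (h : C.J V) {S S' : Scheme.{u}} (k : S' ⟶ S) (g : S ⟶ T)
    (y : S ⟶ V.toScheme) (H H'), φ V h (k ≫ g) (k ≫ y) H' = k.appTop (φ V h g y H)
  compat : ∀ (V V' : Z.Opens) (h h') (e : V ≤ V') {S : Scheme.{u}} (g : S ⟶ T)
    (y : S ⟶ V.toScheme) (H H'), φ V' h' g (y ≫ Z.homOfLE e) H' =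
      y.appTop (C.u V V' h h' e) * φ V h g y H

theorem glue_agree {T : Scheme.{u}} {x : T ⟶ Z} (F : C.Fam x) {S : Scheme.{u}} (g : S ⟶ T)
    (V V' : Z.Opens) (h h') (y : S ⟶ V.toScheme) (y' : S ⟶ V'.toScheme) (H H') :
    pt y (F.φ V h g y H) ≫ C.inc V h = pt y' (F.φ V' h' g y' H') ≫ C.inc V' h' := by
  have hr : Set.range (g ≫ x) ⊆ Set.range (V ⊓ V').ι := by
    rw [Scheme.Opens.range_ι]
    rintro _ ⟨s, rfl⟩
    constructor
    · rw [← H]; exact (y s).2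
    · rw [← H']; exact (y' s).2
  let w : S ⟶ (V ⊓ V').toScheme := IsOpenImmersion.lift (V ⊓ V').ι (g ≫ x) hr
  have hw : w ≫ (V ⊓ V').ι = g ≫ x := IsOpenImmersion.lift_fac _ _ _
  have e1 : y = w ≫ Z.homOfLE inf_le_left := by
    rw [← cancel_mono V.ι, H, Category.assoc, Scheme.homOfLE_ι, hw]
  have e2 : y' = w ≫ Z.homOfLE inf_le_right := by
    rw [← cancel_mono V'.ι, H', Category.assoc, Scheme.homOfLE_ι, hw]
  have hJ : C.J (V ⊓ V') := C.lower inf_le_left h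
  subst e1 e2
  rw [F.compat (V ⊓ V') V hJ h inf_le_left g w hw H, F.compat (V ⊓ V') V' hJ h' inf_le_right g w hw H']
  rw [← pt_tr, ← pt_tr, Category.assoc, Category.assoc, tr_inc, tr_inc]

def pcov {T : Scheme.{u}} (x : T ⟶ Z) : T.OpenCover := C.cov.pullback₁ x

theorem cov_ext {T Y : Scheme.{u}} (x : T ⟶ Z) (a b : T ⟶ Y)
    (h : ∀ (V : Z.Opens) (_ : C.J V), pullback.fst x V.ι ≫ a = pullback.fst x V.ι ≫ b) : a = b :=
  (C.pcov x).hom_ext a b (fun i => h i.1 i.2)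

theorem ext {T : Scheme.{u}} (a b : T ⟶ C.tot) (hp : a ≫ C.pi = b ≫ C.pi)
    (h : ∀ (V : Z.Opens) (h : C.J V) {S : Scheme.{u}} (g : S ⟶ T) (y : S ⟶ V.toScheme) (H H'),
      C.coord V h (g ≫ a) y H = C.coord V h (g ≫ b) y H') : a = b := by
  apply C.cov_ext (a ≫ C.pi)
  intro V hV
  have H : pullback.snd (a ≫ C.pi) V.ι ≫ V.ι = (pullback.fst (a ≫ C.pi) V.ι ≫ a) ≫ C.pi := by
    rw [Category.assoc, pullback.condition]
  have H' : pullback.snd (a ≫ C.pi) V.ι ≫ V.ι = (pullback.fst (a ≫ C.pi) V.ι ≫ b) ≫ C.pi := by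
    rw [Category.assoc, ← hp, pullback.condition]
  rw [C.eq_pt V hV _ _ H, C.eq_pt V hV _ _ H', h V hV _ _ H H']

theorem exists_mk {T : Scheme.{u}} {x : T ⟶ Z} (F : C.Fam x) :
    ∃ a : T ⟶ C.tot, ∀ (V : Z.Opens) (h : C.J V),
      pullback.fst x V.ι ≫ a = pt (pullback.snd x V.ι) (F.φ V h (pullback.fst x V.ι) _
        pullback.condition.symm) ≫ C.inc V h := by
  let m : ∀ i, (C.pcov x).X i ⟶ C.tot := fun i =>
    pt (V := i.1) (pullback.snd x i.1.ι) (F.φ i.1 i.2 (pullback.fst x i.1.ι) _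
        pullback.condition.symm) ≫ C.inc i.1 i.2
  have key : ∀ (V V' : Z.Opens) (h : C.J V) (h' : C.J V'),
      pullback.fst (pullback.fst x V.ι) (pullback.fst x V'.ι) ≫ pt (pullback.snd x V.ι)
        (F.φ V h (pullback.fst x V.ι) _ pullback.condition.symm) ≫ C.inc V h =
      pullback.snd (pullback.fst x V.ι) (pullback.fst x V'.ι) ≫ pt (pullback.snd x V'.ι)
        (F.φ V' h' (pullback.fst x V'.ι) _ pullback.condition.symm) ≫ C.inc V' h' := by
    intro V V' h h'
    have cm : ∀ {W : Z.Opens} {S S' : Scheme.{u}} (k : S' ⟶ S) (y : S ⟶ W.toScheme) (f),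
        k ≫ pt y f = pt (k ≫ y) (k.appTop f) := by
      intro W S S' k y f
      apply AA_ext
      · rw [Category.assoc, pt_prj, pt_prj]
      · rw [comp_crd, pt_crd, pt_crd]
    have c1 := pullback.condition (f := x) (g := V.ι)
    have c2 := pullback.condition (f := x) (g := V'.ι)
    have c3 := pullback.condition (f := pullback.fst x V.ι) (g := pullback.fst x V'.ι)
    rw [← Category.assoc, ← Category.assoc, cm, cm,
      ← F.nat V h _ _ _ _ (by rw [Category.assoc, Category.assoc, c1]),
      ← F.nat V' h' _ _ _ _ (by rw [Category.assoc, Category.assoc, c2])]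
    have := C.glue_agree F (pullback.fst (pullback.fst x V.ι) (pullback.fst x V'.ι) ≫ pullback.fst x V.ι) 
      V V' h h' (pullback.fst (pullback.fst x V.ι) (pullback.fst x V'.ι) ≫ pullback.snd x V.ι)
      (pullback.snd (pullback.fst x V.ι) (pullback.fst x V'.ι) ≫ pullback.snd x V'.ι)
      (by rw [Category.assoc, Category.assoc, c1]) (by rw [c3, Category.assoc, Category.assoc, c2])
    rw [this]
    congr 2
    congr 1
  refine ⟨(C.pcov x).glueMorphisms m ?_, ?_⟩
  · intro i j
    exact key i.1 j.1 i.2 j.2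
  · intro V h
    exact (C.pcov x).ι_glueMorphisms m _ ⟨V, h⟩

def mkp {T : Scheme.{u}} {x : T ⟶ Z} (F : C.Fam x) : T ⟶ C.tot := (C.exists_mk F).choose

theorem mkp_pi {T : Scheme.{u}} {x : T ⟶ Z} (F : C.Fam x) : C.mkp F ≫ C.pi = x := by
  apply C.cov_ext x
  intro V h
  rw [← Category.assoc, mkp, (C.exists_mk F).choose_spec V h, pt_inc_pi, pullback.condition]

theorem coord_mkp {T : Scheme.{u}} {x : T ⟶ Z} (F : C.Fam x) (V : Z.Opens) (h : C.J V)
    {S : Scheme.{u}} (g : S ⟶ T) (y : S ⟶ V.toScheme) (H H') :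
    C.coord V h (g ≫ C.mkp F) y H = F.φ V h g y H' := by
  let k : S ⟶ pullback x V.ι := pullback.lift g y H'.symm
  have k1 : k ≫ pullback.fst x V.ι = g := pullback.lift_fst _ _ _
  have k2 : k ≫ pullback.snd x V.ι = y := pullback.lift_snd _ _ _
  have e := (C.exists_mk F).choose_spec V h
  change pullback.fst x V.ι ≫ C.mkp F = _ at e
  clear_value k
  subst k1 k2
  rw [C.coord_congr V h (Category.assoc _ _ _) rfl _ (by
    rw [Category.assoc, Category.assoc, Category.assoc, mkp_pi, pullback.condition]),
    C.coord_natural V h k _ _ (by rw [Category.assoc, mkp_pi, pullback.condition]),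
    F.nat V h k _ _ pullback.condition.symm,
    C.coord_congr V h e rfl _ (by rw [pt_inc_pi]), coord_pt]

end Coc
end

noncomputable section
namespace Coc
variable {Z : Scheme.{u}} (C : Coc Z)

theorem hc {T S : Scheme.{u}} {V : Z.Opens} {x : T ⟶ Z} {a : T ⟶ C.tot} (ha : a ≫ C.pi = x)
    {g : S ⟶ T} {y : S ⟶ V.toScheme} (H : y ≫ V.ι = g ≫ x) : y ≫ V.ι = (g ≫ a) ≫ C.pi := by
  rw [H, Category.assoc, ha]

/-- the coordinate of a point pulled back along `g` -/
def cc {T S : Scheme.{u}} {x : T ⟶ Z} (V : Z.Opens) (h : C.J V) (a : T ⟶ C.tot)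
    (ha : a ≫ C.pi = x) (g : S ⟶ T) (y : S ⟶ V.toScheme) (H : y ≫ V.ι = g ≫ x) : Γ(S, ⊤) :=
  C.coord V h (g ≫ a) y (C.hc ha H)

theorem cc_nat {T S S' : Scheme.{u}} {x : T ⟶ Z} (V : Z.Opens) (h : C.J V) (a : T ⟶ C.tot)
    (ha : a ≫ C.pi = x) (k : S' ⟶ S) (g : S ⟶ T) (y : S ⟶ V.toScheme) (H H') :
    C.cc V h a ha (k ≫ g) (k ≫ y) H' = k.appTop (C.cc V h a ha g y H) := by
  rw [cc, cc, ← C.coord_natural V h k (g ≫ a) y (C.hc ha H) (by rw [Category.assoc, C.hc ha H]; simp)]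
  exact C.coord_congr V h (Category.assoc _ _ _) rfl _ _

theorem cc_compat {T S : Scheme.{u}} {x : T ⟶ Z} (V V' : Z.Opens) (h : C.J V) (h' : C.J V')
    (e : V ≤ V') (a : T ⟶ C.tot)
    (ha : a ≫ C.pi = x) (g : S ⟶ T) (y : S ⟶ V.toScheme) (H H') :
    C.cc V' h' a ha g (y ≫ Z.homOfLE e) H' =
      y.appTop (C.u V V' h h' e) * C.cc V h a ha g y H :=
  C.coord_tr V V' h h' e (g ≫ a) y _ _

theorem cc_comp {T T' S : Scheme.{u}} {x : T ⟶ Z} {x' : T' ⟶ Z} (V : Z.Opens) (h : C.J V)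
    (a : T ⟶ C.tot) (ha : a ≫ C.pi = x) (g : T' ⟶ T) (ha' : (g ≫ a) ≫ C.pi = x')
    (g' : S ⟶ T') (y : S ⟶ V.toScheme) (H H') :
    C.cc V h (g ≫ a) ha' g' y H = C.cc V h a ha (g' ≫ g) y H' :=
  C.coord_congr V h (Category.assoc _ _ _).symm rfl _ _

theorem cc_ext {T : Scheme.{u}} (x : T ⟶ Z) (a b : T ⟶ C.tot) (ha : a ≫ C.pi = x)
    (hb : b ≫ C.pi = x)
    (h : ∀ (V : Z.Opens) (h : C.J V) {S : Scheme.{u}} (g : S ⟶ T) (y : S ⟶ V.toScheme) (H),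
      C.cc V h a ha g y H = C.cc V h b hb g y H) : a = b := by
  refine C.ext a b (ha.trans hb.symm) ?_
  intro V hV S g y H H'
  exact h V hV g y (by rw [H, Category.assoc, ha])

theorem cc_mkp {T : Scheme.{u}} {x : T ⟶ Z} (F : C.Fam x) (V : Z.Opens) (h : C.J V)
    {S : Scheme.{u}} (g : S ⟶ T) (y : S ⟶ V.toScheme) (H) :
    C.cc V h (C.mkp F) (C.mkp_pi F) g y H = F.φ V h g y H := C.coord_mkp F V h g y _ _

theorem cc_congr {T S : Scheme.{u}} {x x' : T ⟶ Z} (V : Z.Opens) (h : C.J V) {a a' : T ⟶ C.tot}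
    (e : a = a') (ha : a ≫ C.pi = x) (ha' : a' ≫ C.pi = x') (g : S ⟶ T) (y : S ⟶ V.toScheme) (H H') :
    C.cc V h a ha g y H = C.cc V h a' ha' g y H' := C.coord_congr V h (by rw [e]) rfl _ _

def zeroF {T : Scheme.{u}} (x : T ⟶ Z) : C.Fam x where
  φ V h S g y H := 0
  nat V h S S' k g y H H' := by simp only [map_zero]
  compat V V' h h' e S g y H H' := by simp

def addF {T : Scheme.{u}} {x : T ⟶ Z} (a b : T ⟶ C.tot) (ha : a ≫ C.pi = x) (hb : b ≫ C.pi = x) :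
    C.Fam x where
  φ V h S g y H := C.cc V h a ha g y H + C.cc V h b hb g y H
  nat V h S S' k g y H H' := by rw [C.cc_nat _ _ _ _ _ _ _ H, C.cc_nat _ _ _ _ _ _ _ H, map_add]
  compat V V' h h' e S g y H H' := by
    rw [C.cc_compat V V' h h' e _ _ _ _ H, C.cc_compat V V' h h' e _ _ _ _ H, mul_add]

def smulF {T : Scheme.{u}} {x : T ⟶ Z} (f : Γ(T, ⊤)) (a : T ⟶ C.tot) (ha : a ≫ C.pi = x) :
    C.Fam x where
  φ V h S g y H := g.appTop f * C.cc V h a ha g y H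
  nat V h S S' k g y H H' := by rw [C.cc_nat _ _ _ _ _ _ _ H, map_mul, appTop_comp_apply]
  compat V V' h h' e S g y H H' := by
    rw [C.cc_compat V V' h h' e _ _ _ _ H]; ring

/-- section from local data -/
def secF (s : ∀ V, C.J V → Γ(V.toScheme, ⊤))
    (hs : ∀ V V' (h : C.J V) (h' : C.J V') (e : V ≤ V'), (Z.homOfLE e).appTop (s V' h') =
      C.u V V' h h' e * s V h) {T : Scheme.{u}} (x : T ⟶ Z) : C.Fam x where
  φ V h S g y H := y.appTop (s V h)
  nat V h S S' k g y H H' := by rw [appTop_comp_apply]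
  compat V V' h h' e S g y H H' := by
    rw [appTop_comp_apply, hs V V' h h' e, map_mul]

def zer : Z ⟶ C.tot := C.mkp (C.zeroF (𝟙 Z))
def ad {T : Scheme.{u}} (a b : T ⟶ C.tot) (h : a ≫ C.pi = b ≫ C.pi) : T ⟶ C.tot :=
  C.mkp (C.addF a b rfl h.symm)
def sm {T : Scheme.{u}} (f : Γ(T, ⊤)) (a : T ⟶ C.tot) : T ⟶ C.tot :=
  C.mkp (C.smulF f a rfl)

theorem zer_pi {T : Scheme.{u}} (x : T ⟶ Z) : (x ≫ C.zer) ≫ C.pi = x := by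
  rw [Category.assoc, zer, mkp_pi, Category.comp_id]
theorem ad_pi {T : Scheme.{u}} {x : T ⟶ Z} (a b : T ⟶ C.tot) (ha : a ≫ C.pi = x) (h) :
  C.ad a b h ≫ C.pi = x := by rw [ad, mkp_pi, ha]
theorem sm_pi {T : Scheme.{u}} {x : T ⟶ Z} (f : Γ(T, ⊤)) (a : T ⟶ C.tot) (ha : a ≫ C.pi = x) :
  C.sm f a ≫ C.pi = x := by rw [sm, mkp_pi, ha]

theorem cc_zer {T S : Scheme.{u}} (x : T ⟶ Z) (V : Z.Opens) (h : C.J V) (hx) (g : S ⟶ T)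
    (y : S ⟶ V.toScheme) (H : y ≫ V.ι = g ≫ x) : C.cc V h (x ≫ C.zer) hx g y H = 0 := by
  rw [C.cc_comp V h C.zer (C.mkp_pi _) x hx g y H (by rw [H, Category.comp_id])]
  exact C.cc_mkp _ V h _ y _

theorem cc_ad {T S : Scheme.{u}} {x : T ⟶ Z} (a b : T ⟶ C.tot) (ha : a ≫ C.pi = x)
    (hb : b ≫ C.pi = x) (hab) (h0) (V : Z.Opens) (h : C.J V) (g : S ⟶ T)
    (y : S ⟶ V.toScheme) (H : y ≫ V.ι = g ≫ x) :
    C.cc V h (C.ad a b hab) h0 g y H = C.cc V h a ha g y H + C.cc V h b hb g y H := by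
  subst ha
  exact C.cc_mkp (C.addF a b rfl hab.symm) V h g y H

theorem cc_sm {T S : Scheme.{u}} {x : T ⟶ Z} (f : Γ(T, ⊤)) (a : T ⟶ C.tot) (ha : a ≫ C.pi = x)
    (h0) (V : Z.Opens) (h : C.J V) (g : S ⟶ T)
    (y : S ⟶ V.toScheme) (H : y ≫ V.ι = g ≫ x) :
    C.cc V h (C.sm f a) h0 g y H = g.appTop f * C.cc V h a ha g y H := by
  subst ha
  exact C.cc_mkp (C.smulF f a rfl) V h g y H

def vbd : VecBundleData Z where
  tot := C.tot
  π := C.pi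
  zero := C.zer
  zero_π := by rw [zer, mkp_pi]
  add a b h := C.ad a b h
  smul f a := C.sm f a
  add_π a b h := C.ad_pi a b rfl h
  smul_π f a := C.sm_pi f a rfl
  add_natural g a b h h' := by
    have e : (g ≫ b) ≫ C.pi = (g ≫ a) ≫ C.pi := h'.symm
    refine C.cc_ext ((g ≫ a) ≫ C.pi) _ _ (by rw [Category.assoc, C.ad_pi a b rfl, Category.assoc])
      (C.ad_pi _ _ rfl _) ?_
    intro V hV S g' y H
    have H' : y ≫ V.ι = (g' ≫ g) ≫ a ≫ C.pi := by rw [H]; simp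
    rw [C.cc_comp V hV (C.ad a b h) (C.ad_pi a b rfl h) g _ g' y H H',
      C.cc_ad a b rfl h.symm, C.cc_ad _ _ rfl e, C.cc_comp V hV a rfl g _ g' y H H',
      C.cc_comp V hV b h.symm g _ g' y H H']
  smul_natural g f a := by
    refine C.cc_ext ((g ≫ a) ≫ C.pi) _ _ (by rw [Category.assoc, C.sm_pi f a rfl, Category.assoc])
      (C.sm_pi _ _ rfl) ?_
    intro V hV S g' y H
    have H' : y ≫ V.ι = (g' ≫ g) ≫ a ≫ C.pi := by rw [H]; simp
    rw [C.cc_comp V hV (C.sm f a) (C.sm_pi f a rfl) g _ g' y H H',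
      C.cc_sm f a rfl, C.cc_sm _ _ rfl, C.cc_comp V hV a rfl g _ g' y H H', appTop_comp_apply]
  add_comm a b h h' := by
    refine C.cc_ext (a ≫ C.pi) _ _ (C.ad_pi a b rfl h) (C.ad_pi b a h.symm h') ?_
    intro V hV S g' y H
    rw [C.cc_ad a b rfl h.symm, C.cc_ad b a h.symm rfl, add_comm]
  add_assoc a b c h₁ h₂ h₃ h₄ := by
    have hb : b ≫ C.pi = a ≫ C.pi := h₁.symm
    have hc : c ≫ C.pi = a ≫ C.pi := (hb.symm.trans h₃).symm
    have h12 := C.ad_pi a b rfl h₁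
    have h23 := C.ad_pi b c hb h₃
    refine C.cc_ext (a ≫ C.pi) _ _ (C.ad_pi _ c h12 _) (C.ad_pi a _ rfl _) ?_
    intro V hV S g' y H
    rw [C.cc_ad _ c h12 hc, C.cc_ad a b rfl hb, C.cc_ad a _ rfl h23, C.cc_ad b c hb hc, add_assoc]
  zero_add a h := by
    have h0 := C.zer_pi (a ≫ C.pi)
    refine C.cc_ext (a ≫ C.pi) _ _ (C.ad_pi _ _ h0 _) rfl ?_
    intro V hV S g' y H
    rw [C.cc_ad _ a h0 rfl, C.cc_zer, zero_add]
  one_smul a := by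
    refine C.cc_ext (a ≫ C.pi) _ _ (C.sm_pi _ _ rfl) rfl ?_
    intro V hV S g' y H
    rw [C.cc_sm _ a rfl, map_one, one_mul]
  mul_smul f g a := by
    have h0 := C.sm_pi g a rfl
    refine C.cc_ext (a ≫ C.pi) _ _ (C.sm_pi _ _ rfl) (C.sm_pi _ _ h0) ?_
    intro V hV S g' y H
    rw [C.cc_sm _ a rfl, C.cc_sm _ _ h0, C.cc_sm _ a rfl, map_mul, mul_assoc]
  smul_add f a b h h' := by
    have h0 := C.ad_pi a b rfl h
    have h1 := C.sm_pi f a rfl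
    have h2 := C.sm_pi f b h.symm
    refine C.cc_ext (a ≫ C.pi) _ _ (C.sm_pi _ _ h0) (C.ad_pi _ _ h1 _) ?_
    intro V hV S g' y H
    rw [C.cc_sm _ _ h0, C.cc_ad a b rfl h.symm, C.cc_ad _ _ h1 h2, C.cc_sm _ a rfl,
      C.cc_sm _ b h.symm, mul_add]
  add_smul f g a h := by
    have h1 := C.sm_pi f a rfl
    have h2 := C.sm_pi g a rfl
    refine C.cc_ext (a ≫ C.pi) _ _ (C.sm_pi _ _ rfl) (C.ad_pi _ _ h1 _) ?_
    intro V hV S g' y H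
    rw [C.cc_sm _ _ rfl, C.cc_ad _ _ h1 h2, C.cc_sm _ a rfl,
      C.cc_sm _ a rfl, map_add, add_mul]
  zero_smul a := by
    have h0 := C.zer_pi (a ≫ C.pi)
    refine C.cc_ext (a ≫ C.pi) _ _ (C.sm_pi _ _ rfl) h0 ?_
    intro V hV S g' y H
    rw [C.cc_sm _ _ rfl, C.cc_zer, map_zero, zero_mul]
  smul_zero f x := by
    have h0 := C.zer_pi x
    refine C.cc_ext x _ _ (C.sm_pi _ _ h0) h0 ?_
    intro V hV S g' y H
    rw [C.cc_sm _ _ h0, C.cc_zer, mul_zero]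

end Coc
end

noncomputable section
namespace Coc
variable {Z : Scheme.{u}} (C : Coc Z)

abbrev fn {S T : Scheme.{u}} (g : S ⟶ T) (f : Γ(S, ⊤)) : S ⟶ 𝔸(PUnit.{u+1}; T) :=
  AffineSpace.homOfVector g (fun _ => f)

theorem comp_fn {S S' T : Scheme.{u}} (k : S' ⟶ S) (g : S ⟶ T) (f : Γ(S, ⊤)) :
    k ≫ fn g f = fn (k ≫ g) (k.appTop f) := by
  apply AffineSpace.hom_ext
  · rw [Category.assoc, AffineSpace.homOfVector_over, AffineSpace.homOfVector_over]
  · intro i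
    rw [appTop_comp_apply, AffineSpace.homOfVector_appTop_coord, AffineSpace.homOfVector_appTop_coord]

theorem fn_inj {S T : Scheme.{u}} (g : S ⟶ T) (f f' : Γ(S, ⊤)) (h : fn g f = fn g f') : f = f' := by
  have := AffineSpace.homOfVector_appTop_coord g (fun _ : PUnit.{u+1} => f) PUnit.unit
  rw [← this]; change (fn g f).appTop _ = _; rw [h, AffineSpace.homOfVector_appTop_coord]

theorem fun_ext {T : Scheme.{u}} (x : T ⟶ Z) (f f' : Γ(T, ⊤))
    (h : ∀ (V : Z.Opens) (_ : C.J V) {S : Scheme.{u}} (g : S ⟶ T) (y : S ⟶ V.toScheme),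
      y ≫ V.ι = g ≫ x → g.appTop f = g.appTop f') : f = f' := by
  apply fn_inj (𝟙 T)
  apply C.cov_ext x
  intro V hV
  rw [comp_fn, comp_fn, h V hV _ _ pullback.condition.symm]

theorem fun_glue {T : Scheme.{u}} (x : T ⟶ Z)
    (φ : ∀ (V : Z.Opens) (_ : C.J V) {S : Scheme.{u}} (g : S ⟶ T) (y : S ⟶ V.toScheme),
      y ≫ V.ι = g ≫ x → Γ(S, ⊤))
    (nat : ∀ (V : Z.Opens) (h : C.J V) {S S' : Scheme.{u}} (k : S' ⟶ S) (g : S ⟶ T)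
      (y : S ⟶ V.toScheme) (H H'), φ V h (k ≫ g) (k ≫ y) H' = k.appTop (φ V h g y H))
    (ind : ∀ (V V' : Z.Opens) (h h') {S : Scheme.{u}} (g : S ⟶ T)
      (y : S ⟶ V.toScheme) (y' : S ⟶ V'.toScheme) (H H'), φ V h g y H = φ V' h' g y' H') :
    ∃ f : Γ(T, ⊤), ∀ (V : Z.Opens) (h : C.J V) {S : Scheme.{u}} (g : S ⟶ T) (y : S ⟶ V.toScheme)
      (H), φ V h g y H = g.appTop f := by
  let m : ∀ i, (C.pcov x).X i ⟶ 𝔸(PUnit.{u+1}; T) := fun i =>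
    fn (pullback.fst x i.1.ι) (φ i.1 i.2 (pullback.fst x i.1.ι) _ pullback.condition.symm)
  have key : ∀ (V V' : Z.Opens) (h : C.J V) (h' : C.J V'),
      pullback.fst (pullback.fst x V.ι) (pullback.fst x V'.ι) ≫ fn (pullback.fst x V.ι)
        (φ V h (pullback.fst x V.ι) _ pullback.condition.symm) =
      pullback.snd (pullback.fst x V.ι) (pullback.fst x V'.ι) ≫ fn (pullback.fst x V'.ι)
        (φ V' h' (pullback.fst x V'.ι) _ pullback.condition.symm) := by
    intro V V' h h'
    have c1 := pullback.condition (f := x) (g := V.ι)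
    have c2 := pullback.condition (f := x) (g := V'.ι)
    have c3 := pullback.condition (f := pullback.fst x V.ι) (g := pullback.fst x V'.ι)
    rw [comp_fn, comp_fn, 
      ← nat V h _ _ _ _ (by rw [Category.assoc, Category.assoc, c1]),
      ← nat V' h' _ _ _ _ (by rw [Category.assoc, Category.assoc, c2]), 
      ind V V' h h' _ _ (pullback.snd (pullback.fst x V.ι) (pullback.fst x V'.ι) ≫ pullback.snd x V'.ι)
        _ (by rw [c3, Category.assoc, Category.assoc, c2])]
    congr 2
  obtain ⟨a, ha⟩ : ∃ a : T ⟶ 𝔸(PUnit.{u+1}; T), ∀ V h, pullback.fst x V.ι ≫ a =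
      fn (pullback.fst x V.ι) (φ V h (pullback.fst x V.ι) _ pullback.condition.symm) := by
    refine ⟨(C.pcov x).glueMorphisms m ?_, ?_⟩
    · intro i j
      exact key i.1 j.1 i.2 j.2
    · intro V h
      exact (C.pcov x).ι_glueMorphisms m _ ⟨V, h⟩
  refine ⟨a.appTop (AffineSpace.coord T PUnit.unit), ?_⟩
  intro V h S g y H
  let k : S ⟶ pullback x V.ι := pullback.lift g y H.symm
  have k1 : k ≫ pullback.fst x V.ι = g := pullback.lift_fst _ _ _
  have k2 : k ≫ pullback.snd x V.ι = y := pullback.lift_snd _ _ _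
  clear_value k
  subst k1 k2
  rw [nat V h k _ _ pullback.condition.symm, ← appTop_comp_apply, Category.assoc, ha V h, comp_fn,
    AffineSpace.homOfVector_appTop_coord]

theorem exists_inf {S : Scheme.{u}} (V V' : Z.Opens) (y : S ⟶ V.toScheme) (y' : S ⟶ V'.toScheme)
    (H : y ≫ V.ι = y' ≫ V'.ι) : ∃ w : S ⟶ (V ⊓ V').toScheme, 
      y = w ≫ Z.homOfLE inf_le_left ∧ y' = w ≫ Z.homOfLE inf_le_right := by
  have hr : Set.range (y ≫ V.ι) ⊆ Set.range (V ⊓ V').ι := by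
    rw [Scheme.Opens.range_ι]
    rintro _ ⟨s, rfl⟩
    constructor
    · exact (y s).2
    · rw [H]; exact (y' s).2
  refine ⟨IsOpenImmersion.lift (V ⊓ V').ι (y ≫ V.ι) hr, ?_, ?_⟩
  · rw [← cancel_mono V.ι, Category.assoc, Scheme.homOfLE_ι, IsOpenImmersion.lift_fac]
  · rw [← cancel_mono V'.ι, Category.assoc, Scheme.homOfLE_ι, IsOpenImmersion.lift_fac, H]

theorem cc_change {T S : Scheme.{u}} {x : T ⟶ Z} (V V' : Z.Opens) (h : C.J V) (h' : C.J V')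
    (g : S ⟶ T) (y : S ⟶ V.toScheme) (y' : S ⟶ V'.toScheme) (H H') :
    ∃ c : Γ(S, ⊤), IsUnit c ∧ ∀ (a : T ⟶ C.tot) (ha : a ≫ C.pi = x),
      C.cc V h a ha g y H = c * C.cc V' h' a ha g y' H' := by
  obtain ⟨w, rfl, rfl⟩ := exists_inf V V' y y' (H.trans H'.symm)
  have hJ : C.J (V ⊓ V') := C.lower inf_le_left h
  obtain ⟨c, hc⟩ := (C.u_unit (V ⊓ V') V hJ h inf_le_left).map w.appTop.hom
  obtain ⟨c', hc'⟩ := (C.u_unit (V ⊓ V') V' hJ h' inf_le_right).map w.appTop.hom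
  have hw : w ≫ (V ⊓ V').ι = g ≫ x := by rw [← H, Category.assoc, Scheme.homOfLE_ι]
  refine ⟨(c * c'⁻¹ : Γ(S, ⊤)ˣ), Units.isUnit _, ?_⟩
  intro a ha
  rw [C.cc_compat _ V hJ h inf_le_left a ha g w hw, C.cc_compat _ V' hJ h' inf_le_right a ha g w hw]
  change w.appTop.hom _ * _ = _ * (w.appTop.hom _ * _)
  rw [← hc, ← hc', ← mul_assoc, ← Units.val_mul]
  simp

theorem bij_of_unit {Y : Scheme.{u}} {q : Y ⟶ Z} (s : Y ⟶ C.tot) (hs : s ≫ C.pi = q)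
    (hu : ∀ (V : Z.Opens) (h : C.J V) {S : Scheme.{u}} (g : S ⟶ Y) (y : S ⟶ V.toScheme) (H),
      IsUnit (C.cc V h s hs g y H)) {T : Scheme.{u}} (x : T ⟶ Y) :
    (∀ f f' : Γ(T, ⊤), C.sm f (x ≫ s) = C.sm f' (x ≫ s) → f = f') ∧
    ∀ a : T ⟶ C.tot, a ≫ C.pi = x ≫ q → ∃ f : Γ(T, ⊤), C.sm f (x ≫ s) = a := by
  have hxs : (x ≫ s) ≫ C.pi = x ≫ q := by rw [Category.assoc, hs]
  have hu' : ∀ (V : Z.Opens) (h : C.J V) {S : Scheme.{u}} (g : S ⟶ T) (y : S ⟶ V.toScheme) (H),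
      IsUnit (C.cc V h (x ≫ s) hxs g y H) := by
    intro V h S g y H
    rw [C.cc_comp V h s hs x hxs g y H (by rw [H, Category.assoc])]
    exact hu V h _ y _
  constructor
  · intro f f' hf
    apply C.fun_ext (x ≫ q)
    intro V h S g y H
    have := C.cc_congr V h hf (C.sm_pi f _ hxs) (C.sm_pi f' _ hxs) g y H H
    rw [C.cc_sm f _ hxs, C.cc_sm f' _ hxs] at this
    exact (hu' V h g y H).mul_right_cancel this
  · intro a ha
    have ch : ∀ (V : Z.Opens) (h : C.J V) {S : Scheme.{u}} (g : S ⟶ T) (y : S ⟶ V.toScheme) (H),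
      ∃ p : Γ(S, ⊤), p * C.cc V h (x ≫ s) hxs g y H = C.cc V h a ha g y H := by
      intro V h S g y H
      obtain ⟨c, hc⟩ := hu' V h g y H
      exact ⟨C.cc V h a ha g y H * ((c⁻¹ : Γ(S, ⊤)ˣ) : Γ(S, ⊤)), by rw [← hc]; simp⟩
    choose φ hφ using @ch
    obtain ⟨f, hf⟩ := C.fun_glue (x ≫ q) φ (by
      intro V h S S' k g y H H'
      apply (hu' V h _ _ H').mul_right_cancel
      rw [hφ, C.cc_nat V h a ha k g y H, C.cc_nat V h (x ≫ s) hxs k g y H, ← map_mul, hφ]) (by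
      intro V V' h h' S g y y' H H'
      obtain ⟨c, hc, hc'⟩ := C.cc_change V V' h h' g y y' H H'
      apply (hu' V h _ _ H).mul_right_cancel
      rw [hφ, hc', hc' (x ≫ s) hxs, ← hφ V' h']
      ring)
    refine ⟨f, C.cc_ext (x ≫ q) _ _ (C.sm_pi f _ hxs) ha ?_⟩
    intro V h S g y H
    rw [C.cc_sm f _ hxs, ← hf V h g y H, hφ]

theorem isFrame_of_unit (U : Z.Opens) (s : Fin 1 → (U.toScheme ⟶ C.tot)) (hs : s 0 ≫ C.pi = U.ι)
    (hu : ∀ (V : Z.Opens) (h : C.J V) {S : Scheme.{u}} (g : S ⟶ U.toScheme) (y : S ⟶ V.toScheme) (H),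
      IsUnit (C.cc V h (s 0) hs g y H)) : C.vbd.IsFrame U s := by
  refine ⟨fun i => by rw [Subsingleton.elim i 0]; exact hs, ?_⟩
  intro T x
  have := C.bij_of_unit (s 0) hs hu x
  constructor
  · intro f f' hff
    have h2 := congrArg Subtype.val hff
    simp only [Fin.sum_univ_one] at h2
    ext i
    rw [Subsingleton.elim i 0]
    exact this.1 _ _ h2
  · intro a
    obtain ⟨f, hf⟩ := this.2 a.1 a.2
    refine ⟨fun _ => f, ?_⟩
    apply Subtype.ext
    simp only [Fin.sum_univ_one]
    exact hf

theorem isGlobalFrame_of_unit (s : Fin 1 → (Z ⟶ C.tot)) (hs : s 0 ≫ C.pi = 𝟙 Z)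
    (hu : ∀ (V : Z.Opens) (h : C.J V) {S : Scheme.{u}} (g : S ⟶ Z) (y : S ⟶ V.toScheme) (H),
      IsUnit (C.cc V h (s 0) hs g y H)) : C.vbd.IsGlobalFrame s := by
  refine ⟨fun i => by rw [Subsingleton.elim i 0]; exact hs, ?_⟩
  intro T x
  have := C.bij_of_unit (s 0) hs hu x
  constructor
  · intro f f' hff
    have h2 := congrArg Subtype.val hff
    simp only [Fin.sum_univ_one] at h2
    ext i
    rw [Subsingleton.elim i 0]
    exact this.1 _ _ h2
  · intro a
    obtain ⟨f, hf⟩ := this.2 a.1 (a.2.trans (Category.comp_id _).symm)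
    refine ⟨fun _ => f, ?_⟩
    apply Subtype.ext
    simp only [Fin.sum_univ_one]
    exact hf

theorem unit_of_isFrame (U : Z.Opens) (s : Fin 1 → (U.toScheme ⟶ C.tot)) (hs : s 0 ≫ C.pi = U.ι)
    (hF : C.vbd.IsFrame U s)
    (V : Z.Opens) (h : C.J V) {S : Scheme.{u}} (g : S ⟶ U.toScheme) (y : S ⟶ V.toScheme) (H) :
      IsUnit (C.cc V h (s 0) hs g y H) := by
  obtain ⟨hs', hb⟩ := hF
  obtain ⟨f, hf⟩ := (hb g).2 ⟨pt y 1 ≫ C.inc V h, (C.pt_inc_pi V h y 1).trans H⟩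
  have h2 : C.sm (f 0) (g ≫ s 0) = pt y 1 ≫ C.inc V h := by
    have := congrArg Subtype.val hf
    simp only [Fin.sum_univ_one] at this
    exact this
  have hg : (g ≫ s 0) ≫ C.pi = g ≫ U.ι := by rw [Category.assoc, hs]
  have H' : y ≫ V.ι = 𝟙 S ≫ g ≫ U.ι := by rw [Category.id_comp, H]
  have h3 := C.cc_congr V h h2 (C.sm_pi _ _ hg) ((C.pt_inc_pi V h y 1).trans H) (𝟙 S) y H' H'
  rw [C.cc_sm _ _ hg, C.cc_comp V h (s 0) hs g hg (𝟙 S) y H' (by rw [H]; simp)] at h3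
  have h4 : C.cc V h (pt y 1 ≫ C.inc V h) ((C.pt_inc_pi V h y 1).trans H) (𝟙 S) y H' = 1 := by
    rw [cc]
    rw [C.coord_congr V h (Category.id_comp _) rfl _ (C.pt_inc_pi V h y 1).symm]
    exact C.coord_pt V h y 1 _
  rw [h4] at h3
  have h5 : C.cc V h (s 0) hs (𝟙 S ≫ g) y (by rw [H]; simp) = C.cc V h (s 0) hs g y H :=
    C.coord_congr V h (by simp) rfl _ _
  rw [h5] at h3
  exact IsUnit.of_mul_eq_one_right _ h3

def lb : LineBundle Z where
  toVecBundleData := C.vbd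
  locTriv z := by
    obtain ⟨V, h, hz⟩ := C.covers z
    have hp : (pt (𝟙 V.toScheme) 1 ≫ C.inc V h) ≫ C.pi = V.ι := by
      rw [C.pt_inc_pi V h (𝟙 _) 1, Category.id_comp]
    refine ⟨V, fun _ => pt (𝟙 _) 1 ≫ C.inc V h, hz, ?_⟩
    apply C.isFrame_of_unit V _ hp
    intro V' h' S g y H
    obtain ⟨c, hc, hc'⟩ := C.cc_change V' V h' h g y g H rfl
    have hcc := hc' _ hp
    refine (congrArg IsUnit hcc).mpr (hc.mul ?_)
    have : C.cc V h (pt (𝟙 V.toScheme) 1 ≫ C.inc V h) hp (g ≫ 𝟙 _) (g ≫ 𝟙 _) (by simp) = 1 := by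
      rw [C.cc_nat V h _ hp g (𝟙 _) (𝟙 _) rfl, cc, 
        C.coord_congr V h (Category.id_comp _) rfl _ (C.pt_inc_pi V h (𝟙 _) 1).symm, C.coord_pt, map_one]
    have e : C.cc V h (pt (𝟙 V.toScheme) 1 ≫ C.inc V h) hp g g rfl = 1 := by
      rw [← this]; exact C.coord_congr V h (by simp) (by simp) _ _
    rw [e]; exact isUnit_one

end Coc
end

noncomputable section
namespace Coc
variable {Z : Scheme.{u}} (C : Coc Z)

section tensor
variable (D E : Coc Z) (h1 : ∀ V, E.J V → C.J V) (h2 : ∀ V, E.J V → D.J V)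
  (hu : ∀ V V' h h' e, E.u V V' h h' e = C.u V V' (h1 _ h) (h1 _ h') e * D.u V V' (h2 _ h) (h2 _ h') e)

def mulF {T : Scheme.{u}} {x : T ⟶ Z} (a : T ⟶ C.tot) (b : T ⟶ D.tot) (ha : a ≫ C.pi = x)
    (hb : b ≫ D.pi = x) : E.Fam x where
  φ V h S g y H := C.cc V (h1 V h) a ha g y H * D.cc V (h2 V h) b hb g y H
  nat V h S S' k g y H H' := by rw [C.cc_nat _ _ _ _ _ _ _ H, D.cc_nat _ _ _ _ _ _ _ H, map_mul]
  compat V V' h h' e S g y H H' := by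
    rw [C.cc_compat V V' (h1 V h) (h1 V' h') e _ _ _ _ H, D.cc_compat V V' (h2 V h) (h2 V' h') e _ _ _ _ H, hu, map_mul]
    ring

def bt {T : Scheme.{u}} (a : T ⟶ C.tot) (b : T ⟶ D.tot) (h : a ≫ C.pi = b ≫ D.pi) : T ⟶ E.tot :=
  E.mkp (C.mulF D E h1 h2 hu a b rfl h.symm)

theorem bt_pi {T : Scheme.{u}} {x : T ⟶ Z} (a : T ⟶ C.tot) (b : T ⟶ D.tot)
    (h : a ≫ C.pi = b ≫ D.pi) (ha : a ≫ C.pi = x) :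
    C.bt D E h1 h2 hu a b h ≫ E.pi = x := by rw [bt, mkp_pi, ha]

theorem cc_bt {T S : Scheme.{u}} {x : T ⟶ Z} (a : T ⟶ C.tot) (b : T ⟶ D.tot)
    (h : a ≫ C.pi = b ≫ D.pi) (ha : a ≫ C.pi = x) (hb : b ≫ D.pi = x) (h0) (V : Z.Opens) (hV : E.J V)
    (g : S ⟶ T) (y : S ⟶ V.toScheme) (H : y ≫ V.ι = g ≫ x) :
    E.cc V hV (C.bt D E h1 h2 hu a b h) h0 g y H =
      C.cc V (h1 V hV) a ha g y H * D.cc V (h2 V hV) b hb g y H := by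
  subst ha
  exact E.cc_mkp (C.mulF D E h1 h2 hu a b rfl h.symm) V hV g y H

theorem bt_nat {T' T : Scheme.{u}} (g : T' ⟶ T) (a : T ⟶ C.tot) (b : T ⟶ D.tot) (h : a ≫ C.pi = b ≫ D.pi)
    (h' : (g ≫ a) ≫ C.pi = (g ≫ b) ≫ D.pi) :
    g ≫ C.bt D E h1 h2 hu a b h = C.bt D E h1 h2 hu (g ≫ a) (g ≫ b) h' := by
  have e := C.bt_pi D E h1 h2 hu a b h rfl
  have e' : (g ≫ C.bt D E h1 h2 hu a b h) ≫ E.pi = (g ≫ a) ≫ C.pi := by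
    rw [Category.assoc, e, Category.assoc]
  have e'' : (g ≫ b) ≫ D.pi = (g ≫ a) ≫ C.pi := h'.symm
  refine E.cc_ext ((g ≫ a) ≫ C.pi) _ _ e' (C.bt_pi D E h1 h2 hu (g ≫ a) (g ≫ b) h' rfl) ?_
  intro V hV S g' y H
  have H' : y ≫ V.ι = (g' ≫ g) ≫ a ≫ C.pi := by rw [H]; simp
  rw [E.cc_comp V hV (C.bt D E h1 h2 hu a b h) e g _ g' y H H',
    C.cc_bt D E h1 h2 hu a b h rfl h.symm, C.cc_bt D E h1 h2 hu (g ≫ a) (g ≫ b) h' rfl e'',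
    C.cc_comp V (h1 V hV) a rfl g _ g' y H H', D.cc_comp V (h2 V hV) b h.symm g _ g' y H H']

theorem bt_add1 {T : Scheme.{u}} (a a' : T ⟶ C.tot) (b : T ⟶ D.tot) (k1 k2 k3 k4 k5) :
    C.bt D E h1 h2 hu (C.ad a a' k1) b k2 = E.ad (C.bt D E h1 h2 hu a b k3) (C.bt D E h1 h2 hu a' b k4) k5 := by
  have e0 : a' ≫ C.pi = a ≫ C.pi := k1.symm
  have e1 : b ≫ D.pi = a ≫ C.pi := k3.symm
  have e2 := C.ad_pi a a' rfl k1
  have e3 := C.bt_pi D E h1 h2 hu a b k3 rfl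
  have e4 := C.bt_pi D E h1 h2 hu a' b k4 e0
  refine E.cc_ext (a ≫ C.pi) _ _ (C.bt_pi D E h1 h2 hu _ b k2 e2) (E.ad_pi _ _ e3 k5) ?_
  intro V hV S g y H
  refine (C.cc_bt D E h1 h2 hu _ b k2 e2 e1 _ V hV g y H).trans ?_
  refine Eq.trans ?_ (E.cc_ad _ _ e3 e4 k5 _ V hV g y H).symm
  rw [C.cc_ad a a' rfl e0 k1, C.cc_bt D E h1 h2 hu a b k3 rfl e1, 
    C.cc_bt D E h1 h2 hu a' b k4 e0 e1, add_mul]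

theorem bt_add2 {T : Scheme.{u}} (a : T ⟶ C.tot) (b b' : T ⟶ D.tot) (k1 k2 k3 k4 k5) :
    C.bt D E h1 h2 hu a (D.ad b b' k1) k2 = E.ad (C.bt D E h1 h2 hu a b k3) (C.bt D E h1 h2 hu a b' k4) k5 := by
  have e0 : b ≫ D.pi = a ≫ C.pi := k3.symm
  have e1 : b' ≫ D.pi = a ≫ C.pi := k4.symm
  have e2 := D.ad_pi b b' e0 k1
  have e3 := C.bt_pi D E h1 h2 hu a b k3 rfl
  have e4 := C.bt_pi D E h1 h2 hu a b' k4 rfl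
  refine E.cc_ext (a ≫ C.pi) _ _ (C.bt_pi D E h1 h2 hu a _ k2 rfl) (E.ad_pi _ _ e3 k5) ?_
  intro V hV S g y H
  refine (C.cc_bt D E h1 h2 hu a _ k2 rfl e2 _ V hV g y H).trans ?_
  refine Eq.trans ?_ (E.cc_ad _ _ e3 e4 k5 _ V hV g y H).symm
  rw [D.cc_ad b b' e0 e1 k1, C.cc_bt D E h1 h2 hu a b k3 rfl e0, 
    C.cc_bt D E h1 h2 hu a b' k4 rfl e1, mul_add]

theorem bt_sm1 {T : Scheme.{u}} (f : Γ(T, ⊤)) (a : T ⟶ C.tot) (b : T ⟶ D.tot) (k1 k2) :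
    C.bt D E h1 h2 hu (C.sm f a) b k1 = E.sm f (C.bt D E h1 h2 hu a b k2) := by
  have e0 : b ≫ D.pi = a ≫ C.pi := k2.symm
  have e2 := C.sm_pi f a rfl
  have e3 := C.bt_pi D E h1 h2 hu a b k2 rfl
  refine E.cc_ext (a ≫ C.pi) _ _ (C.bt_pi D E h1 h2 hu _ b k1 e2) (E.sm_pi _ _ e3) ?_
  intro V hV S g y H
  refine (C.cc_bt D E h1 h2 hu _ b k1 e2 e0 _ V hV g y H).trans ?_
  refine Eq.trans ?_ (E.cc_sm _ _ e3 _ V hV g y H).symm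
  rw [C.cc_sm f a rfl, C.cc_bt D E h1 h2 hu a b k2 rfl e0, mul_assoc]

theorem bt_sm2 {T : Scheme.{u}} (f : Γ(T, ⊤)) (a : T ⟶ C.tot) (b : T ⟶ D.tot) (k1 k2) :
    C.bt D E h1 h2 hu a (D.sm f b) k1 = E.sm f (C.bt D E h1 h2 hu a b k2) := by
  have e0 : b ≫ D.pi = a ≫ C.pi := k2.symm
  have e2 := D.sm_pi f b e0
  have e3 := C.bt_pi D E h1 h2 hu a b k2 rfl
  refine E.cc_ext (a ≫ C.pi) _ _ (C.bt_pi D E h1 h2 hu a _ k1 rfl) (E.sm_pi _ _ e3) ?_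
  intro V hV S g y H
  refine (C.cc_bt D E h1 h2 hu a _ k1 rfl e2 _ V hV g y H).trans ?_
  refine Eq.trans ?_ (E.cc_sm _ _ e3 _ V hV g y H).symm
  rw [D.cc_sm f b e0, C.cc_bt D E h1 h2 hu a b k2 rfl e0]
  ring

theorem isTensor (C D E : Coc Z) (h1 : ∀ V, E.J V → C.J V) (h2 : ∀ V, E.J V → D.J V)
    (hu : ∀ V V' h h' e, E.u V V' h h' e = C.u V V' (h1 _ h) (h1 _ h') e * D.u V V' (h2 _ h) (h2 _ h') e) :
    IsTensor C.lb D.lb E.lb := by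
  refine ⟨fun a b h => C.bt D E h1 h2 hu a b h, fun a b h => C.bt_pi D E h1 h2 hu a b h rfl,
    C.bt_nat D E h1 h2 hu, C.bt_add1 D E h1 h2 hu, C.bt_add2 D E h1 h2 hu, C.bt_sm1 D E h1 h2 hu,
    C.bt_sm2 D E h1 h2 hu, ?_⟩
  · intro U sL sM hL hM h
    have hsL : sL 0 ≫ C.pi = U.ι := hL.1 0
    have hsM : sM 0 ≫ D.pi = U.ι := hM.1 0
    refine E.isFrame_of_unit U _ (C.bt_pi D E h1 h2 hu (sL 0) (sM 0) h hsL) ?_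
    intro V hV S g y H
    refine (congrArg IsUnit (C.cc_bt D E h1 h2 hu (sL 0) (sM 0) h hsL hsM _ V hV g y H)).mpr ?_
    exact (C.unit_of_isFrame U sL hsL hL V _ g y H).mul (D.unit_of_isFrame U sM hsM hM V _ g y H)


end tensor

def pw (m : ℕ) : Coc Z where
  J := C.J
  lower := C.lower
  covers := C.covers
  u V V' h h' e := C.u V V' h h' e ^ m
  u_unit V V' h h' e := (C.u_unit V V' h h' e).pow m
  u_id V h h' e := by rw [C.u_id, one_pow]
  u_comp V V' V'' h h' h'' e e' e'' := by
    rw [C.u_comp V V' V'' h h' h'' e e' e'', mul_pow, map_pow]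

theorem isTensorPow (m : ℕ) : IsTensorPow C.lb m (C.pw m).lb := by
  induction m with
  | zero =>
    have hs : ∀ V V' (h : (C.pw 0).J V) (h' : (C.pw 0).J V') (e : V ≤ V'), (Z.homOfLE e).appTop
        (1 : Γ(V'.toScheme, ⊤)) = (C.pw 0).u V V' h h' e * 1 := by
      intro V V' h h' e
      rw [map_one, mul_one]
      exact (pow_zero _).symm
    refine ⟨fun _ => (C.pw 0).mkp ((C.pw 0).secF (fun V h => 1) hs (𝟙 Z)), ?_⟩
    apply (C.pw 0).isGlobalFrame_of_unit _ ((C.pw 0).mkp_pi _)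
    intro V h S g y H
    refine (congrArg IsUnit ((C.pw 0).cc_mkp _ V h g y H)).mpr ?_
    change IsUnit (y.appTop 1)
    rw [map_one]; exact isUnit_one
  | succ m ih =>
    exact ⟨(C.pw m).lb, ih, (C.pw m).isTensor C (C.pw (m + 1)) (fun _ h => h) (fun _ h => h)
      (fun V V' h h' e => pow_succ _ _)⟩

theorem pt_ne_iff {V : Z.Opens} (f : Γ(V.toScheme, ⊤)) (y : V.toScheme) :
    pt (𝟙 V.toScheme) f y ≠ pt (𝟙 V.toScheme) 0 y ↔ y ∈ V.toScheme.basicOpen f := by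
  constructor
  · intro hne
    by_contra hy
    apply hne
    have key : (V.toScheme.fromSpecResidueField y).appTop f = 0 := by
      by_contra h0
      apply hy
      have hF : IsField Γ(Spec (V.toScheme.residueField y), ⊤) :=
        MulEquiv.isField (Field.toIsField (V.toScheme.residueField y)) (Scheme.ΓSpecIso (V.toScheme.residueField y)).commRingCatIsoToRingEquiv.toMulEquiv
      obtain ⟨b, hb⟩ := hF.mul_inv_cancel h0
      have hun : IsUnit ((V.toScheme.fromSpecResidueField y).appTop f) := IsUnit.of_mul_eq_one _ hb
      have h1 := Scheme.preimage_basicOpen_top (V.toScheme.fromSpecResidueField y) f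
      rw [Scheme.basicOpen_of_isUnit _ hun] at h1
      have h2 : (default : Spec (V.toScheme.residueField y)) ∈ (V.toScheme.fromSpecResidueField y) ⁻¹ᵁ V.toScheme.basicOpen f := by
        rw [h1]; trivial
      have h3 : V.toScheme.fromSpecResidueField y default ∈ V.toScheme.basicOpen f := h2
      rwa [Scheme.fromSpecResidueField_apply] at h3
    have e : V.toScheme.fromSpecResidueField y ≫ pt (𝟙 V.toScheme) f =
        V.toScheme.fromSpecResidueField y ≫ pt (𝟙 V.toScheme) 0 := by
      apply AA_ext
      · rw [Category.assoc, Category.assoc, pt_prj, pt_prj]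
      · rw [comp_crd, comp_crd, pt_crd, pt_crd, key, map_zero]
    have := congrArg (fun q => q default) e
    simp only [Scheme.Hom.comp_apply, Scheme.fromSpecResidueField_apply] at this
    exact this
  · intro hy he
    have h1 := Scheme.preimage_basicOpen_top (pt (𝟙 V.toScheme) f) (crd V)
    have h2 := Scheme.preimage_basicOpen_top (pt (𝟙 V.toScheme) 0) (crd V)
    rw [pt_crd] at h1 h2
    rw [← h1] at hy
    have : y ∈ pt (𝟙 V.toScheme) 0 ⁻¹ᵁ (AA V).basicOpen (crd V) := by
      have hy' : pt (𝟙 V.toScheme) f y ∈ (AA V).basicOpen (crd V) := hy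
      rw [he] at hy'; exact hy'
    rw [h2, Scheme.basicOpen_zero] at this
    exact this

theorem sec_ne_iff (s : ∀ V, C.J V → Γ(V.toScheme, ⊤))
    (hs : ∀ V V' (h : C.J V) (h' : C.J V') (e : V ≤ V'), (Z.homOfLE e).appTop (s V' h') =
      C.u V V' h h' e * s V h) (V : Z.Opens) (h : C.J V) (y : V.toScheme) :
    C.mkp (C.secF s hs (𝟙 Z)) (V.ι y) ≠ C.zer (V.ι y) ↔ y ∈ V.toScheme.basicOpen (s V h) := by
  rw [← pt_ne_iff]
  have e1 : V.ι ≫ C.mkp (C.secF s hs (𝟙 Z)) = pt (𝟙 V.toScheme) (s V h) ≫ C.inc V h := by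
    have H : 𝟙 V.toScheme ≫ V.ι = (V.ι ≫ C.mkp (C.secF s hs (𝟙 Z))) ≫ C.pi := by
      rw [Category.assoc, mkp_pi]; simp
    rw [C.eq_pt V h _ (𝟙 _) H, C.coord_mkp _ V h V.ι (𝟙 _) _ (by simp)]
    change pt (𝟙 _) ((𝟙 V.toScheme : V.toScheme ⟶ V.toScheme).appTop (s V h)) ≫ _ = _
    simp
  have e2 : V.ι ≫ C.zer = pt (𝟙 V.toScheme) 0 ≫ C.inc V h := by
    have H : 𝟙 V.toScheme ≫ V.ι = (V.ι ≫ C.zer) ≫ C.pi := by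
      rw [C.zer_pi]; simp
    rw [C.eq_pt V h _ (𝟙 _) H]
    congr 2
    exact C.cc_zer V.ι V h (C.zer_pi _) (𝟙 _) (𝟙 _) rfl |> fun q => (C.coord_congr V h (by simp) rfl _ _).trans q
  have i : IsOpenImmersion (C.inc V h) := MorphismProperty.of_isPullback (C.inc_isPullback V h) inferInstance
  rw [← Scheme.Hom.comp_apply, ← Scheme.Hom.comp_apply, e1, e2, Scheme.Hom.comp_apply,
    Scheme.Hom.comp_apply, (C.inc V h).isOpenEmbedding.injective.ne_iff]

/-- ampleness criterion -/
theorem ample_of [CompactSpace Z] [QuasiSeparatedSpace Z]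
    (H : ∀ z : Z, ∃ m : ℕ, 0 < m ∧ ∃ s : ∀ V, C.J V → Γ(V.toScheme, ⊤),
      (∀ V V' (h : C.J V) (h' : C.J V') (e : V ≤ V'), (Z.homOfLE e).appTop (s V' h') =
        C.u V V' h h' e ^ m * s V h) ∧
      ∃ U : Z.Opens, IsAffineOpen U ∧ z ∈ U ∧ ∀ V (h : C.J V) (y : V.toScheme),
        V.ι y ∈ U ↔ y ∈ V.toScheme.basicOpen (s V h)) : IsAmple C.lb := by
  refine ⟨inferInstance, inferInstance, fun z => ?_⟩
  obtain ⟨m, hm, s, hs, U, hU, hz, h⟩ := H z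
  refine ⟨m, hm, (C.pw m).lb, C.isTensorPow m, (C.pw m).mkp ((C.pw m).secF s hs (𝟙 Z)),
    (C.pw m).mkp_pi _, U, hU, hz, ?_⟩
  ext y
  obtain ⟨V, hV, hy⟩ := C.covers y
  obtain ⟨y, rfl⟩ : ∃ y' : V.toScheme, V.ι y' = y := ⟨⟨_, hy⟩, rfl⟩
  exact (h V hV y).trans ((C.pw m).sec_ne_iff s hs V hV y).symm

end Coc
end

noncomputable section
namespace Rat
variable {Z : Scheme.{u}} [IsIntegral Z]

/-- the local ring at `x` as a subring of the function field -/
def loc (Z : Scheme.{u}) [IsIntegral Z] (x : Z) : Subring Z.functionField :=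
  (algebraMap (Z.presheaf.stalk x) Z.functionField).range

theorem inj (x : Z) : Function.Injective (algebraMap (Z.presheaf.stalk x) Z.functionField) :=
  IsFractionRing.injective _ _

def Val {V : Z.Opens} (s : Γ(Z, V)) (h : Z.functionField) : Prop :=
  ∀ x (hx : x ∈ V), algebraMap (Z.presheaf.stalk x) Z.functionField (Z.presheaf.germ V x hx s) = h

theorem Val.uniq {V : Z.Opens} {s t : Γ(Z, V)} {h : Z.functionField} (hs : Val s h) (ht : Val t h) :
    s = t := by
  apply TopCat.Presheaf.section_ext Z.sheaf V
  intro x hx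
  exact inj x ((hs x hx).trans (ht x hx).symm)

theorem Val.mul {V : Z.Opens} {s t : Γ(Z, V)} {h h' : Z.functionField} (hs : Val s h) (ht : Val t h') :
    Val (s * t) (h * h') := fun x hx => by
  rw [map_mul, map_mul, hs x hx, ht x hx]

theorem Val.pow {V : Z.Opens} {s : Γ(Z, V)} {h : Z.functionField} (hs : Val s h) (m : ℕ) :
    Val (s ^ m) (h ^ m) := fun x hx => by
  rw [map_pow, map_pow, hs x hx]

theorem val_one {V : Z.Opens} : Val (1 : Γ(Z, V)) 1 := fun x hx => by
  rw [map_one, map_one]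

theorem Val.res {V V' : Z.Opens} (e : V ≤ V') {s : Γ(Z, V')} {h : Z.functionField} (hs : Val s h) :
    Val (Z.presheaf.map (homOfLE e).op s) h := fun x hx => by
  rw [TopCat.Presheaf.germ_res_apply, hs x (e hx)]

theorem Val.mem_loc {V : Z.Opens} {s : Γ(Z, V)} {h : Z.functionField} (hs : Val s h) {x : Z} (hx : x ∈ V) :
    h ∈ loc Z x := ⟨_, hs x hx⟩

theorem val_self {V : Z.Opens} (s : Γ(Z, V)) {x : Z} (hx : x ∈ V) :
    Val s (algebraMap (Z.presheaf.stalk x) Z.functionField (Z.presheaf.germ V x hx s)) := by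
  intro y hy
  have : Nonempty V := ⟨⟨x, hx⟩⟩
  rw [Scheme.algebraMap_germ_eq_germToFunctionField, Scheme.algebraMap_germ_eq_germToFunctionField]

theorem exists_nhd {x : Z} {h : Z.functionField} (hx : h ∈ loc Z x) :
    ∃ V : Z.Opens, x ∈ V ∧ ∃ s : Γ(Z, V), Val s h := by
  obtain ⟨a, rfl⟩ := hx
  obtain ⟨V, hxV, s, rfl⟩ := TopCat.Presheaf.exists_germ_eq Z.presheaf a
  exact ⟨V, hxV, s, val_self s hxV⟩

theorem exists_val (V : Z.Opens) (h : Z.functionField) (hV : ∀ x ∈ V, h ∈ loc Z x) :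
    ∃ s : Γ(Z, V), Val s h := by
  have h1 : ∀ x : V, ∃ W : Z.Opens, x.1 ∈ W ∧ W ≤ V ∧ ∃ s : Γ(Z, W), Val s h := by
    intro x
    obtain ⟨W, hW, s, hs⟩ := exists_nhd (hV x.1 x.2)
    exact ⟨W ⊓ V, ⟨hW, x.2⟩, inf_le_right, _, hs.res inf_le_left⟩
  choose W hxW hWV s hs using h1
  obtain ⟨t, ht, -⟩ := Z.sheaf.existsUnique_gluing' W V (fun i => homOfLE (hWV i))
    (fun x hx => TopologicalSpace.Opens.mem_iSup.mpr ⟨⟨x, hx⟩, hxW _⟩) s (by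
      intro i j
      exact ((hs i).res inf_le_left).uniq ((hs j).res inf_le_right))
  refine ⟨t, fun x hx => ?_⟩
  rw [← hs ⟨x, hx⟩ x (hxW _), ← ht ⟨x, hx⟩]
  congr 1
  exact (TopCat.Presheaf.germ_res_apply Z.presheaf (homOfLE (hWV ⟨x, hx⟩)) x (hxW ⟨x, hx⟩) t).symm

theorem Val.isUnit {V : Z.Opens} {s : Γ(Z, V)} {h : Z.functionField} (hs : Val s h) (h0 : h ≠ 0)
    (hV : ∀ x ∈ V, h⁻¹ ∈ loc Z x) : IsUnit s := by
  obtain ⟨t, ht⟩ := exists_val V _ hV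
  have := hs.mul ht
  rw [mul_inv_cancel₀ h0] at this
  exact IsUnit.of_mul_eq_one _ (this.uniq val_one)

theorem Val.mem_basicOpen {V : Z.Opens} {s : Γ(Z, V)} {h : Z.functionField} (hs : Val s h) {x : Z}
    (hx : x ∈ V) : x ∈ Z.basicOpen s ↔ h ≠ 0 ∧ h⁻¹ ∈ loc Z x := by
  rw [Scheme.mem_basicOpen _ _ _ hx]
  have e := hs x hx
  constructor
  · intro hu
    obtain ⟨b, hb⟩ := hu.exists_right_inv
    have := congrArg (algebraMap (Z.presheaf.stalk x) Z.functionField) hb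
    rw [map_mul, e, map_one] at this
    refine ⟨left_ne_zero_of_mul_eq_one this, b, ?_⟩
    exact (inv_eq_of_mul_eq_one_right this).symm
  · rintro ⟨h0, b, hb⟩
    apply IsUnit.of_mul_eq_one b
    apply inj x
    rw [map_mul, e, hb, map_one, mul_inv_cancel₀ h0]

/-! now with sections of `V.toScheme` -/

def sec (V : Z.Opens) (h : Z.functionField) : Γ(V.toScheme, ⊤) :=
  open Classical in
  if hV : ∀ x ∈ V, h ∈ loc Z x then V.topIso.inv (exists_val V h hV).choose else 0

theorem sec_eq {V : Z.Opens} {h : Z.functionField} {s : Γ(Z, V)} (hs : Val s h) :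
    sec V h = V.topIso.inv s := by
  have hV : ∀ x ∈ V, h ∈ loc Z x := fun x hx => hs.mem_loc hx
  rw [sec, dif_pos hV, (exists_val V h hV).choose_spec.uniq hs]

theorem sec_mul {V : Z.Opens} {h h' : Z.functionField} (hV : ∀ x ∈ V, h ∈ loc Z x)
    (hV' : ∀ x ∈ V, h' ∈ loc Z x) : sec V (h * h') = sec V h * sec V h' := by
  obtain ⟨s, hs⟩ := exists_val V h hV
  obtain ⟨t, ht⟩ := exists_val V h' hV'
  rw [sec_eq hs, sec_eq ht, sec_eq (hs.mul ht), map_mul]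

theorem sec_pow {V : Z.Opens} {h : Z.functionField} (hV : ∀ x ∈ V, h ∈ loc Z x) (m : ℕ) :
    sec V (h ^ m) = sec V h ^ m := by
  obtain ⟨s, hs⟩ := exists_val V h hV
  rw [sec_eq hs, sec_eq (hs.pow m), map_pow]

theorem sec_one {V : Z.Opens} : sec V 1 = 1 := by
  rw [sec_eq val_one, map_one]

theorem sec_isUnit {V : Z.Opens} {h : Z.functionField} (h0 : h ≠ 0) (hV : ∀ x ∈ V, h ∈ loc Z x)
    (hV' : ∀ x ∈ V, h⁻¹ ∈ loc Z x) : IsUnit (sec V h) := by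
  obtain ⟨s, hs⟩ := exists_val V h hV
  rw [sec_eq hs]
  exact (hs.isUnit h0 hV').map V.topIso.inv.hom

theorem topIso_inv_res {V V' : Z.Opens} (e : V ≤ V') (s : Γ(Z, V')) :
    (Z.homOfLE e).appTop (V'.topIso.inv s) = V.topIso.inv (Z.presheaf.map (homOfLE e).op s) := by
  have : V'.topIso.inv ≫ (Z.homOfLE e).appTop = Z.presheaf.map (homOfLE e).op ≫ V.topIso.inv := by
    rw [Scheme.homOfLE_appTop, Scheme.Opens.topIso_inv, Scheme.Opens.topIso_inv]
    erw [← Functor.map_comp, ← Functor.map_comp]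
    rfl
  exact congrArg (fun f => f.hom s) this

theorem sec_res {V V' : Z.Opens} (e : V ≤ V') {h : Z.functionField} (hV : ∀ x ∈ V', h ∈ loc Z x) :
    (Z.homOfLE e).appTop (sec V' h) = sec V h := by
  obtain ⟨s, hs⟩ := exists_val V' h hV
  rw [sec_eq hs, sec_eq (hs.res e), topIso_inv_res]

theorem mem_basicOpen_sec {V : Z.Opens} {h : Z.functionField} (hV : ∀ x ∈ V, h ∈ loc Z x)
    (y : V.toScheme) : y ∈ V.toScheme.basicOpen (sec V h) ↔ h ≠ 0 ∧ h⁻¹ ∈ loc Z (V.ι y) := by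
  obtain ⟨s, hs⟩ := exists_val V h hV
  have hy : V.ι y ∈ V := y.2
  rw [sec_eq hs, ← hs.mem_basicOpen hy, ← Scheme.Opens.ι_image_basicOpen_topIso_inv (U := V)]
  generalize V.toScheme.basicOpen (V.topIso.inv s) = B
  change _ ↔ V.ι y ∈ V.ι '' (B : Set V.toScheme)
  rw [V.ι.isOpenEmbedding.injective.mem_set_image]
  rfl

/-! the cocycle of a family of rational functions -/
section
variable {I : Type*} (p : I → Z.functionField)

def Good (i : I) (x : Z) : Prop := p i ≠ 0 ∧ ∀ j, p j / p i ∈ loc Z x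

def coc [Finite I] (hp : ∀ x : Z, ∃ i, Good p i x) : Coc Z where
  J V := ∃ i, p i ≠ 0 ∧ ∀ x ∈ V, Good p i x
  lower := fun {V V'} e ⟨i, h0, h⟩ => ⟨i, h0, fun x hx => h x (e hx)⟩
  covers z := by
    obtain ⟨i, hi⟩ := hp z
    choose W hzW s hs using fun j => exists_nhd (hi.2 j)
    refine ⟨⟨⋂ j, (W j : Set Z), isOpen_iInter_of_finite fun j => (W j).2⟩, 
      ⟨i, hi.1, fun x hx => ⟨hi.1, fun j => (hs j).mem_loc (Set.mem_iInter.mp hx j)⟩⟩,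
      Set.mem_iInter.mpr hzW⟩
  u V V' h h' e := sec V (p h.choose / p h'.choose)
  u_unit V V' h h' e := by
    apply sec_isUnit (div_ne_zero h.choose_spec.1 h'.choose_spec.1)
    · intro x hx; exact (h'.choose_spec.2 x (e hx)).2 _
    · intro x hx; rw [inv_div]; exact (h.choose_spec.2 x hx).2 _
  u_id V h h' e := by rw [div_self h.choose_spec.1, sec_one]
  u_comp V V' V'' h h' h'' e e' e'' := by
    rw [sec_res e (fun x hx => (h''.choose_spec.2 x (e' hx)).2 _), 
      ← sec_mul (fun x hx => (h'.choose_spec.2 x (e hx)).2 _)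
        (fun x hx => (h''.choose_spec.2 x (e'' hx)).2 _), div_mul_div_cancel₀ h'.choose_spec.1]

theorem exists_ample [Finite I] [CompactSpace Z] [QuasiSeparatedSpace Z] 
    (hp : ∀ x : Z, ∃ i, Good p i x)
    (H : ∀ z : Z, ∃ m : ℕ, 0 < m ∧ ∃ h : Z.functionField,
      (∀ x i, Good p i x → h / p i ^ m ∈ loc Z x) ∧
      ∃ U : Z.Opens, IsAffineOpen U ∧ z ∈ U ∧ ∀ x i, Good p i x →
        (x ∈ U ↔ h ≠ 0 ∧ p i ^ m / h ∈ loc Z x)) : ∃ L : LineBundle Z, IsAmple L := by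
  refine ⟨(coc p hp).lb, (coc p hp).ample_of ?_⟩
  intro z
  obtain ⟨m, hm, h, h1, U, hU, hz, h2⟩ := H z
  refine ⟨m, hm, fun V (hV : ∃ i, p i ≠ 0 ∧ ∀ x ∈ V, Good p i x) => sec V (h / p hV.choose ^ m),
    ?_, U, hU, hz, ?_⟩
  · intro V V' (h' : ∃ i, p i ≠ 0 ∧ ∀ x ∈ V, Good p i x) 
      (h'' : ∃ i, p i ≠ 0 ∧ ∀ x ∈ V', Good p i x) e
    change _ = sec V (p h'.choose / p h''.choose) ^ m * _
    rw [sec_res e (fun x hx => h1 x _ (h''.choose_spec.2 x hx)), 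
      ← sec_pow (fun x hx => (h''.choose_spec.2 x (e hx)).2 _), ← sec_mul]
    · congr 1
      have a1 := h'.choose_spec.1
      have a2 := h''.choose_spec.1
      rw [div_pow]; field_simp
    · intro x hx
      exact Subring.pow_mem _ ((h''.choose_spec.2 x (e hx)).2 _) _
    · intro x hx
      exact h1 x _ (h'.choose_spec.2 x hx)
  · intro V (hV : ∃ i, p i ≠ 0 ∧ ∀ x ∈ V, Good p i x) y
    rw [mem_basicOpen_sec (fun x hx => h1 x _ (hV.choose_spec.2 x hx)),
      h2 _ _ (hV.choose_spec.2 (V.ι y) y.2), inv_div]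
    have a1 := hV.choose_spec.1
    have : h / p hV.choose ^ m ≠ 0 ↔ h ≠ 0 := by
      rw [div_ne_zero_iff]; simp [a1]
    rw [this]
end
end Rat
end

noncomputable section
namespace Alg

/-- At most one nonzero prime below `q`. -/
def Ht1 {R : Type*} [CommRing R] (q : Ideal R) : Prop :=
  ∀ p : Ideal R, p.IsPrime → p ≤ q → p = ⊥ ∨ p = q

theorem principal_of_colon {N : Type*} [CommRing N] [IsDomain N] [IsNoetherianRing N]
    [IsIntegrallyClosed N] [IsLocalRing N] (a b : N) (hb : b ≠ 0)
    (hbm : b ∈ IsLocalRing.maximalIdeal N)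
    (h : ∀ s, s ∈ IsLocalRing.maximalIdeal N ↔ b ∣ s * a) :
    (IsLocalRing.maximalIdeal N).IsPrincipal := by
  classical
  let K := FractionRing N
  have inj : Function.Injective (algebraMap N K) := IsFractionRing.injective N K
  have hb' : algebraMap N K b ≠ 0 := by
    intro h0; exact hb (inj (by rw [h0, map_zero]))
  let x : K := algebraMap N K a / algebraMap N K b
  let M := Submodule.map (Algebra.linearMap N K) (IsLocalRing.maximalIdeal N)
  have key : ∀ y ∈ IsLocalRing.maximalIdeal N, ∃ z : N, x * algebraMap N K y = algebraMap N K z := by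
    intro y hy
    obtain ⟨z, hz⟩ := (h y).1 hy
    refine ⟨z, ?_⟩
    simp only [x]
    rw [div_mul_eq_mul_div, div_eq_iff hb', ← map_mul, ← map_mul, mul_comm a y, hz, mul_comm]
  by_cases hx : ∀ y ∈ M, x * y ∈ M
  · exfalso
    have := isIntegral_of_smul_mem_submodule M ?_ ?_ x hx
    · obtain ⟨y, e⟩ := IsIntegrallyClosed.algebraMap_eq_of_integral this
      have : b ∣ 1 * a := by
        refine ⟨y, inj ?_⟩
        rw [map_mul, map_mul, map_one, e]
        simp only [x]
        rw [_root_.one_mul, mul_div_cancel₀ _ hb']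
      exact (Ideal.ne_top_iff_one _).1 (IsLocalRing.maximalIdeal.isMaximal N).ne_top ((h 1).2 this)
    · rw [Submodule.ne_bot_iff]
      exact ⟨_, ⟨b, hbm, rfl⟩, hb'⟩
    · apply Submodule.FG.map; exact IsNoetherian.noetherian _
  · push Not at hx
    obtain ⟨y, ⟨y', hy', rfl⟩, hy⟩ := hx
    obtain ⟨z, hz⟩ := key y' hy'
    have hzu : IsUnit z := by
      by_contra hzn
      exact hy ⟨z, (IsLocalRing.mem_maximalIdeal z).2 hzn, hz.symm⟩
    obtain ⟨u, rfl⟩ := hzu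
    refine ⟨⟨y', le_antisymm ?_ ?_⟩⟩
    · intro w hw
      obtain ⟨v, hv⟩ := key w hw
      rw [Ideal.submodule_span_eq, Ideal.mem_span_singleton]
      refine ⟨v * ((u⁻¹ : Nˣ) : N), inj ?_⟩
      have hu : algebraMap N K (u : N) * algebraMap N K ((u⁻¹ : Nˣ) : N) = 1 := by
        rw [← map_mul, Units.mul_inv, map_one]
      rw [map_mul, map_mul, ← hv]
      calc algebraMap N K w = (x * algebraMap N K y') * algebraMap N K ((u⁻¹ : Nˣ) : N) * algebraMap N K w := by
            rw [hz, hu, _root_.one_mul]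
        _ = _ := by ring
    · rw [Ideal.submodule_span_eq, Ideal.span_singleton_le_iff_mem]; exact hy'

theorem colon_prime {M : Type*} [CommRing M] [IsDomain M] [IsNoetherianRing M]
    [IsIntegrallyClosed M] (a b : M) (hb : b ≠ 0) (q : Ideal M) [hq : q.IsPrime]
    (h : ∀ s, s ∈ q ↔ b ∣ s * a) :
    Ht1 q ∧ ∀ x y : M, ∃ s, s ∉ q ∧ (x ∣ s * y ∨ y ∣ s * x) := by
  classical
  let N := Localization.AtPrime q
  haveI : IsDomain N := IsLocalization.isDomain_localization q.primeCompl_le_nonZeroDivisors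
  have inj : Function.Injective (algebraMap M N) :=
    IsLocalization.injective N q.primeCompl_le_nonZeroDivisors
  haveI : IsNoetherianRing N := IsLocalization.isNoetherianRing q.primeCompl N inferInstance
  haveI : IsIntegrallyClosed N := isIntegrallyClosed_of_isLocalization N q.primeCompl q.primeCompl_le_nonZeroDivisors
  have hmem : ∀ s : M, algebraMap M N s ∈ IsLocalRing.maximalIdeal N ↔ s ∈ q := by
    intro s
    exact IsLocalization.AtPrime.to_map_mem_maximal_iff N q s
  have hbq : b ∈ q := (h b).2 ⟨a, rfl⟩
  have hdvd : ∀ x y : M, algebraMap M N x ∣ algebraMap M N y → ∃ s, s ∉ q ∧ x ∣ s * y := by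
    rintro x y ⟨z, hz⟩
    obtain ⟨⟨z', s⟩, hs⟩ := IsLocalization.surj q.primeCompl z
    refine ⟨s, s.2, z', inj ?_⟩
    rw [map_mul, map_mul, ← hs, hz]; ring
  have hP : (IsLocalRing.maximalIdeal N).IsPrincipal := by
    refine principal_of_colon (algebraMap M N a) (algebraMap M N b) ?_ ((hmem b).2 hbq) ?_
    · intro h0; exact hb (inj (by rw [h0, map_zero]))
    · intro s
      obtain ⟨⟨s', t⟩, hs⟩ := IsLocalization.surj q.primeCompl s
      have ht : IsUnit (algebraMap M N t) := IsLocalization.map_units N t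
      have e1 : s ∈ IsLocalRing.maximalIdeal N ↔ s' ∈ q := by
        rw [← hmem, ← hs, Ideal.mul_unit_mem_iff_mem _ ht]
      rw [e1]
      have e2 : algebraMap M N b ∣ s * algebraMap M N a ↔ algebraMap M N b ∣ algebraMap M N (s' * a) := by
        rw [map_mul, ← hs, mul_right_comm, ht.dvd_mul_right]
      rw [e2, h]
      constructor
      · exact fun hd => map_dvd _ hd
      · intro hd
        obtain ⟨c, hc, hcd⟩ := hdvd _ _ hd
        rw [← h]
        have : c * s' ∈ q := by rw [h, mul_assoc]; exact hcd
        exact (hq.mem_or_mem this).resolve_left hc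
  have T := tfae_of_isNoetherianRing_of_isLocalRing_of_isDomain N
  have hV : ValuationRing N := (T.out 4 1).1 hP
  have h4' : IsIntegrallyClosed N ∧ ∀ P : Ideal N, P ≠ ⊥ → P.IsPrime →
      P = IsLocalRing.maximalIdeal N := (T.out 4 3).1 hP
  have h4 := h4'.2
  constructor
  · intro p hp hpq
    by_cases hp0 : p = ⊥
    · exact Or.inl hp0
    right
    have hd : Disjoint (q.primeCompl : Set M) p := by
      rw [Set.disjoint_left]; exact fun x hx hx' => hx (hpq hx')
    have hp' := IsLocalization.isPrime_of_isPrime_disjoint q.primeCompl N p hp hd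
    have hc := IsLocalization.comap_map_of_isPrime_disjoint q.primeCompl N hp hd
    have := h4 (p.map (algebraMap M N)) (by
      intro h0; rw [Ideal.map_eq_bot_iff_of_injective inj] at h0; exact hp0 h0) hp'
    rw [this] at hc
    rw [← hc]
    ext s
    rw [Ideal.mem_comap]; exact hmem s
  · intro x y
    rcases ValuationRing.dvd_total (algebraMap M N x) (algebraMap M N y) with hd | hd
    · obtain ⟨s, h1, h2⟩ := hdvd _ _ hd; exact ⟨s, h1, Or.inl h2⟩
    · obtain ⟨s, h1, h2⟩ := hdvd _ _ hd; exact ⟨s, h1, Or.inr h2⟩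

/-- Hartogs: a fraction `a/b` not in `M_𝔭` fails to be in `M_q` for a height one `q ≤ 𝔭`. -/
theorem hartogs {M : Type*} [CommRing M] [IsDomain M] [IsNoetherianRing M]
    [IsIntegrallyClosed M] (a b : M) (hb : b ≠ 0) (p : Ideal M) (hp : p.IsPrime)
    (H : ∀ s, b ∣ s * a → s ∈ p) :
    ∃ q : Ideal M, q.IsPrime ∧ q ≤ p ∧ q ≠ ⊥ ∧ Ht1 q ∧
      (∀ x y : M, ∃ s, s ∉ q ∧ (x ∣ s * y ∨ y ∣ s * x)) ∧ ∀ s, b ∣ s * a → s ∈ q := by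
  classical
  let I : Ideal M := Submodule.comap (LinearMap.mulRight M a) (Ideal.span {b})
  have hI : ∀ s, s ∈ I ↔ b ∣ s * a := by
    intro s; rw [Submodule.mem_comap, Ideal.mem_span_singleton]; rfl
  have hIp : I ≤ p := fun s hs => H s ((hI s).1 hs)
  obtain ⟨q, hq, hqp⟩ := Ideal.exists_minimalPrimes_le hIp
  have hA := Module.associatedPrimes.minimalPrimes_annihilator_subset_associatedPrimes M (M ⧸ I)
  rw [Ideal.annihilator_quotient] at hA
  obtain ⟨hqp', x, hx⟩ := isAssociatedPrime_iff.1 (hA hq)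
  obtain ⟨c, rfl⟩ := Ideal.Quotient.mk_surjective x
  have hc : ∀ s, s ∈ q ↔ b ∣ s * (c * a) := by
    intro s
    rw [hx, Submodule.mem_colon_singleton, Submodule.mem_bot, ← mul_assoc, ← hI,
      ← Ideal.Quotient.eq_zero_iff_mem, map_mul]
    rfl
  obtain ⟨h1, h2⟩ := colon_prime (c * a) b hb q hc
  refine ⟨q, hqp', hqp, ?_, h1, h2, fun s hs => hq.1.2 ((hI s).2 hs)⟩
  rintro rfl
  exact hb ((hc b).2 ⟨_, rfl⟩)

end Alg
end

noncomputable section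
namespace Alg
open MvPolynomial in
theorem icl (n : ℕ) (O : Type*) [CommRing O] [IsDomain O] [IsIntegrallyClosed O] :
    IsIntegrallyClosed (MvPolynomial (Fin n) O) := by
  induction n with
  | zero => exact IsIntegrallyClosed.of_equiv (MvPolynomial.isEmptyRingEquiv O (Fin 0)).symm
  | succ n ih => exact IsIntegrallyClosed.of_equiv (MvPolynomial.finSuccEquiv O n).toRingEquiv.symm

theorem mapC_prime {σ O : Type*} [CommRing O] (y : Ideal O) [y.IsPrime] :
    (y.map (MvPolynomial.C (σ := σ))).IsPrime := by
  have : y.map (MvPolynomial.C (σ := σ)) =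
      RingHom.ker (MvPolynomial.map (σ := σ) (Ideal.Quotient.mk y)) := by
    ext f
    rw [MvPolynomial.mem_map_C_iff, RingHom.mem_ker, MvPolynomial.ext_iff]
    refine forall_congr' fun m => ?_
    rw [MvPolynomial.coeff_map, MvPolynomial.coeff_zero, Ideal.Quotient.eq_zero_iff_mem]
  rw [this]
  exact RingHom.ker_isPrime _

theorem trich {σ O : Type*} [CommRing O] [IsDomain O] (q : Ideal (MvPolynomial σ O)) [q.IsPrime]
    (h : Ht1 q) : q.comap MvPolynomial.C = ⊥ ∨
      q = (q.comap (MvPolynomial.C (σ := σ))).map MvPolynomial.C := by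
  haveI : (q.comap (MvPolynomial.C (σ := σ))).IsPrime := Ideal.comap_isPrime _ _
  rcases h _ (mapC_prime (σ := σ) (q.comap (MvPolynomial.C (σ := σ)))) Ideal.map_comap_le with h | h
  · left; exact (Ideal.map_eq_bot_iff_of_injective (MvPolynomial.C_injective σ O)).1 h
  · right; exact h.symm

theorem exists_min {ι O : Type*} [CommRing O] [IsDomain O] (y : Ideal O) [hy : y.IsPrime]
    (tot : ∀ x z : O, ∃ c, c ∉ y ∧ (x ∣ c * z ∨ z ∣ c * x)) (p : ι → O) (T : Finset ι)
    (hT : T.Nonempty) : ∃ a ∈ T, ∀ b ∈ T, ∃ c, c ∉ y ∧ p a ∣ c * p b := by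
  classical
  induction hT using Finset.Nonempty.cons_induction with
  | singleton a =>
    refine ⟨a, by simp, fun b hb => ?_⟩
    rw [Finset.mem_singleton] at hb
    subst hb
    exact ⟨1, (Ideal.ne_top_iff_one _).1 hy.ne_top, by simp⟩
  | cons a T ha hT ih =>
    obtain ⟨a', ha', h⟩ := ih
    obtain ⟨c, hc, h1 | h1⟩ := tot (p a) (p a')
    · refine ⟨a, by simp, fun b hb => ?_⟩
      rw [Finset.mem_cons] at hb
      rcases hb with rfl | hb
      · exact ⟨1, (Ideal.ne_top_iff_one _).1 hy.ne_top, by simp⟩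
      · obtain ⟨c', hc', h2⟩ := h b hb
        refine ⟨c * c', fun hh => (hy.mem_or_mem hh).elim hc hc', ?_⟩
        exact (h1.trans (mul_dvd_mul_left c h2)).trans (by rw [mul_assoc])
    · refine ⟨a', by simp [ha'], fun b hb => ?_⟩
      rw [Finset.mem_cons] at hb
      rcases hb with rfl | hb
      · exact ⟨c, hc, h1⟩
      · exact h b hb

open MvPolynomial in
theorem claim1_aux {n : ℕ} {O : Type*} [CommRing O] [IsDomain O] [IsNoetherianRing O]
    [IsIntegrallyClosed O] [IsLocalRing O] (P : MvPolynomial (Fin n) O) (hP : P ≠ 0)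
    (hPq : ∀ q : Ideal (MvPolynomial (Fin n) O), q.IsPrime →
      q ≤ (IsLocalRing.maximalIdeal O).map C → q.comap C = ⊥ → P ∉ q) (a : Fin n →₀ ℕ) :
    ∃ s, s ∉ (IsLocalRing.maximalIdeal O).map (C (σ := Fin n)) ∧ P ∣ s * C (coeff a P) := by
  classical
  haveI := icl n O
  by_contra! hcon
  obtain ⟨q, hq, hqm, hq0, h1, hv, hs⟩ := hartogs (C (coeff a P)) P hP
    ((IsLocalRing.maximalIdeal O).map (C (σ := Fin n))) (mapC_prime _)
    (fun s hs => by by_contra h; exact hcon s h hs)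
  rcases trich q h1 with h0 | h0
  · exact hPq q hq hqm h0 (hs P (dvd_mul_right _ _))
  set y := q.comap (C (σ := Fin n)) with hy
  haveI hyp : y.IsPrime := Ideal.comap_isPrime _ _
  have hmem : ∀ f, f ∈ q ↔ ∀ m, coeff m f ∈ y := fun f => by rw [h0, mem_map_C_iff]
  have tot : ∀ x z : O, ∃ c, c ∉ y ∧ (x ∣ c * z ∨ z ∣ c * x) := by
    intro x z
    obtain ⟨s, hsq, h⟩ := hv (C x) (C z)
    rw [hmem] at hsq
    push Not at hsq
    obtain ⟨m, hm⟩ := hsq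
    refine ⟨_, hm, h.imp ?_ ?_⟩ <;>
    · rintro ⟨w, hw⟩
      refine ⟨coeff m w, ?_⟩
      rw [mul_comm, ← coeff_C_mul, ← coeff_C_mul, ← hw, mul_comm]
  obtain ⟨a0, ha0, hmin⟩ := exists_min y tot (fun a => coeff a P) P.support
    (by rwa [Finset.nonempty_iff_ne_empty, Ne, support_eq_empty])
  have ha0' : coeff a0 P ≠ 0 := by rwa [mem_support_iff] at ha0
  have hmin' : ∀ b, ∃ c, c ∉ y ∧ coeff a0 P ∣ c * coeff b P := by
    intro b
    by_cases hb : b ∈ P.support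
    · exact hmin b hb
    · rw [notMem_support_iff] at hb
      exact ⟨1, (Ideal.ne_top_iff_one _).1 hyp.ne_top, by simp [hb]⟩
  choose c hcy hc using hmin'
  let cc := ∏ b ∈ P.support, c b
  have hcc : cc ∉ y := by
    intro h
    obtain ⟨b, -, hb⟩ := (Ideal.IsPrime.prod_mem_iff).1 h
    exact hcy b hb
  have hcc' : ∀ b, ∃ d, cc * coeff b P = coeff a0 P * d := by
    intro b
    by_cases hb : b ∈ P.support
    · obtain ⟨d, hd⟩ := (hc b).trans (mul_dvd_mul_right (Finset.dvd_prod_of_mem c hb) _)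
      exact ⟨d, hd⟩
    · rw [notMem_support_iff] at hb
      exact ⟨0, by simp [hb]⟩
  choose d hd using hcc'
  have hPd : C cc * P = C (coeff a0 P) * ∑ b ∈ P.support, monomial b (d b) := by
    conv_lhs => rw [← support_sum_monomial_coeff P]
    rw [Finset.mul_sum, Finset.mul_sum]
    refine Finset.sum_congr rfl fun b _ => ?_
    rw [C_mul_monomial, C_mul_monomial, hd]
  set Q := ∑ b ∈ P.support, monomial b (d b) with hQ
  have hQq : Q ∉ q := by
    rw [hmem]
    intro h
    have h2 := congrArg (coeff a0) hPd
    rw [coeff_C_mul, coeff_C_mul, mul_comm] at h2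
    exact hcc ((mul_left_cancel₀ ha0' h2) ▸ h a0)
  apply hQq
  apply hs
  refine ⟨C (d a), mul_left_cancel₀ (a := C (coeff a0 P)) (by rwa [Ne, C_eq_zero]) ?_⟩
  calc C (coeff a0 P) * (Q * C (coeff a P)) = (C cc * P) * C (coeff a P) := by rw [hPd]; ring
    _ = P * C (cc * coeff a P) := by rw [C_mul]; ring
    _ = _ := by rw [hd, C_mul]; ring

open MvPolynomial in
theorem claim1 {n : ℕ} {O : Type*} [CommRing O] [IsDomain O] [IsNoetherianRing O]
    [IsIntegrallyClosed O] [IsLocalRing O] (P : MvPolynomial (Fin n) O) (hP : P ≠ 0)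
    (hPq : ∀ q : Ideal (MvPolynomial (Fin n) O), q.IsPrime →
      q ≤ (IsLocalRing.maximalIdeal O).map C → q.comap C = ⊥ → P ∉ q) :
    ∃ a, coeff a P ≠ 0 ∧ ∀ b, coeff a P ∣ coeff b P := by
  classical
  choose s hsm hs using claim1_aux P hP hPq
  set mS := (IsLocalRing.maximalIdeal O).map (C (σ := Fin n)) with hmS
  haveI : mS.IsPrime := mapC_prime _
  let ss := ∏ b ∈ P.support, s b
  have hss : ss ∉ mS := by
    intro h
    obtain ⟨b, -, hb⟩ := (Ideal.IsPrime.prod_mem_iff).1 h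
    exact hsm b hb
  have hr : ∀ b, ∃ r, ss * C (coeff b P) = P * r := by
    intro b
    by_cases hb : b ∈ P.support
    · obtain ⟨d, hd⟩ := (hs b).trans (mul_dvd_mul_right (Finset.dvd_prod_of_mem s hb) _)
      exact ⟨d, hd⟩
    · rw [notMem_support_iff] at hb
      exact ⟨0, by simp [hb]⟩
  choose r hr using hr
  have hsum : ss = ∑ b ∈ P.support, monomial b 1 * r b := by
    apply mul_left_cancel₀ hP
    rw [Finset.mul_sum]
    conv_lhs => rw [← support_sum_monomial_coeff P]
    rw [Finset.sum_mul]
    refine Finset.sum_congr rfl fun b _ => ?_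
    rw [mul_left_comm, ← hr, mul_left_comm, mul_comm (monomial b 1), C_mul_monomial, mul_one,
      mul_comm]
  obtain ⟨a, ha, har⟩ : ∃ a ∈ P.support, r a ∉ mS := by
    by_contra! h
    apply hss
    rw [hsum]
    exact Ideal.sum_mem _ fun b hb => Ideal.mul_mem_left _ _ (h b hb)
  refine ⟨a, mem_support_iff.1 ha, fun b => ?_⟩
  rw [hmS, mem_map_C_iff] at har
  push Not at har
  obtain ⟨m, hm⟩ := har
  have hu : IsUnit (coeff m (r a)) := by
    by_contra h; exact hm ((IsLocalRing.mem_maximalIdeal _).2 h)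
  have e : r a * C (coeff b P) = r b * C (coeff a P) := by
    apply mul_left_cancel₀ hP
    rw [← mul_assoc, ← mul_assoc, ← hr, ← hr]; ring
  have e' := congrArg (coeff m) e
  rw [mul_comm, coeff_C_mul, mul_comm (r b), coeff_C_mul, mul_comm, mul_comm (coeff a P)] at e'
  rw [← hu.dvd_mul_left, e']
  exact dvd_mul_left _ _

open MvPolynomial in
theorem claim2 {n : ℕ} {O : Type*} [CommRing O] [IsDomain O] [IsNoetherianRing O]
    [IsIntegrallyClosed O] [IsLocalRing O] (Q : MvPolynomial (Fin n) O)
    (hQ1 : ∃ a, coeff a Q = 1)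
    (W : Set (PrimeSpectrum (MvPolynomial (Fin n) O)))
    (hgen : ∀ q q' : PrimeSpectrum (MvPolynomial (Fin n) O), q.asIdeal ≤ q'.asIdeal → q' ∈ W → q ∈ W)
    (H : ∀ g, (∀ q : PrimeSpectrum (MvPolynomial (Fin n) O), Ht1 q.asIdeal → g ∉ q.asIdeal → q ∈ W) →
      ∀ q : PrimeSpectrum (MvPolynomial (Fin n) O), g ∉ q.asIdeal → q ∈ W)
    (hm : ∀ q : PrimeSpectrum (MvPolynomial (Fin n) O),
      q.asIdeal = (IsLocalRing.maximalIdeal O).map C → q ∈ W)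
    (h0 : ∀ q : PrimeSpectrum (MvPolynomial (Fin n) O), q.asIdeal.comap C = ⊥ →
      (q ∈ W ↔ Q ∉ q.asIdeal)) (q : PrimeSpectrum (MvPolynomial (Fin n) O)) :
    q ∈ W ↔ Q ∉ q.asIdeal := by
  classical
  haveI := icl n O
  obtain ⟨a, ha⟩ := hQ1
  have hQ0 : Q ≠ 0 := by rintro rfl; simp at ha
  constructor
  · intro hq hQq
    obtain ⟨q', hq', hqq, hq0, h1, hv, hs⟩ := hartogs 1 Q hQ0 q.asIdeal q.2
      (fun s hs => by rw [mul_one] at hs; exact Ideal.mem_of_dvd _ hs hQq)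
    have hQq' : Q ∈ q' := hs Q (dvd_mul_right _ _)
    rcases trich q' h1 with h | h
    · exact (h0 ⟨q', hq'⟩ h).1 (hgen ⟨q', hq'⟩ q hqq hq) hQq'
    · rw [h, mem_map_C_iff] at hQq'
      have := hQq' a
      rw [ha, Ideal.mem_comap, map_one] at this
      exact hq'.ne_top ((Ideal.eq_top_iff_one _).2 this)
  · refine H Q (fun q h1 hQq => ?_) q
    haveI := q.2
    rcases trich q.asIdeal h1 with h | h
    · exact (h0 q h).2 hQq
    · refine hgen q ⟨_, mapC_prime (IsLocalRing.maximalIdeal O)⟩ ?_ (hm _ rfl)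
      rw [h]
      exact Ideal.map_mono (IsLocalRing.le_maximalIdeal (Ideal.comap_ne_top _ q.2.ne_top))

theorem exists_eqn {B : Type*} [CommRing B] [IsDomain B] [UniqueFactorizationMonoid B]
    (W : Set (PrimeSpectrum B)) (hW : IsOpen W) (hne : W.Nonempty)
    (H : ∀ g, (∀ q : PrimeSpectrum B, Ht1 q.asIdeal → g ∉ q.asIdeal → q ∈ W) →
      ∀ q : PrimeSpectrum B, g ∉ q.asIdeal → q ∈ W) :
    ∃ P : B, P ≠ 0 ∧ ∀ q : PrimeSpectrum B, q ∈ W ↔ P ∉ q.asIdeal := by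
  classical
  have hgen : ∀ q q' : PrimeSpectrum B, q.asIdeal ≤ q'.asIdeal → q' ∈ W → q ∈ W := by
    intro q q' h hq'
    exact ((PrimeSpectrum.le_iff_specializes q q').1 h).mem_open hW hq'
  obtain ⟨w, hw⟩ := hne
  obtain ⟨_, ⟨h, rfl⟩, hwh, hhW⟩ := PrimeSpectrum.isTopologicalBasis_basic_opens.exists_subset_of_mem_open hw hW
  have hh0 : h ≠ 0 := by
    rintro rfl
    exact hwh (Ideal.zero_mem _)
  let N := UniqueFactorizationMonoid.factors h
  let bad : B → Prop := fun π => ∃ q : PrimeSpectrum B, q.asIdeal = Ideal.span {π} ∧ q ∉ W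
  have hpr : ∀ π ∈ N, Prime π := UniqueFactorizationMonoid.prime_of_factor
  refine ⟨(N.filter bad).prod, ?_, fun q => ⟨?_, ?_⟩⟩
  · rw [Ne, Multiset.prod_eq_zero_iff]
    intro h0
    exact (hpr 0 (Multiset.mem_of_mem_filter h0)).ne_zero rfl
  · intro hq hP
    rw [Ideal.IsPrime.multiset_prod_mem_iff_exists_mem q.2] at hP
    obtain ⟨π, hπ, hπq⟩ := hP
    rw [Multiset.mem_filter] at hπ
    obtain ⟨q', hq', hq'W⟩ := hπ.2
    exact hq'W (hgen q' q (by rw [hq', Ideal.span_singleton_le_iff_mem]; exact hπq) hq)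
  · refine H _ (fun q h1 hP => ?_) q
    by_cases hhq : h ∈ q.asIdeal
    · have : N.prod ∈ q.asIdeal :=
        Ideal.mem_of_dvd _ (UniqueFactorizationMonoid.factors_prod hh0).symm.dvd hhq
      rw [Ideal.IsPrime.multiset_prod_mem_iff_exists_mem q.2] at this
      obtain ⟨π, hπ, hπq⟩ := this
      have hπp : (Ideal.span {π}).IsPrime := by
        rw [Ideal.span_singleton_prime (hpr π hπ).ne_zero]; exact hpr π hπ
      rcases h1 (Ideal.span {π}) hπp (by rwa [Ideal.span_singleton_le_iff_mem]) with h | h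
      · exact absurd (Ideal.span_singleton_eq_bot.1 h) (hpr π hπ).ne_zero
      · by_contra hqW
        apply hP
        rw [Ideal.IsPrime.multiset_prod_mem_iff_exists_mem q.2]
        exact ⟨π, Multiset.mem_filter.2 ⟨hπ, q, h.symm, hqW⟩, hπq⟩
    · exact hhW hhq

end Alg
end

noncomputable section
namespace Alg

theorem ht1_bot {R : Type*} [CommRing R] : Ht1 (⊥ : Ideal R) := fun _ _ h => Or.inl (le_bot_iff.1 h)

theorem avoid {M C : Type*} [CommRing M] [IsDomain M] [CommRing C] [Algebra M C]
    (Ω : Set (PrimeSpectrum C))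
    (hΩ : ∀ P : PrimeSpectrum C, Ht1 (P.asIdeal.comap (algebraMap M C)) → P ∈ Ω)
    (J : Ideal C) (hJ : ∀ P ∈ Ω, ∃ d ∈ J, d ∉ P.asIdeal) (q : Ideal M) [hq : q.IsPrime] (h1 : Ht1 q) :
    ∃ t, t ∉ q ∧ algebraMap M C t ∈ J := by
  by_contra! h
  obtain ⟨P, hP, hJP, hd⟩ := Ideal.exists_le_prime_disjoint J (q.primeCompl.map (algebraMap M C)) (by
    rw [Set.disjoint_left]
    rintro x hx ⟨t, ht, rfl⟩
    exact h t ht hx)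
  have hle : P.comap (algebraMap M C) ≤ q := by
    intro t ht
    by_contra htq
    exact Set.disjoint_left.1 hd ht ⟨t, htq, rfl⟩
  have : (⟨P, hP⟩ : PrimeSpectrum C) ∈ Ω := by
    apply hΩ
    rcases h1 _ (Ideal.comap_isPrime (algebraMap M C) P) hle with h | h
    · show Ht1 (P.comap (algebraMap M C)); rw [h]; exact ht1_bot
    · show Ht1 (P.comap (algebraMap M C)); rw [h]; exact h1
  obtain ⟨d, hdJ, hdP⟩ := hJ _ this
  exact hdP (hJP hdJ)

theorem alg_hartogs {M C B : Type*} [CommRing M] [IsDomain M] [IsNoetherianRing M]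
    [IsIntegrallyClosed M] [CommRing C] [CommRing B] [Algebra M C] [Module.Free M C] (φ : C →+* B)
    (Ω : Set (PrimeSpectrum C))
    (hΩ : ∀ P : PrimeSpectrum C, Ht1 (P.asIdeal.comap (algebraMap M C)) → P ∈ Ω)
    (Loc : ∀ σ : B, ∀ P ∈ Ω, ∃ d, d ∉ P.asIdeal ∧ ∃ c, φ d * σ = φ c)
    (Sep : ∀ σ : B, (∀ P ∈ Ω, ∃ d, d ∉ P.asIdeal ∧ φ d * σ = 0) → σ = 0)
    (Van : ∀ c : C, φ c = 0 → ∀ P ∈ Ω, ∃ d, d ∉ P.asIdeal ∧ d * c = 0) : Function.Bijective φ := by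
  classical
  let e := Module.Free.chooseBasis M C
  have tf : ∀ (s : M) (c : C), s ≠ 0 → algebraMap M C s * c = 0 → c = 0 := by
    intro s c hs h
    rw [← Algebra.smul_def] at h
    apply e.repr.injective
    ext i
    have := congrArg (fun z => e.repr z i) h
    simp only [map_smul, Finsupp.smul_apply, map_zero, Finsupp.zero_apply, smul_eq_mul] at this ⊢
    exact (mul_eq_zero.1 this).resolve_left hs
  have inj : ∀ c, φ c = 0 → c = 0 := by
    intro c hc
    let J : Ideal C := LinearMap.ker (LinearMap.mulRight C c)
    obtain ⟨t, ht, htJ⟩ := avoid (M := M) Ω hΩ J (fun P hP => by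
      obtain ⟨d, h1, h2⟩ := Van c hc P hP
      exact ⟨d, h2, h1⟩) ⊥ ht1_bot
    exact tf t c ht htJ
  have inj' : Function.Injective φ := (injective_iff_map_eq_zero φ).2 inj
  have tf' : ∀ (s : M) (σ : B), s ≠ 0 → φ (algebraMap M C s) * σ = 0 → σ = 0 := by
    intro s σ hs h
    apply Sep
    intro P hP
    obtain ⟨d, hd, c, hc⟩ := Loc σ P hP
    refine ⟨d, hd, ?_⟩
    rw [hc, tf s c hs, map_zero]
    apply inj
    rw [map_mul, ← hc, mul_left_comm, h, mul_zero]
  refine ⟨inj', fun σ => ?_⟩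
  let J : Ideal C :=
    { carrier := {d | ∃ c, φ d * σ = φ c}
      add_mem' := by
        rintro d d' ⟨c, hc⟩ ⟨c', hc'⟩
        exact ⟨c + c', by rw [map_add, map_add, add_mul, hc, hc']⟩
      zero_mem' := ⟨0, by simp⟩
      smul_mem' := by
        rintro x d ⟨c, hc⟩
        exact ⟨x * c, by rw [smul_eq_mul, map_mul, map_mul, mul_assoc, hc]⟩ }
  have hJ : ∀ P ∈ Ω, ∃ d ∈ J, d ∉ P.asIdeal := by
    intro P hP
    obtain ⟨d, hd, c, hc⟩ := Loc σ P hP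
    exact ⟨d, ⟨c, hc⟩, hd⟩
  obtain ⟨s, hs, c, hc⟩ := avoid (M := M) Ω hΩ J hJ ⊥ ht1_bot
  have hs0 : s ≠ 0 := hs
  have hdvd : ∀ i, s ∣ e.repr c i := by
    intro i
    by_contra hnd
    let I : Ideal M := Submodule.comap (LinearMap.mulRight M (e.repr c i)) (Ideal.span {s})
    have hI : ∀ t, t ∈ I ↔ s ∣ t * e.repr c i := by
      intro s; rw [Submodule.mem_comap, Ideal.mem_span_singleton]; rfl
    have hIt : I ≠ ⊤ := by
      rw [Ideal.ne_top_iff_one, hI, one_mul]; exact hnd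
    obtain ⟨p, hp, hIp⟩ := Ideal.exists_le_maximal I hIt
    obtain ⟨q, hq, -, -, h1, -, hq'⟩ := hartogs (e.repr c i) s hs0 p hp.isPrime
      (fun t ht => hIp ((hI t).2 ht))
    obtain ⟨t, ht, c', hc'⟩ := avoid (M := M) Ω hΩ J hJ q h1
    apply ht
    apply hq'
    have e1 : t • c = s • c' := by
      apply inj'
      rw [Algebra.smul_def, Algebra.smul_def, map_mul, map_mul, ← hc, ← hc', mul_left_comm]
    have := congrArg (fun z => e.repr z i) e1
    simp only [map_smul, Finsupp.smul_apply, smul_eq_mul] at this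
    exact ⟨_, this⟩
  choose m hm using hdvd
  let c' : C := ∑ i ∈ (e.repr c).support, m i • e i
  have hcc : c = algebraMap M C s * c' := by
    conv_lhs => rw [← e.linearCombination_repr c]
    rw [Finsupp.linearCombination_apply, Finsupp.sum, Finset.mul_sum]
    refine Finset.sum_congr rfl fun i _ => ?_
    rw [hm i, mul_smul, Algebra.smul_def]
  refine ⟨c', ?_⟩
  rw [← sub_eq_zero, ← neg_eq_zero, neg_sub]
  apply tf' s _ hs0
  rw [mul_sub, hc, hcc, map_mul, sub_self]

theorem away_helper {R E : Type*} [CommRing R] [CommRing E] (ρ : R →+* E) (d : R)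
    (L : @IsLocalization.Away _ _ d E _ ρ.toAlgebra) :
    (∀ e, ∃ (n : ℕ) (r : R), ρ r = ρ (d ^ n) * e) ∧
      ∀ a b, ρ a = ρ b → ∃ n : ℕ, d ^ n * a = d ^ n * b := by
  letI := ρ.toAlgebra
  refine ⟨fun e => ?_, fun a b h => ?_⟩
  · obtain ⟨⟨y, _, n, rfl⟩, hy⟩ := IsLocalization.surj (Submonoid.powers d) e
    exact ⟨n, y, by rw [mul_comm]; exact hy.symm⟩
  · obtain ⟨⟨_, m, rfl⟩, hm⟩ := IsLocalization.exists_of_eq (M := Submonoid.powers d) (S := E) h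
    exact ⟨m, hm⟩

theorem top_of_iso {Y : Scheme.{u}} [IsAffine Y] (Ω : Y.Opens) [IsAffine Ω.toScheme]
    (hiso : IsIso (Y.presheaf.map (homOfLE (le_top : Ω ≤ ⊤)).op)) : Ω = ⊤ := by
  have h2 : IsIso (Ω.ι.appTop) := by
    rw [Scheme.Opens.ι_appTop]
    have hh : Ω.ι ''ᵁ ⊤ = Ω := by simp
    have : (homOfLE (le_top : Ω.ι ''ᵁ ⊤ ≤ ⊤)) = eqToHom hh ≫ homOfLE (le_top : Ω ≤ ⊤) :=
      Subsingleton.elim _ _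
    have e1 : IsIso (Y.presheaf.map (eqToHom hh).op) := inferInstance
    have e2 := IsIso.comp_isIso' hiso e1
    rw [← Functor.map_comp, ← op_comp, ← this] at e2
    exact e2
  haveI : IsIso Ω.ι := by
    have := (MorphismProperty.isomorphisms Scheme.{u}).arrow_mk_iso_iff (arrowIsoSpecΓOfIsAffine Ω.ι)
    simp only [MorphismProperty.isomorphisms.iff] at this
    rw [this]
    infer_instance
  rw [← Scheme.Opens.opensRange_ι Ω]
  exact Scheme.Hom.opensRange_of_isIso _

theorem spec_hartogs {M : Type*} {C : Type u} [CommRing M] [IsDomain M] [IsNoetherianRing M]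
    [IsIntegrallyClosed M] [CommRing C] [Algebra M C] [Module.Free M C]
    (Ω : (Spec (CommRingCat.of C)).Opens) (hΩa : IsAffineOpen Ω)
    (hΩ : ∀ P : Spec (CommRingCat.of C), Ht1 (P.asIdeal.comap (algebraMap M C)) → P ∈ Ω) : Ω = ⊤ := by
  let Y := Spec (CommRingCat.of C)
  let ψ : C →+* Γ(Y, ⊤) := (Scheme.ΓSpecIso (CommRingCat.of C)).inv.hom
  let φ : C →+* Γ(Y, Ω) := (Y.presheaf.map (homOfLE le_top).op).hom.comp ψ
  have hψ : Function.Bijective ψ :=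
    ConcreteCategory.bijective_of_isIso (Scheme.ΓSpecIso (CommRingCat.of C)).inv
  have key : ∀ P ∈ Ω, ∃ d : C, d ∉ P.asIdeal ∧ (∀ σ, ∃ (n : ℕ) (c : C), φ (d ^ n) * σ = φ c) ∧
      (∀ c, φ c = 0 → ∃ n : ℕ, d ^ n * c = 0) := by
    intro P hP
    obtain ⟨f, hfΩ, hPf⟩ := (isAffineOpen_top Y).exists_basicOpen_le ⟨P, hP⟩ (show P ∈ ⊤ from trivial)
    obtain ⟨d, rfl⟩ := hψ.2 f
    have hDd : Y.basicOpen (ψ d) = PrimeSpectrum.basicOpen d :=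
      basicOpen_eq_of_affine (R := CommRingCat.of C) d
    have hD : Y.basicOpen (ψ d) = Y.basicOpen (φ d) := by
      show _ = Y.basicOpen (Y.presheaf.map (homOfLE le_top).op (ψ d))
      rw [Scheme.basicOpen_res, inf_eq_right.2 hfΩ]
    have L1 := (isAffineOpen_top Y).isLocalization_of_eq_basicOpen (ψ d) (homOfLE le_top) rfl
    have L2 := hΩa.isLocalization_of_eq_basicOpen (φ d) (homOfLE hfΩ) hD
    set ρ1 := (Y.presheaf.map (homOfLE (le_top : Y.basicOpen (ψ d) ≤ ⊤)).op).hom with hρ1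
    set ρ2 := (Y.presheaf.map (homOfLE hfΩ).op).hom with hρ2
    have hρ : ∀ c, ρ2 (φ c) = ρ1 (ψ c) := by
      intro c
      show (Y.presheaf.map (homOfLE hfΩ).op).hom ((Y.presheaf.map (homOfLE le_top).op).hom (ψ c)) = _
      rw [← CommRingCat.comp_apply, ← Functor.map_comp]
      rfl
    obtain ⟨L1a, L1b⟩ := away_helper ρ1 (ψ d) L1
    obtain ⟨L2a, L2b⟩ := away_helper ρ2 (φ d) L2
    refine ⟨d, ?_, fun σ => ?_, fun c hc => ?_⟩
    · have : P ∈ PrimeSpectrum.basicOpen d := hDd ▸ hPf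
      exact this
    · obtain ⟨n, y, hy⟩ := L1a (ρ2 σ)
      obtain ⟨c, rfl⟩ := hψ.2 y
      have h3 : ρ2 (φ (d ^ n) * σ) = ρ2 (φ c) := by
        rw [map_mul, hρ, hρ, map_pow ψ, hy]
      obtain ⟨m, hm⟩ := L2b _ _ h3
      refine ⟨m + n, d ^ m * c, ?_⟩
      rw [pow_add, map_mul, map_mul, map_pow φ d m, mul_assoc, hm]
    · have h3 : ρ1 (ψ c) = ρ1 0 := by rw [← hρ, hc, map_zero, map_zero]
      obtain ⟨m, hm⟩ := L1b _ _ h3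
      refine ⟨m, hψ.1 ?_⟩
      rw [mul_zero] at hm
      rw [map_mul, map_pow, hm, map_zero]
  have hbij : Function.Bijective φ := by
    refine alg_hartogs (M := M) φ {P : PrimeSpectrum C | Membership.mem Ω P} hΩ ?_ ?_ ?_
    · intro σ P hP
      obtain ⟨d, hd, h1, h2⟩ := key P hP
      obtain ⟨n, c, hc⟩ := h1 σ
      exact ⟨d ^ n, fun h => hd (P.2.mem_of_pow_mem n h), c, hc⟩
    · intro σ hσ
      apply TopCat.Presheaf.section_ext Y.sheaf Ω σ 0
      intro P hP
      obtain ⟨d, hd, h⟩ := hσ P hP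
      have hu : IsUnit (Y.presheaf.germ Ω P hP (φ d)) := by
        rw [← Y.mem_basicOpen (hx := hP)]
        show P ∈ Y.basicOpen (Y.presheaf.map (homOfLE le_top).op (ψ d))
        rw [Scheme.basicOpen_res]
        refine ⟨hP, ?_⟩
        have hDd : Y.basicOpen (ψ d) = PrimeSpectrum.basicOpen d :=
          basicOpen_eq_of_affine (R := CommRingCat.of C) d
        show P ∈ Y.basicOpen (ψ d)
        rw [hDd]; exact hd
      have := congrArg (Y.presheaf.germ Ω P hP) h
      rw [map_mul, map_zero, hu.mul_right_eq_zero] at this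
      rw [map_zero]
      exact this
    · intro c hc P hP
      obtain ⟨d, hd, h1, h2⟩ := key P hP
      obtain ⟨n, hn⟩ := h2 c hc
      exact ⟨d ^ n, fun h => hd (P.2.mem_of_pow_mem n h), hn⟩
  have hres : Function.Bijective (Y.presheaf.map (homOfLE (le_top : Ω ≤ ⊤)).op) := by
    refine ⟨fun a b hab => ?_, fun σ => ?_⟩
    · obtain ⟨a, rfl⟩ := hψ.2 a
      obtain ⟨b, rfl⟩ := hψ.2 b
      rw [hbij.1 hab]
    · obtain ⟨c, hc⟩ := hbij.2 σ
      exact ⟨ψ c, hc⟩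
  haveI : IsAffine Ω.toScheme := hΩa
  have hiso : IsIso (Y.presheaf.map (homOfLE (le_top : Ω ≤ ⊤)).op) :=
    (ConcreteCategory.isIso_iff_bijective _).2 hres
  exact top_of_iso (Y := Y) Ω hiso
end Alg
end

noncomputable section

/-- A finite chart: an affine open of `G`, finite over affine space and generically free. -/
structure Chart {k : Type u} [Field k] {G : GroupSchemeOver k} {X : SchemeOver k}
    (α : ActionOver G X) where
  n : ℕ
  A : Type u
  [cr : CommRing A]
  [alg : Algebra (MvPolynomial (Fin n) k) A]
  [fin : Module.Finite (MvPolynomial (Fin n) k) A]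
  inj : Function.Injective (algebraMap (MvPolynomial (Fin n) k) A)
  j : Spec (CommRingCat.of A) ⟶ G.carrier
  [jopen : IsOpenImmersion j]
  j_str : j ≫ G.str = Spec.map (CommRingCat.ofHom (algebraMap (MvPolynomial (Fin n) k) A)) ≫
    Spec.map (CommRingCat.ofHom (MvPolynomial.C (σ := Fin n) (R := k)))
  f : MvPolynomial (Fin n) k
  f_ne : f ≠ 0
  free : ∀ (M : Type u) [CommRing M] [Algebra (MvPolynomial (Fin n) k) M],
    IsUnit (algebraMap (MvPolynomial (Fin n) k) M f) →
      Module.Free M (TensorProduct (MvPolynomial (Fin n) k) M A)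
  U : X.carrier.Opens
  aff : IsAffineOpen U

namespace Chart
variable {k : Type u} [Field k] {G : GroupSchemeOver k} {X : SchemeOver k}
    {α : ActionOver G X} (c : Chart α)
attribute [instance] Chart.cr Chart.alg Chart.fin Chart.jopen

/-- coordinate ring of affine space -/
abbrev R : Type u := MvPolynomial (Fin c.n) k
/-- affine space -/
abbrev S : Scheme.{u} := Spec (CommRingCat.of c.R)
/-- structure map -/
def ρ : c.S ⟶ Spk k := Spec.map (CommRingCat.ofHom (MvPolynomial.C (σ := Fin c.n) (R := k)))
/-- the finite map -/
def ι : Spec (CommRingCat.of c.A) ⟶ c.S :=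
  Spec.map (CommRingCat.ofHom (algebraMap (MvPolynomial (Fin c.n) k) c.A))

theorem j_str' : c.j ≫ G.str = c.ι ≫ c.ρ := c.j_str

theorem compat {T T' : Scheme.{u}} {τ : T ⟶ c.S} {ξ : T ⟶ X.carrier} (h : τ ≫ c.ρ = ξ ≫ X.str)
    (s : T' ⟶ T) (g : T' ⟶ Spec (CommRingCat.of c.A)) (hs : s ≫ τ = g ≫ c.ι) :
    (g ≫ c.j) ≫ G.str = (s ≫ ξ) ≫ X.str := by
  rw [Category.assoc, c.j_str', ← reassoc_of% hs, h, Category.assoc]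

/-- the good locus -/
def W {T : Scheme.{u}} (τ : T ⟶ c.S) (ξ : T ⟶ X.carrier) (h : τ ≫ c.ρ = ξ ≫ X.str) : Set T :=
  {t | c.f ∉ (τ t).asIdeal ∧ ∀ (T' : Scheme.{u}) (s : T' ⟶ T)
    (g : T' ⟶ Spec (CommRingCat.of c.A)) (hs : s ≫ τ = g ≫ c.ι) (w : T'), s w = t →
    α.act (g ≫ c.j) (s ≫ ξ) (c.compat h s g hs) w ∈ c.U}

variable {T : Scheme.{u}} {τ : T ⟶ c.S} {ξ : T ⟶ X.carrier} (h : τ ≫ c.ρ = ξ ≫ X.str)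

theorem mem_of_eq {T Y : Scheme.{u}} {U : Y.Opens} {a b : T ⟶ Y} (e : a = b) {w : T}
    (hw : b w ∈ U) : a w ∈ U := e ▸ hw

theorem mem_W_iff {T' : Scheme.{u}} (φ : T' ⟶ T) {τ' : T' ⟶ c.S} {ξ' : T' ⟶ X.carrier}
    (h' : τ' ≫ c.ρ = ξ' ≫ X.str) (e1 : φ ≫ τ = τ') (e2 : φ ≫ ξ = ξ') (t : T') :
    t ∈ c.W τ' ξ' h' ↔ φ t ∈ c.W τ ξ h := by
  subst e1 e2
  constructor
  · rintro ⟨h1, h2⟩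
    refine ⟨by simpa using h1, fun S s g hs w hw => ?_⟩
    obtain ⟨z, hz1, hz2⟩ := Scheme.Pullback.exists_preimage_pullback (f := s) (g := φ) w t hw
    have e : pullback.snd s φ ≫ φ ≫ τ = (pullback.fst s φ ≫ g) ≫ c.ι := by
      rw [Category.assoc, ← hs, pullback.condition_assoc]
    have := h2 _ (pullback.snd s φ) (pullback.fst s φ ≫ g) e z hz2
    rw [← hz1, ← Scheme.Hom.comp_apply, α.act_natural _ _ _ _ (by
      rw [Category.assoc, c.compat h s g hs]; simp only [Category.assoc])]
    refine mem_of_eq (α.act_congr (Category.assoc _ _ _) (pullback.condition_assoc ξ) _ _) this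
  · rintro ⟨h1, h2⟩
    refine ⟨by simpa using h1, fun S s g hs w hw => ?_⟩
    have := h2 S (s ≫ φ) g (by simpa using hs) w (by simp [hw])
    exact mem_of_eq (α.act_congr rfl (Category.assoc _ _ _) _ _) this

/-- the action on the pullback -/
def a : pullback τ c.ι ⟶ X.carrier :=
  α.act (pullback.snd τ c.ι ≫ c.j) (pullback.fst τ c.ι ≫ ξ) (c.compat h _ _ pullback.condition)

theorem a_str : c.a h ≫ X.str = pullback.fst τ c.ι ≫ ξ ≫ X.str := by
  rw [a, α.act_str, Category.assoc]

theorem mem_W_iff_pullback (t : T) :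
    t ∈ c.W τ ξ h ↔ c.f ∉ (τ t).asIdeal ∧ ∀ z : (pullback τ c.ι : Scheme.{u}),
      pullback.fst τ c.ι z = t → c.a h z ∈ c.U := by
  constructor
  · rintro ⟨h1, h2⟩
    exact ⟨h1, fun z hz => h2 _ _ _ pullback.condition z hz⟩
  · rintro ⟨h1, h2⟩
    refine ⟨h1, fun S s g hs w hw => ?_⟩
    have := h2 (pullback.lift s g hs w) (by
      rw [← Scheme.Hom.comp_apply, pullback.lift_fst, hw])
    have e1 : pullback.lift s g hs ≫ pullback.snd τ c.ι ≫ c.j = g ≫ c.j := by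
      rw [pullback.lift_snd_assoc]
    have e2 : pullback.lift s g hs ≫ pullback.fst τ c.ι ≫ ξ = s ≫ ξ := by
      rw [pullback.lift_fst_assoc]
    have e3 : α.act (g ≫ c.j) (s ≫ ξ) (c.compat h s g hs) = pullback.lift s g hs ≫ c.a h := by
      have h5 : (pullback.lift s g hs ≫ pullback.snd τ c.ι ≫ c.j) ≫ G.str =
          (pullback.lift s g hs ≫ pullback.fst τ c.ι ≫ ξ) ≫ X.str := by
        rw [e1, e2]; exact c.compat h s g hs
      exact (α.act_congr e1.symm e2.symm _ h5).trans (α.act_natural _ _ _ _ _).symm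
    exact mem_of_eq e3 (by rw [Scheme.Hom.comp_apply]; exact this)

instance : IsFinite c.ι := by
  rw [ι, IsFinite.SpecMap_iff]
  exact RingHom.finite_algebraMap.mpr c.fin

theorem isOpen_W : IsOpen (c.W τ ξ h) := by
  have : c.W τ ξ h = ((τ ⁻¹ᵁ (PrimeSpectrum.basicOpen c.f) : T.Opens) : Set T) ∩
      (pullback.fst τ c.ι '' ((c.a h ⁻¹ᵁ c.U : (pullback τ c.ι).Opens) : Set _)ᶜ)ᶜ := by
    ext t
    rw [mem_W_iff_pullback]
    refine and_congr Iff.rfl ?_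
    simp only [Set.mem_compl_iff, Set.mem_image, not_exists, not_and]
    exact forall_congr' fun z => ⟨fun h' h1 h2 => h1 (h' h2), fun h' h2 => by_contra fun h1 => h' h1 h2⟩
  rw [this]
  refine (τ ⁻¹ᵁ _).isOpen.inter ?_
  rw [isOpen_compl_iff]
  exact (pullback.fst τ c.ι).isClosedMap _ (c.a h ⁻¹ᵁ c.U).isOpen.isClosed_compl

end Chart
end

noncomputable section
namespace Chart
variable {k : Type u} [Field k] {G : GroupSchemeOver k} {X : SchemeOver k}
    {α : ActionOver G X} (c : Chart α)

theorem exists_iso (M : Type u) [CommRing M] [Algebra c.R M] :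
    ∃ e : pullback (Spec.map (CommRingCat.ofHom (algebraMap c.R M))) c.ι ≅
      Spec (CommRingCat.of (TensorProduct c.R M c.A)), e.inv ≫ pullback.fst _ _ =
      Spec.map (CommRingCat.ofHom (algebraMap M (TensorProduct c.R M c.A))) :=
  ⟨pullbackSpecIso c.R M c.A, pullbackSpecIso_inv_fst' ..⟩

theorem hartogs_aux [IsSeparated X.str] (M : Type u) [CommRing M] [IsDomain M] [IsNoetherianRing M]
    [IsIntegrallyClosed M] [Algebra c.R M] {τ : Spec (CommRingCat.of M) ⟶ c.S}
    (hτ : τ = Spec.map (CommRingCat.ofHom (algebraMap c.R M)))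
    {ξ : Spec (CommRingCat.of M) ⟶ X.carrier}
    (h : τ ≫ c.ρ = ξ ≫ X.str)
    (hW : ∀ q : Spec (CommRingCat.of M), Alg.Ht1 q.asIdeal → q ∈ c.W τ ξ h)
    (q : Spec (CommRingCat.of M)) : q ∈ c.W τ ξ h := by
  have hf : ∀ q ∈ c.W τ ξ h, algebraMap c.R M c.f ∉ q.asIdeal := by
    intro q hq
    have := hq.1
    subst hτ
    exact this
  have hf0 : algebraMap c.R M c.f ≠ 0 := by
    intro h0
    refine hf ⟨⊥, Ideal.isPrime_bot⟩ (hW _ Alg.ht1_bot) ?_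
    rw [h0]; exact Ideal.zero_mem _
  have hu : IsUnit (algebraMap c.R M c.f) := by
    by_contra hu
    obtain ⟨m, hm, hfm⟩ := exists_max_ideal_of_mem_nonunits hu
    obtain ⟨q, hq, -, -, hq1, -, hq2⟩ := Alg.hartogs 1 (algebraMap c.R M c.f) hf0 m hm.isPrime
      (fun s hs => m.mem_of_dvd (by simpa using hs) hfm)
    exact hf ⟨q, hq⟩ (hW _ hq1) (hq2 _ (by simp))
  have := c.free M hu
  have haff : IsAffineHom (c.a h) := by
    have : IsAffineHom (c.a h ≫ X.str) := inferInstance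
    exact IsAffineHom.of_comp _ X.str
  subst hτ
  obtain ⟨e, he⟩ := c.exists_iso M
  let Ω : (Spec (CommRingCat.of (TensorProduct c.R M c.A))).Opens := e.inv ⁻¹ᵁ c.a h ⁻¹ᵁ c.U
  have hΩ : Ω = ⊤ := by
    refine Alg.spec_hartogs (M := M) (C := TensorProduct c.R M c.A) Ω ?_ ?_
    · exact (c.aff.preimage (c.a h)).preimage_of_isIso e.inv
    · intro P hP
      have h1 := hW (Spec.map (CommRingCat.ofHom (algebraMap M (TensorProduct c.R M c.A))) P) hP
      rw [mem_W_iff_pullback] at h1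
      refine h1.2 (e.inv P) ?_
      rw [← Scheme.Hom.comp_apply, he]
  rw [mem_W_iff_pullback]
  constructor
  · intro h1
    exact q.isPrime.ne_top (Ideal.eq_top_of_isUnit_mem _ h1 hu)
  · intro z _
    have : e.hom z ∈ Ω := by rw [hΩ]; trivial
    have h2 : c.a h (e.inv (e.hom z)) ∈ c.U := this
    rw [← Scheme.Hom.comp_apply e.hom, e.hom_inv_id] at h2
    exact h2

theorem hartogs [IsSeparated X.str] (M : Type u) [CommRing M] [IsDomain M] [IsNoetherianRing M]
    [IsIntegrallyClosed M] {τ : Spec (CommRingCat.of M) ⟶ c.S}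
    {ξ : Spec (CommRingCat.of M) ⟶ X.carrier}
    (h : τ ≫ c.ρ = ξ ≫ X.str)
    (hW : ∀ q : Spec (CommRingCat.of M), Alg.Ht1 q.asIdeal → q ∈ c.W τ ξ h)
    (q : Spec (CommRingCat.of M)) : q ∈ c.W τ ξ h := by
  letI := (Spec.preimage τ).hom.toAlgebra
  exact c.hartogs_aux M (Spec.map_preimage τ).symm h hW q

theorem hartogs' [IsSeparated X.str] (M : Type u) [CommRing M] [IsDomain M] [IsNoetherianRing M]
    [IsIntegrallyClosed M] {τ : Spec (CommRingCat.of M) ⟶ c.S}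
    {ξ : Spec (CommRingCat.of M) ⟶ X.carrier}
    (h : τ ≫ c.ρ = ξ ≫ X.str) (g : M)
    (hW : ∀ q : Spec (CommRingCat.of M), Alg.Ht1 q.asIdeal → g ∉ q.asIdeal → q ∈ c.W τ ξ h)
    (q : Spec (CommRingCat.of M)) (hq : g ∉ q.asIdeal) : q ∈ c.W τ ξ h := by
  have hg : g ≠ 0 := by rintro rfl; exact hq (Ideal.zero_mem _)
  have hle := powers_le_nonZeroDivisors_of_noZeroDivisors hg
  let N := Localization.Away g
  haveI : IsDomain N := IsLocalization.isDomain_localization hle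
  haveI : IsNoetherianRing N := IsLocalization.isNoetherianRing (.powers g) _ inferInstance
  haveI : IsIntegrallyClosed N := isIntegrallyClosed_of_isLocalization N _ hle
  let φ : Spec (CommRingCat.of N) ⟶ Spec (CommRingCat.of M) :=
    Spec.map (CommRingCat.ofHom (algebraMap M N))
  have h' : (φ ≫ τ) ≫ c.ρ = (φ ≫ ξ) ≫ X.str := by simp [h]
  have key := c.hartogs N h' (fun p hp => by
    rw [c.mem_W_iff h φ h' rfl rfl]
    refine hW _ ?_ ?_
    · intro P hP hle'
      have hdisj : Disjoint (Submonoid.powers g : Set M) P := by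
        refine Set.disjoint_left.mpr fun x hx hxP => ?_
        have h3 : algebraMap M N x ∈ p.asIdeal := hle' hxP
        exact p.isPrime.ne_top (Ideal.eq_top_of_isUnit_mem _ h3
          (IsLocalization.map_units N (⟨x, hx⟩ : Submonoid.powers g)))
      have h4 := IsLocalization.comap_map_of_isPrime_disjoint (.powers g) N hP hdisj
      have h5 := IsLocalization.isPrime_of_isPrime_disjoint (.powers g) N P hP hdisj
      rcases hp _ h5 (Ideal.map_le_iff_le_comap.mpr hle') with h6 | h6
      · left
        rw [← h4, h6, Ideal.under_def, ← RingHom.ker_eq_comap_bot]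
        exact (RingHom.injective_iff_ker_eq_bot _).mp (IsLocalization.injective N hle)
      · right
        rw [← h4, h6]; rfl
    · intro h3
      have h3 : algebraMap M N g ∈ p.asIdeal := h3
      exact p.isPrime.ne_top (Ideal.eq_top_of_isUnit_mem _ h3
          (IsLocalization.map_units N (⟨g, Submonoid.mem_powers g⟩ : Submonoid.powers g))))
  obtain ⟨p, hp⟩ : ∃ p : Spec (CommRingCat.of N), φ p = q := by
    have := PrimeSpectrum.localization_away_comap_range N g
    have h7 : q ∈ Set.range (PrimeSpectrum.comap (algebraMap M N)) := by
      rw [this]; exact hq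
    exact h7
  rw [← hp, ← c.mem_W_iff h φ h' rfl rfl]
  exact key p
end Chart
end

noncomputable section
namespace Alg
open MvPolynomial

theorem eqn_bot {n : ℕ} {O K : Type*} [CommRing O] [IsDomain O] [Field K] [Algebra O K]
    [IsFractionRing O K] (P : MvPolynomial (Fin n) K)
    (W : Set (PrimeSpectrum (MvPolynomial (Fin n) O)))
    (hK : ∀ q : PrimeSpectrum (MvPolynomial (Fin n) K),
      PrimeSpectrum.comap (map (algebraMap O K)) q ∈ W ↔ P ∉ q.asIdeal)
    (Q : MvPolynomial (Fin n) O) (r : K) (hr : r ≠ 0) (hQ : map (algebraMap O K) Q = C r * P)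
    (q : PrimeSpectrum (MvPolynomial (Fin n) O)) (hq : q.asIdeal.comap C = ⊥) :
    q ∈ W ↔ Q ∉ q.asIdeal := by
  let M := (nonZeroDivisors O).map (C (σ := Fin n) (R := O))
  letI : Algebra (MvPolynomial (Fin n) O) (MvPolynomial (Fin n) K) := MvPolynomial.algebraMvPolynomial
  have hL : IsLocalization M (MvPolynomial (Fin n) K) := MvPolynomial.isLocalization ..
  have hdisj : Disjoint (M : Set (MvPolynomial (Fin n) O)) q.asIdeal := by
    rw [Set.disjoint_left]
    rintro _ ⟨m, hm, rfl⟩ h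
    have : m ∈ q.asIdeal.comap (C (σ := Fin n)) := h
    rw [hq] at this
    exact nonZeroDivisors.ne_zero hm this
  obtain ⟨p, hp⟩ : ∃ p : PrimeSpectrum (MvPolynomial (Fin n) K),
      PrimeSpectrum.comap (map (algebraMap O K)) p = q := by
    have : q ∈ Set.range (PrimeSpectrum.comap (algebraMap (MvPolynomial (Fin n) O) (MvPolynomial (Fin n) K))) := by
      rw [PrimeSpectrum.localization_comap_range _ M]
      exact hdisj
    exact this
  rw [← hp, hK, ← not_iff_not, not_not, not_not]
  have : Q ∈ (PrimeSpectrum.comap (map (algebraMap O K)) p).asIdeal ↔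
    map (algebraMap O K) Q ∈ p.asIdeal := Iff.rfl
  rw [this, hQ]
  constructor
  · exact fun h => Ideal.mul_mem_left _ _ h
  · intro h
    have h2 := Ideal.mul_mem_left _ (C r⁻¹) h
    rwa [← _root_.mul_assoc, ← map_mul, inv_mul_cancel₀ hr, map_one, _root_.one_mul] at h2

theorem local_eqn1 {n : ℕ} {O K : Type*} [CommRing O] [IsDomain O] [IsNoetherianRing O]
    [IsIntegrallyClosed O] [IsLocalRing O] [Field K] [Algebra O K]
    [IsFractionRing O K] (P : MvPolynomial (Fin n) K) (hP : P ≠ 0)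
    (W : Set (PrimeSpectrum (MvPolynomial (Fin n) O)))
    (hgen : ∀ q q' : PrimeSpectrum (MvPolynomial (Fin n) O), q.asIdeal ≤ q'.asIdeal → q' ∈ W → q ∈ W)
    (hm : ∀ q : PrimeSpectrum (MvPolynomial (Fin n) O),
      q.asIdeal = (IsLocalRing.maximalIdeal O).map C → q ∈ W)
    (hK : ∀ q : PrimeSpectrum (MvPolynomial (Fin n) K),
      PrimeSpectrum.comap (map (algebraMap O K)) q ∈ W ↔ P ∉ q.asIdeal) :
    ∃ a, coeff a P ≠ 0 ∧ ∀ b, ∃ r : O, algebraMap O K r = coeff b P / coeff a P := by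
  classical
  obtain ⟨d, hd⟩ := IsLocalization.exist_integer_multiples (nonZeroDivisors O) P.support
    (fun a => coeff a P)
  have hd0 : algebraMap O K d ≠ 0 := by
    simpa using nonZeroDivisors.ne_zero d.2
  obtain ⟨P', hP'⟩ : ∃ P' : MvPolynomial (Fin n) O, map (algebraMap O K) P' =
      C (algebraMap O K d) * P := by
    have : C (algebraMap O K d) * P ∈ Set.range (map (σ := Fin n) (algebraMap O K)) := by
      rw [MvPolynomial.mem_range_map_iff_coeffs_subset]
      intro y hy
      rw [Finset.mem_coe, mem_coeffs_iff] at hy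
      obtain ⟨a, -, rfl⟩ := hy
      rw [coeff_C_mul]
      by_cases ha : a ∈ P.support
      · obtain ⟨r, hr⟩ := hd a ha
        exact ⟨r, by rw [hr, Algebra.smul_def]⟩
      · rw [notMem_support_iff.mp ha]; exact ⟨0, by simp⟩
    exact this
  have hP'0 : P' ≠ 0 := by
    rintro rfl
    rw [map_zero] at hP'
    exact mul_ne_zero (by simpa using hd0) hP hP'.symm
  obtain ⟨a, ha, hab⟩ := claim1 P' hP'0 (fun q hq hqm hq0 => by
    refine (eqn_bot P W hK P' _ hd0 hP' ⟨q, hq⟩ hq0).mp ?_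
    exact hgen _ ⟨_, mapC_prime _⟩ hqm (hm _ rfl))
  have hc : ∀ b, algebraMap O K (coeff b P') = algebraMap O K d * coeff b P := fun b => by
    rw [← coeff_map, hP', coeff_C_mul]
  have ha' : coeff a P ≠ 0 := fun h => by
    have := hc a
    rw [h, mul_zero] at this
    exact ha (by simpa using this)
  refine ⟨a, ha', fun b => ?_⟩
  obtain ⟨r, hr⟩ := hab b
  refine ⟨r, ?_⟩
  rw [eq_div_iff ha']
  have h1 := hc b
  rw [hr, map_mul, hc a] at h1
  apply mul_left_cancel₀ hd0
  rw [← h1]; ring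

theorem local_eqn2 {n : ℕ} {O K : Type*} [CommRing O] [IsDomain O] [IsNoetherianRing O]
    [IsIntegrallyClosed O] [IsLocalRing O] [Field K] [Algebra O K]
    [IsFractionRing O K] (P : MvPolynomial (Fin n) K)
    (W : Set (PrimeSpectrum (MvPolynomial (Fin n) O)))
    (hgen : ∀ q q' : PrimeSpectrum (MvPolynomial (Fin n) O), q.asIdeal ≤ q'.asIdeal → q' ∈ W → q ∈ W)
    (H : ∀ g, (∀ q : PrimeSpectrum (MvPolynomial (Fin n) O), Ht1 q.asIdeal → g ∉ q.asIdeal → q ∈ W) →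
      ∀ q : PrimeSpectrum (MvPolynomial (Fin n) O), g ∉ q.asIdeal → q ∈ W)
    (hm : ∀ q : PrimeSpectrum (MvPolynomial (Fin n) O),
      q.asIdeal = (IsLocalRing.maximalIdeal O).map C → q ∈ W)
    (hK : ∀ q : PrimeSpectrum (MvPolynomial (Fin n) K),
      PrimeSpectrum.comap (map (algebraMap O K)) q ∈ W ↔ P ∉ q.asIdeal)
    (Q : MvPolynomial (Fin n) O) (a : Fin n →₀ ℕ) (ha : coeff a P ≠ 0)
    (hQ : ∀ b, algebraMap O K (coeff b Q) = coeff b P / coeff a P)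
    (q : PrimeSpectrum (MvPolynomial (Fin n) O)) : q ∈ W ↔ Q ∉ q.asIdeal := by
  refine claim2 Q ⟨a, ?_⟩ W hgen H hm (fun q hq => eqn_bot P W hK Q (coeff a P)⁻¹
    (inv_ne_zero ha) ?_ q hq) q
  · apply IsFractionRing.injective O K
    rw [hQ, div_self ha, map_one]
  · ext b
    rw [coeff_map, hQ, coeff_C_mul]; field_simp
end Alg
end

noncomputable section
namespace Chart
variable {k : Type u} [Field k] {G : GroupSchemeOver k} {X : SchemeOver k}
    {α : ActionOver G X} (c : Chart α)

/-- scalar map of a ring-valued point -/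
def sc {X : SchemeOver k} {O : CommRingCat.{u}} (η : Spec O ⟶ X.carrier) : k →+* O :=
  (Spec.preimage (η ≫ X.str)).hom

/-- coordinates -/
def tm {O : CommRingCat.{u}} (η : Spec O ⟶ X.carrier) :
    Spec (CommRingCat.of (MvPolynomial (Fin c.n) O)) ⟶ c.S :=
  Spec.map (CommRingCat.ofHom (MvPolynomial.map (sc η)))

/-- point -/
def xm {O : CommRingCat.{u}} (η : Spec O ⟶ X.carrier) :
    Spec (CommRingCat.of (MvPolynomial (Fin c.n) O)) ⟶ X.carrier :=
  Spec.map (CommRingCat.ofHom (MvPolynomial.C (σ := Fin c.n) (R := O))) ≫ η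

theorem tm_compat {O : CommRingCat.{u}} (η : Spec O ⟶ X.carrier) :
    c.tm η ≫ c.ρ = c.xm η ≫ X.str := by
  have : η ≫ X.str = Spec.map (CommRingCat.ofHom (sc η)) := (Spec.map_preimage _).symm
  rw [tm, xm, Category.assoc, this, ρ, ← Spec.map_comp, ← Spec.map_comp, ← CommRingCat.ofHom_comp,
    ← CommRingCat.ofHom_comp]
  congr 2
  ext x
  simp

theorem sc_comp {O O' : CommRingCat.{u}} (η : Spec O ⟶ X.carrier) (ψ : O ⟶ O') :
    sc (Spec.map ψ ≫ η) = ψ.hom.comp (sc η) := by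
  have : Spec.preimage ((Spec.map ψ ≫ η) ≫ X.str) = Spec.preimage (η ≫ X.str) ≫ ψ := by
    apply Spec.map_injective
    rw [Spec.map_comp, Spec.map_preimage, Spec.map_preimage, Category.assoc]
  rw [sc, this]; rfl

/-- good locus over a ring -/
def WO {O : CommRingCat.{u}} (η : Spec O ⟶ X.carrier) :
    Set (PrimeSpectrum (MvPolynomial (Fin c.n) O)) :=
  c.W (c.tm η) (c.xm η) (c.tm_compat η)

theorem mem_WO_iff {O O' : CommRingCat.{u}} (η : Spec O ⟶ X.carrier) (ψ : O ⟶ O')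
    {η' : Spec O' ⟶ X.carrier} (e : Spec.map ψ ≫ η = η')
    (q : PrimeSpectrum (MvPolynomial (Fin c.n) O')) :
    q ∈ c.WO η' ↔ PrimeSpectrum.comap (MvPolynomial.map ψ.hom) q ∈ c.WO η := by
  subst e
  refine c.mem_W_iff (c.tm_compat η) (Spec.map (CommRingCat.ofHom (MvPolynomial.map ψ.hom)))
    (c.tm_compat _) ?_ ?_ q
  · rw [tm, tm, ← Spec.map_comp, ← CommRingCat.ofHom_comp]
    congr 2
    rw [sc_comp]
    ext x <;> simp
  · rw [xm, xm, ← Category.assoc, ← Category.assoc, ← Spec.map_comp, ← Spec.map_comp]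
    congr 2
    ext x
    simp

theorem isOpen_WO {O : CommRingCat.{u}} (η : Spec O ⟶ X.carrier) : IsOpen (c.WO η) :=
  c.isOpen_W _

theorem WO_gen {O : CommRingCat.{u}} (η : Spec O ⟶ X.carrier)
    (q q' : PrimeSpectrum (MvPolynomial (Fin c.n) O)) (h : q.asIdeal ≤ q'.asIdeal)
    (h' : q' ∈ c.WO η) : q ∈ c.WO η :=
  ((PrimeSpectrum.le_iff_specializes q q').1 h).mem_open (c.isOpen_WO η) h'

theorem WO_H [IsSeparated X.str] {O : CommRingCat.{u}} [IsDomain O] [IsNoetherianRing O]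
    [IsIntegrallyClosed O] (η : Spec O ⟶ X.carrier) (g : MvPolynomial (Fin c.n) O)
    (hg : ∀ q : PrimeSpectrum (MvPolynomial (Fin c.n) O), Alg.Ht1 q.asIdeal → g ∉ q.asIdeal →
      q ∈ c.WO η) (q : PrimeSpectrum (MvPolynomial (Fin c.n) O)) (hq : g ∉ q.asIdeal) :
    q ∈ c.WO η := by
  haveI := Alg.icl c.n O
  exact c.hartogs' (MvPolynomial (Fin c.n) O) (c.tm_compat η) g hg q hq

/-- generic points of fibres are good -/
def Gen : Prop := ∀ (x : X.carrier)
  (q : PrimeSpectrum (MvPolynomial (Fin c.n) (X.carrier.presheaf.stalk x))),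
  q.asIdeal = (IsLocalRing.maximalIdeal (X.carrier.presheaf.stalk x)).map MvPolynomial.C →
    q ∈ c.WO (X.carrier.fromSpecStalk x)

/-- equation -/
def IsEq [IsIntegral X.carrier] (P : MvPolynomial (Fin c.n) X.carrier.functionField) : Prop :=
  P ≠ 0 ∧ ∀ q, q ∈ c.WO (X.carrier.fromSpecStalk (genericPoint X.carrier)) ↔ P ∉ q.asIdeal

theorem exists_P [IsIntegral X.carrier] [IsSeparated X.str] (hg : c.Gen) :
    ∃ P, c.IsEq P := by
  letI : Field (X.carrier.presheaf.stalk (genericPoint X.carrier)) :=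
    inferInstanceAs (Field X.carrier.functionField)
  refine Alg.exists_eqn (c.WO (X.carrier.fromSpecStalk (genericPoint X.carrier))) (c.isOpen_WO _)
    ⟨⟨_, Alg.mapC_prime (IsLocalRing.maximalIdeal _)⟩, hg _ _ rfl⟩ (fun g h => c.WO_H _ g h)

variable {c} in
theorem IsEq.stalk [IsIntegral X.carrier]
    {P : MvPolynomial (Fin c.n) X.carrier.functionField} (hP : c.IsEq P) (x : X.carrier)
    (q : PrimeSpectrum (MvPolynomial (Fin c.n) X.carrier.functionField)) :
    PrimeSpectrum.comap (MvPolynomial.map (algebraMap (X.carrier.presheaf.stalk x)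
      X.carrier.functionField)) q ∈ c.WO (X.carrier.fromSpecStalk x) ↔ P ∉ q.asIdeal := by
  rw [← hP.2]
  exact (c.mem_WO_iff (X.carrier.fromSpecStalk x) (X.carrier.presheaf.stalkSpecializes
    ((genericPoint_spec X.carrier).specializes trivial))
    (Scheme.SpecMap_stalkSpecializes_fromSpecStalk _) q).symm

variable {c} in
theorem IsEq.good1 [IsIntegral X.carrier] [IsLocallyNoetherian X.carrier]
    (hn : IsNormalScheme X.carrier) (hg : c.Gen)
    {P : MvPolynomial (Fin c.n) X.carrier.functionField} (hP : c.IsEq P) (x : X.carrier) :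
    ∃ a, P.coeff a ≠ 0 ∧ ∀ b, P.coeff b / P.coeff a ∈ Rat.loc X.carrier x := by
  haveI := (hn x).1
  haveI := (hn x).2
  exact Alg.local_eqn1 P hP.1 (c.WO (X.carrier.fromSpecStalk x)) (c.WO_gen _) (hg x) (hP.stalk x)

variable {c} in
theorem IsEq.good2 [IsIntegral X.carrier] [IsLocallyNoetherian X.carrier] [IsSeparated X.str]
    (hn : IsNormalScheme X.carrier) (hg : c.Gen)
    {P : MvPolynomial (Fin c.n) X.carrier.functionField} (hP : c.IsEq P) (x : X.carrier)
    (Q : MvPolynomial (Fin c.n) (X.carrier.presheaf.stalk x)) (a) (ha : P.coeff a ≠ 0)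
    (hQ : ∀ b, algebraMap _ X.carrier.functionField (Q.coeff b) = P.coeff b / P.coeff a) (q) :
    q ∈ c.WO (X.carrier.fromSpecStalk x) ↔ Q ∉ q.asIdeal := by
  haveI := (hn x).1
  haveI := (hn x).2
  exact Alg.local_eqn2 P (c.WO (X.carrier.fromSpecStalk x)) (c.WO_gen _) (c.WO_H _)
    (hg x) (hP.stalk x) Q a ha hQ q
end Chart
end

noncomputable section

namespace Irr

theorem preirr_of_local {Z : Type*} [TopologicalSpace Z] [ConnectedSpace Z]
    (h : ∀ z : Z, ∃ V : Set Z, IsOpen V ∧ z ∈ V ∧ IsPreirreducible V) : PreirreducibleSpace Z := by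
  have key : ∀ Ω : Set Z, IsOpen Ω → Ω.Nonempty → closure Ω = Set.univ := by
    intro Ω hΩ hne
    refine IsClopen.eq_univ ⟨isClosed_closure, ?_⟩ hne.closure
    rw [isOpen_iff_forall_mem_open]
    intro z hz
    obtain ⟨V, hV, hzV, hVi⟩ := h z
    refine ⟨V, ?_, hV, hzV⟩
    obtain ⟨y, hy1, hy2⟩ := mem_closure_iff.mp hz V hV hzV
    intro w hw
    rw [mem_closure_iff]
    intro N hN hwN
    obtain ⟨v, -, hv1, hv2⟩ := hVi N Ω hN hΩ ⟨w, hw, hwN⟩ ⟨y, hy1, hy2⟩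
    exact ⟨v, hv1, hv2⟩
  refine ⟨fun A B hA hB ⟨a, _, ha⟩ ⟨b, _, hb⟩ => ?_⟩
  have : a ∈ closure B := by rw [key B hB ⟨b, hb⟩]; trivial
  obtain ⟨v, hv1, hv2⟩ := mem_closure_iff.mp this A hA ha
  exact ⟨v, trivial, hv1, hv2⟩

variable {k : Type u} [Field k] (G : GroupSchemeOver k)

/-- base field extension -/
abbrev cl (k : Type u) [Field k] : Spk (AlgebraicClosure k) ⟶ Spk k :=
  Spec.map (CommRingCat.ofHom (algebraMap k (AlgebraicClosure k)))

/-- base change to the algebraic closure -/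
abbrev Gb : Scheme.{u} := pullback G.str (cl k)

instance : IsIntegralHom (cl k) := by
  rw [cl, IsIntegralHom.SpecMap_iff]
  exact algebraMap_isIntegral_iff.mpr inferInstance

/-- unit of the base change -/
def eb : Spk (AlgebraicClosure k) ⟶ Gb G :=
  pullback.lift (cl k ≫ G.one) (𝟙 _) (by rw [Category.assoc, G.one_str, Category.comp_id, Category.id_comp])

instance : Subsingleton (Spk k) := inferInstanceAs (Subsingleton (PrimeSpectrum k))

theorem fib_e (z : Gb G) (p : Spk k) (hz : pullback.fst G.str (cl k) z = G.one p) :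
    ∃ y, eb G y = z := by
  obtain ⟨w, hw1, hw2⟩ := Scheme.Pullback.exists_preimage_pullback
    (f := pullback.fst G.str (cl k)) (g := G.one) z p hz
  have e : pullback.fst (pullback.fst G.str (cl k)) G.one =
      (pullback.fst (pullback.fst G.str (cl k)) G.one ≫ pullback.snd G.str (cl k)) ≫ eb G := by
    have h1 := pullback.condition (f := pullback.fst G.str (cl k)) (g := G.one)
    apply pullback.hom_ext
    · rw [Category.assoc, eb, pullback.lift_fst, Category.assoc, ← pullback.condition_assoc,
        reassoc_of% h1, reassoc_of% G.one_str, h1]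
    · rw [Category.assoc, eb, pullback.lift_snd, Category.comp_id]
  refine ⟨(pullback.fst (pullback.fst G.str (cl k)) G.one ≫ pullback.snd G.str (cl k)) w, ?_⟩
  rw [← Scheme.Hom.comp_apply, ← e, hw1]

theorem connected [ConnectedSpace G.carrier] : ConnectedSpace (Gb G) := by
  have hopen : IsOpenMap (pullback.fst G.str (cl k)) := (pullback.fst G.str (cl k)).isOpenMap
  have hclosed : IsClosedMap (pullback.fst G.str (cl k)) := (pullback.fst G.str (cl k)).isClosedMap
  obtain ⟨p⟩ : Nonempty (Spk k) := inferInstanceAs (Nonempty (PrimeSpectrum k))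
  obtain ⟨p'⟩ : Nonempty (Spk (AlgebraicClosure k)) :=
    inferInstanceAs (Nonempty (PrimeSpectrum (AlgebraicClosure k)))
  have key : ∀ V : Set (Gb G), IsClopen V → V.Nonempty → eb G p' ∈ V := by
    intro V hV hne
    have : pullback.fst G.str (cl k) '' V = Set.univ :=
      IsClopen.eq_univ ⟨hclosed _ hV.1, hopen _ hV.2⟩ (hne.image _)
    obtain ⟨z, hzV, hz⟩ : G.one p ∈ pullback.fst G.str (cl k) '' V := by rw [this]; trivial
    obtain ⟨y, rfl⟩ := fib_e G z p hz
    rwa [Subsingleton.elim p' y]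
  haveI : PreconnectedSpace (Gb G) := by
    rw [preconnectedSpace_iff_clopen]
    intro V hV
    by_contra! hcon
    obtain ⟨h1, h2⟩ := hcon
    exact key _ hV.compl (Set.nonempty_compl.mpr h2) (key _ hV h1)
  exact ⟨⟨eb G p'⟩⟩

/-- translation -/
def tr (h : Spk (AlgebraicClosure k) ⟶ G.carrier) (hh : h ≫ G.str = cl k) : Gb G ⟶ Gb G :=
  pullback.lift (G.mul (pullback.snd G.str (cl k) ≫ h) (pullback.fst G.str (cl k))
    (by rw [Category.assoc, hh, pullback.condition])) (pullback.snd G.str (cl k))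
    (by rw [G.mul_str, Category.assoc, hh])

end Irr
end

noncomputable section

namespace Irr
variable {k : Type u} [Field k] (G : GroupSchemeOver k)

theorem comp_tr {T : Scheme.{u}} (v : T ⟶ Gb G) (h : Spk (AlgebraicClosure k) ⟶ G.carrier)
    (hh : h ≫ G.str = cl k) (hc) :
    v ≫ tr G h hh = pullback.lift (G.mul ((v ≫ pullback.snd G.str (cl k)) ≫ h)
      (v ≫ pullback.fst G.str (cl k)) hc) (v ≫ pullback.snd G.str (cl k))
      (by rw [G.mul_str]; simp only [Category.assoc, hh]) := by
  apply pullback.hom_ext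
  · rw [Category.assoc, tr, pullback.lift_fst, pullback.lift_fst]
    refine (G.mul_natural v _ _ _ ?_).trans (G.mul_congr ?_ rfl _ _)
    · simp only [Category.assoc, hh, pullback.condition]
    · simp only [Category.assoc]
  · rw [Category.assoc, tr, pullback.lift_snd, pullback.lift_snd]

theorem tr_comp (h h' : Spk (AlgebraicClosure k) ⟶ G.carrier)
    (hh : h ≫ G.str = cl k) (hh' : h' ≫ G.str = cl k) (e) (e') :
    tr G h hh ≫ tr G h' hh' = tr G (G.mul h' h e) e' := by
  have s2 : tr G h hh ≫ pullback.snd G.str (cl k) = pullback.snd G.str (cl k) := by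
    rw [tr, pullback.lift_snd]
  have s1 := pullback.condition (f := G.str) (g := cl k)
  have s3 : tr G h hh ≫ pullback.fst G.str (cl k) = _ := pullback.lift_fst _ _ _
  rw [comp_tr G _ _ _ (by simp only [Category.assoc, pullback.condition, hh'])]
  apply pullback.hom_ext
  · rw [pullback.lift_fst]
    conv_rhs => rw [tr, pullback.lift_fst]
    have hn := G.mul_natural (pullback.snd G.str (cl k)) h' h e (by simp only [Category.assoc, hh, hh'])
    refine (G.mul_congr ?_ s3 _ ?_).trans (((G.mul_assoc (pullback.snd G.str (cl k) ≫ h')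
      (pullback.snd G.str (cl k) ≫ h) (pullback.fst G.str (cl k)) ?_ ?_ ?_ ?_).symm).trans ?_)
    · rw [s2]
    · rw [G.mul_str]; simp only [Category.assoc, hh, hh']
    · simp only [Category.assoc, hh, hh']
    · rw [G.mul_str]; simp only [Category.assoc, hh', s1]
    · simp only [Category.assoc, hh, s1]
    · rw [G.mul_str]; simp only [Category.assoc, hh, hh']
    · exact G.mul_congr hn.symm rfl _ _
  · rw [pullback.lift_snd, s2]
    conv_rhs => rw [tr, pullback.lift_snd]

theorem tr_one (h : Spk (AlgebraicClosure k) ⟶ G.carrier) (hh : h ≫ G.str = cl k)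
    (e : h = cl k ≫ G.one) : tr G h hh = 𝟙 _ := by
  subst e
  apply pullback.hom_ext
  · rw [tr, pullback.lift_fst, Category.id_comp]
    refine (G.mul_congr ?_ rfl _ ?_).trans (G.one_mul _ ?_)
    · rw [pullback.condition_assoc]
    · simp only [Category.assoc, G.one_str, Category.comp_id]
    · simp only [Category.assoc, G.one_str, Category.comp_id]
  · rw [tr, pullback.lift_snd, Category.id_comp]

theorem tr_inv (h : Spk (AlgebraicClosure k) ⟶ G.carrier) (hh : h ≫ G.str = cl k) (hh') :
    tr G h hh ≫ tr G (G.inv h) hh' = 𝟙 _ := by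
  rw [tr_comp G _ _ _ _ (by rw [hh, hh']) (by rw [G.mul_str, hh'])]
  apply tr_one
  rw [G.inv_mul, reassoc_of% hh]

instance tr_iso (h : Spk (AlgebraicClosure k) ⟶ G.carrier) (hh : h ≫ G.str = cl k) :
    IsIso (tr G h hh) := by
  have h1 : G.inv h ≫ G.str = cl k := by rw [G.inv_str, hh]
  have h2 : G.inv (G.inv h) ≫ G.str = cl k := by rw [G.inv_str, h1]
  have a := tr_inv G h hh h1
  have b := tr_inv G _ h1 h2
  have c : tr G (G.inv (G.inv h)) h2 = tr G h hh := by
    calc _ = (tr G h hh ≫ tr G _ h1) ≫ tr G (G.inv (G.inv h)) h2 := by rw [a, Category.id_comp]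
      _ = tr G h hh := by rw [Category.assoc, b, Category.comp_id]
  rw [c] at b
  exact ⟨_, a, b⟩

theorem exists_tr (y z : Spk (AlgebraicClosure k) ⟶ Gb G) (hy : y ≫ pullback.snd _ _ = 𝟙 _)
    (hz : z ≫ pullback.snd _ _ = 𝟙 _) : ∃ t : Gb G ⟶ Gb G, IsIso t ∧ y ≫ t = z := by
  have s1 := pullback.condition (f := G.str) (g := cl k)
  have ey : (y ≫ pullback.fst _ _) ≫ G.str = cl k := by
    rw [Category.assoc, s1, reassoc_of% hy]
  have ez : (z ≫ pullback.fst _ _) ≫ G.str = cl k := by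
    rw [Category.assoc, s1, reassoc_of% hz]
  have ey' : G.inv (y ≫ pullback.fst _ _) ≫ G.str = cl k := by rw [G.inv_str, ey]
  refine ⟨tr G (G.mul (z ≫ pullback.fst _ _) (G.inv (y ≫ pullback.fst _ _)) (by rw [ez, ey']))
    (by rw [G.mul_str, ez]), inferInstance, ?_⟩
  rw [comp_tr G _ _ _ (by rw [hy, Category.id_comp, G.mul_str, ez, ey])]
  apply pullback.hom_ext
  · rw [pullback.lift_fst]
    refine (G.mul_congr (by rw [hy, Category.id_comp]) rfl _ (by rw [G.mul_str, ez, ey])).trans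
      ((G.mul_assoc _ _ _ _ _ (by rw [ey, ey']) (by rw [G.mul_str, ez, ey'])).trans ?_)
    refine (G.mul_congr rfl (G.inv_mul _ _) _ ?_).trans ((G.mul_congr rfl ?_ _ ?_).trans (G.mul_one _ ?_))
    · rw [← Category.assoc (y ≫ _), ey, ez, Category.assoc, G.one_str, Category.comp_id]
    · rw [← Category.assoc (y ≫ _), ey, ← Category.assoc (z ≫ _), ez]
    · rw [← Category.assoc (z ≫ _), ez, Category.assoc, G.one_str, Category.comp_id]
    · rw [← Category.assoc (z ≫ _), ez, Category.assoc, G.one_str, Category.comp_id]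
  · rw [pullback.lift_snd, hy, hz]

theorem preirr [ConnectedSpace G.carrier] (hG : G.IsAlgebraic) : PreirreducibleSpace (Gb G) := by
  haveI := connected G
  haveI : LocallyOfFiniteType G.str := hG.1
  haveI : QuasiCompact G.str := hG.2
  haveI : IsLocallyNoetherian (Spk (AlgebraicClosure k)) :=
    inferInstanceAs (IsLocallyNoetherian (Spec (CommRingCat.of (AlgebraicClosure k))))
  haveI : IsLocallyNoetherian (Gb G) := inferInstance
  haveI : CompactSpace (Spk (AlgebraicClosure k)) := inferInstance
  haveI : CompactSpace (Gb G) := QuasiCompact.compactSpace_of_compactSpace (pullback.snd G.str (cl k))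
  haveI : IsNoetherian (Gb G) := {}
  haveI : TopologicalSpace.NoetherianSpace (Gb G) := inferInstance
  obtain ⟨z0⟩ : Nonempty (Gb G) := inferInstance
  obtain ⟨V, hV, hVne, hVs⟩ :=
    TopologicalSpace.NoetherianSpace.exists_isOpen_nonempty_subset_irreducibleComponent _
      (irreducibleComponent_mem_irreducibleComponents z0)
  have hVi : IsPreirreducible V :=
    (irreducibleComponent_mem_irreducibleComponents z0).1.isPreirreducible.open_subset hV hVs
  haveI : JacobsonSpace (Gb G) := LocallyOfFiniteType.jacobsonSpace (pullback.snd G.str (cl k))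
  obtain ⟨z, hzV, hz⟩ := nonempty_inter_closedPoints hVne hV.isLocallyClosed
  replace hz : IsClosed {z} := hz
  apply preirr_of_local
  intro y
  obtain ⟨y', hy', hyc⟩ := IsClosed.exists_closed_singleton
    (S := closure {y}) isClosed_closure ⟨y, subset_closure rfl⟩
  obtain ⟨t, ht, e⟩ := exists_tr G (pointOfClosedPoint (pullback.snd G.str (cl k)) y' hyc)
    (pointOfClosedPoint (pullback.snd G.str (cl k)) z hz)
    (pointOfClosedPoint_comp _ _ _) (pointOfClosedPoint_comp _ _ _)
  have e' : t y' = z := by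
    obtain ⟨p'⟩ : Nonempty (Spk (AlgebraicClosure k)) :=
      inferInstanceAs (Nonempty (PrimeSpectrum (AlgebraicClosure k)))
    have := congr($e p')
    rwa [Scheme.Hom.comp_apply, pointOfClosedPoint_apply, pointOfClosedPoint_apply] at this
  have ho : IsOpen (t ⁻¹' V) := hV.preimage t.continuous
  refine ⟨t ⁻¹' V, ho, ?_, ?_⟩
  · obtain ⟨w, hw1, hw2⟩ := mem_closure_iff.mp hy' _ ho (by change t y' ∈ V; rwa [e'])
    rw [Set.mem_singleton_iff] at hw2
    rwa [← hw2]
  · exact hVi.preimage t.isOpenEmbedding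

end Irr
end

noncomputable section

theorem Irr.eq_of_specializes {Y Z : Scheme.{u}} (f : Y ⟶ Z) [IsFinite f] (a b : Y)
    (h : a ⤳ b) (e : f a = f b) : a = b := by
  haveI : DiscreteTopology (f ⁻¹' {f b}) :=
    isDiscrete_iff_discreteTopology.mp (f.isDiscrete_preimage_singleton (f b))
  have h1 : (⟨a, e⟩ : (f ⁻¹' {f b} : Set Y)) ⤳ ⟨b, rfl⟩ := by
    rwa [Topology.IsInducing.subtypeVal.specializes_iff.symm]
  exact congrArg Subtype.val h1.eq

namespace Chart
variable {k : Type u} [Field k] {G : GroupSchemeOver k} {X : SchemeOver k}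
    {α : ActionOver G X} (c : Chart α)

theorem sc_bar {x : Spec (CommRingCat.of (AlgebraicClosure k)) ⟶ X.carrier}
    (hx : x ≫ X.str = Irr.cl k) : sc x = algebraMap k (AlgebraicClosure k) := by
  have : Spec.preimage (x ≫ X.str) = CommRingCat.ofHom (algebraMap k (AlgebraicClosure k)) := by
    apply Spec.map_injective
    rw [Spec.map_preimage, hx]
  rw [sc, this]; rfl

theorem isPullback_tm {x : Spec (CommRingCat.of (AlgebraicClosure k)) ⟶ X.carrier}
    (hx : x ≫ X.str = Irr.cl k) :
    IsPullback (c.tm x) (Spec.map (CommRingCat.ofHom (MvPolynomial.C (σ := Fin c.n)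
      (R := AlgebraicClosure k)))) c.ρ (Irr.cl k) := by
  letI : Algebra (MvPolynomial (Fin c.n) k) (MvPolynomial (Fin c.n) (AlgebraicClosure k)) :=
    MvPolynomial.algebraMvPolynomial
  have e : c.tm x = Spec.map (CommRingCat.ofHom (algebraMap (MvPolynomial (Fin c.n) k)
      (MvPolynomial (Fin c.n) (AlgebraicClosure k)))) := by
    rw [tm, sc_bar hx]; rfl
  rw [e]
  exact isPullback_SpecMap_of_isPushout _ _ _ _
    (CommRingCat.isPushout_of_isPushout k (MvPolynomial (Fin c.n) k) (AlgebraicClosure k)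
      (MvPolynomial (Fin c.n) (AlgebraicClosure k)))

theorem bot_mem [ConnectedSpace G.carrier] (hG : G.IsAlgebraic)
    (x : Spec (CommRingCat.of (AlgebraicClosure k)) ⟶ X.carrier)
    (hx : x ≫ X.str = Irr.cl k) (hc) (z : Irr.Gb G)
    (hz : α.act (pullback.fst G.str (Irr.cl k)) (pullback.snd G.str (Irr.cl k) ≫ x) hc z ∈ c.U)
    (q : PrimeSpectrum (MvPolynomial (Fin c.n) (AlgebraicClosure k))) (hq : q.asIdeal = ⊥) :
    q ∈ c.WO x := by
  refine (c.mem_W_iff_pullback (c.tm_compat x) q).mpr ⟨?_, fun v hv => ?_⟩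
  · change c.f ∉ q.asIdeal.comap (MvPolynomial.map (sc x))
    rw [Ideal.mem_comap, hq, Ideal.mem_bot, map_eq_zero_iff _ (MvPolynomial.map_injective _
      (by rw [sc_bar hx]; exact (algebraMap k _).injective))]
    exact c.f_ne
  · have P1 := (IsPullback.of_hasPullback (c.tm x) c.ι).flip.paste_vert (c.isPullback_tm hx)
    rw [← c.j_str'] at P1
    have P2 := IsPullback.of_bot' P1 (IsPullback.of_hasPullback G.str (Irr.cl k))
    obtain ⟨m, hm, P3⟩ : ∃ m : pullback (c.tm x) c.ι ⟶ Irr.Gb G, m ≫ pullback.snd _ _ =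
        pullback.fst (c.tm x) c.ι ≫ Spec.map (CommRingCat.ofHom (MvPolynomial.C (σ := Fin c.n)
      (R := AlgebraicClosure k))) ∧
        IsPullback (pullback.snd (c.tm x) c.ι) m c.j (pullback.fst G.str (Irr.cl k)) :=
      ⟨_, IsPullback.lift_snd _ _ _ _, P2⟩
    haveI : IsOpenImmersion m := MorphismProperty.of_isPullback P3 c.jopen
    have ea : c.a (c.tm_compat x) = m ≫ α.act (pullback.fst G.str (Irr.cl k))
        (pullback.snd G.str (Irr.cl k) ≫ x) hc := by
      refine Eq.trans ?_ (α.act_natural m _ _ _ ?_).symm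
      · refine α.act_congr P3.w ?_ _ _
        rw [reassoc_of% hm]; rfl
      · rw [Category.assoc, hc]; simp only [Category.assoc]
    obtain ⟨b, hb⟩ : ∃ b, b = α.act (pullback.fst G.str (Irr.cl k))
        (pullback.snd G.str (Irr.cl k) ≫ x) hc := ⟨_, rfl⟩
    rw [← hb] at hz ea
    haveI := Irr.preirr G hG
    have h1 := ((PreirreducibleSpace.isPreirreducible_univ (X := Irr.Gb G)).preimage m.isOpenEmbedding)
    haveI : PreirreducibleSpace (pullback (c.tm x) c.ι : Scheme.{u}) := ⟨by simpa using h1⟩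
    haveI : IrreducibleSpace (pullback (c.tm x) c.ι : Scheme.{u}) := ⟨⟨v⟩⟩
    have hgen := genericPoint_specializes v
    obtain ⟨ζ, hζ⟩ : ∃ ζ, ζ = genericPoint (pullback (c.tm x) c.ι : Scheme.{u}) := ⟨_, rfl⟩
    have e1 : pullback.fst (c.tm x) c.ι ζ = pullback.fst (c.tm x) c.ι v := by
      rw [hv]
      have := hgen.map (pullback.fst (c.tm x) c.ι).continuous
      rw [hv, ← hζ] at this
      have h3 := (PrimeSpectrum.le_iff_specializes _ _).2 this
      apply PrimeSpectrum.ext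
      rw [hq]
      exact le_bot_iff.mp (hq ▸ h3)
    have e2 : ζ = v := Irr.eq_of_specializes (pullback.fst (c.tm x) c.ι) ζ v (hζ ▸ hgen) e1
    refine mem_of_eq ea ?_
    obtain ⟨y, -, hy1, ⟨y', hy2⟩⟩ := (PreirreducibleSpace.isPreirreducible_univ (X := Irr.Gb G))
      (b ⁻¹ᵁ c.U) m.opensRange (b ⁻¹ᵁ c.U).isOpen m.opensRange.isOpen ⟨z, trivial, hz⟩
      ⟨m v, trivial, ⟨v, rfl⟩⟩
    have h5 : y' ∈ ((m ≫ b) ⁻¹ᵁ c.U) := by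
      change (m ≫ b) y' ∈ c.U
      rw [Scheme.Hom.comp_apply, hy2]; exact hy1
    rw [← e2, hζ]
    exact (genericPoint_specializes y').mem_open ((m ≫ b) ⁻¹ᵁ c.U).isOpen h5

end Chart
end

noncomputable section

namespace Chart
variable {k : Type u} [Field k] {G : GroupSchemeOver k} {X : SchemeOver k}
    {α : ActionOver G X} (c : Chart α)

/-- orbit map of an open -/
def orb {X : SchemeOver k} (α : ActionOver G X) (U : X.carrier.Opens) :
    pullback G.str (U.ι ≫ X.str) ⟶ X.carrier :=
  α.act (pullback.fst G.str (U.ι ≫ X.str)) (pullback.snd G.str (U.ι ≫ X.str) ≫ U.ι)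
    (by rw [pullback.condition, Category.assoc])

theorem orb_str (U : X.carrier.Opens) :
    orb α U ≫ X.str = pullback.snd G.str (U.ι ≫ X.str) ≫ U.ι ≫ X.str := by
  rw [orb, α.act_str, Category.assoc]

theorem exists_bar [LocallyOfFiniteType X.str] [QuasiCompact X.str] (x : X.carrier) :
    ∃ xb : Spec (CommRingCat.of (AlgebraicClosure k)) ⟶ X.carrier, xb ≫ X.str = Irr.cl k ∧
      ∀ p : Spec (CommRingCat.of (AlgebraicClosure k)), x ⤳ xb p := by
  obtain ⟨p'⟩ : Nonempty (Spk (AlgebraicClosure k)) :=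
    inferInstanceAs (Nonempty (PrimeSpectrum (AlgebraicClosure k)))
  obtain ⟨y, hy, -⟩ := Scheme.Pullback.exists_preimage_pullback (f := X.str) (g := Irr.cl k) x p'
    (Subsingleton.elim _ _)
  haveI : CompactSpace (pullback X.str (Irr.cl k) : Scheme.{u}) :=
    QuasiCompact.compactSpace_of_compactSpace (pullback.snd X.str (Irr.cl k))
  obtain ⟨y', hy', hyc⟩ := IsClosed.exists_closed_singleton
    (S := closure {y}) isClosed_closure ⟨y, subset_closure rfl⟩
  refine ⟨pointOfClosedPoint (pullback.snd X.str (Irr.cl k)) y' hyc ≫ pullback.fst _ _, ?_, ?_⟩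
  · rw [Category.assoc, pullback.condition, pointOfClosedPoint_comp_assoc]
  · intro p
    rw [Scheme.Hom.comp_apply, pointOfClosedPoint_apply, ← hy]
    exact (specializes_iff_mem_closure.mpr hy').map (pullback.fst X.str (Irr.cl k)).continuous

theorem exists_z (hG : G.IsAlgebraic) [LocallyOfFiniteType X.str]
    (xb : Spec (CommRingCat.of (AlgebraicClosure k)) ⟶ X.carrier) (hxb : xb ≫ X.str = Irr.cl k)
    (hs : ∀ x, ∃ p, orb α c.U p = x) (hc) :
    ∃ z : Irr.Gb G, α.act (pullback.fst G.str (Irr.cl k))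
      (pullback.snd G.str (Irr.cl k) ≫ xb) hc z ∈ c.U := by
  haveI : LocallyOfFiniteType G.str := hG.1
  obtain ⟨p'⟩ : Nonempty (Spk (AlgebraicClosure k)) :=
    inferInstanceAs (Nonempty (PrimeSpectrum (AlgebraicClosure k)))
  obtain ⟨p, hp⟩ := hs (xb p')
  obtain ⟨y, -, -⟩ := Scheme.Pullback.exists_preimage_pullback (f := orb α c.U) (g := xb) p p' hp
  haveI : LocallyOfFiniteType (orb α c.U ≫ X.str) := by rw [orb_str]; infer_instance
  haveI : LocallyOfFiniteType (orb α c.U) := locallyOfFiniteType_of_comp _ X.str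
  haveI : JacobsonSpace (pullback (orb α c.U) xb : Scheme.{u}) :=
    LocallyOfFiniteType.jacobsonSpace (pullback.snd (orb α c.U) xb)
  obtain ⟨y', -, hy'⟩ := nonempty_inter_closedPoints (X := (pullback (orb α c.U) xb : Scheme.{u}))
    (Z := Set.univ) ⟨y, trivial⟩ isClosed_univ.isLocallyClosed
  replace hy' : IsClosed {y'} := hy'
  obtain ⟨π, hπ⟩ : ∃ π : Spec (CommRingCat.of (AlgebraicClosure k)) ⟶ pullback (orb α c.U) xb,
      π ≫ pullback.snd _ _ = 𝟙 _ := ⟨_, pointOfClosedPoint_comp (pullback.snd (orb α c.U) xb) y' hy'⟩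
  have e1 : (π ≫ pullback.fst _ _) ≫ orb α c.U = xb := by
    rw [Category.assoc, pullback.condition, reassoc_of% hπ]
  obtain ⟨r, hr⟩ : ∃ r, r = π ≫ pullback.fst _ _ := ⟨_, rfl⟩
  rw [← hr] at e1
  obtain ⟨g, hg⟩ : ∃ g, g = r ≫ pullback.fst G.str (c.U.ι ≫ X.str) := ⟨_, rfl⟩
  obtain ⟨v, hv⟩ : ∃ v, v = r ≫ pullback.snd G.str (c.U.ι ≫ X.str) := ⟨_, rfl⟩
  have hgv : g ≫ G.str = (v ≫ c.U.ι) ≫ X.str := by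
    rw [hg, hv, Category.assoc, pullback.condition]; simp only [Category.assoc]
  have e2 : α.act g (v ≫ c.U.ι) hgv = xb := by
    rw [← e1, orb]
    refine (α.act_congr hg ?_ _ ?_).trans (α.act_natural r _ _ _ _).symm
    · rw [hv, Category.assoc]
    · rw [Category.assoc, pullback.condition]; simp only [Category.assoc]
  have hgs : g ≫ G.str = Irr.cl k := by
    rw [← hxb, ← e2, α.act_str, hgv]
  have h1 : G.inv g ≫ G.str = xb ≫ X.str := by rw [G.inv_str, hgs, hxb]
  have e3 : α.act (G.inv g) xb h1 = v ≫ c.U.ι := by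
    have hA : G.inv g ≫ G.str = g ≫ G.str := G.inv_str g
    refine (α.act_congr rfl e2.symm _ (by rw [e2, h1])).trans ((α.mul_act (G.inv g) g (v ≫ c.U.ι) hA
      (by rw [G.mul_str, hA, hgv]) hgv _).symm.trans ?_)
    refine (α.act_congr (G.inv_mul g _) rfl _ ?_).trans ((α.act_congr ?_ rfl _ ?_).trans
      (α.one_act (v ≫ c.U.ι) ?_))
    · rw [Category.assoc, Category.assoc, G.one_str, Category.comp_id, hgv]
    · rw [← Category.assoc g, hgv]; simp only [Category.assoc]
    · simp only [Category.assoc, G.one_str, Category.comp_id]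
    · simp only [Category.assoc, G.one_str, Category.comp_id]
  have hl : G.inv g ≫ G.str = 𝟙 _ ≫ Irr.cl k := by rw [Category.id_comp, G.inv_str, hgs]
  refine ⟨pullback.lift (G.inv g) (𝟙 _) hl p', ?_⟩
  rw [← Scheme.Hom.comp_apply]
  have e4 : pullback.lift (G.inv g) (𝟙 _) hl ≫ α.act (pullback.fst G.str (Irr.cl k))
      (pullback.snd G.str (Irr.cl k) ≫ xb) hc = v ≫ c.U.ι := by
    refine (α.act_natural _ _ _ _ ?_).trans ((α.act_congr ?_ ?_ _ _).trans e3)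
    · rw [Category.assoc, hc]; simp only [Category.assoc]
    · rw [pullback.lift_fst]
    · rw [pullback.lift_snd_assoc, Category.id_comp]
  refine mem_of_eq e4 ?_
  rw [Scheme.Hom.comp_apply]
  exact (v p').2

theorem gen_of_surj [ConnectedSpace G.carrier] (hG : G.IsAlgebraic)
    [LocallyOfFiniteType X.str] [QuasiCompact X.str]
    (hs : ∀ x, ∃ p, orb α c.U p = x) : c.Gen := by
  intro x q hq
  obtain ⟨xb, hxb, hsp⟩ := exists_bar x
  have hc : pullback.fst G.str (Irr.cl k) ≫ G.str =
      (pullback.snd G.str (Irr.cl k) ≫ xb) ≫ X.str := by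
    rw [pullback.condition, Category.assoc, hxb]
  obtain ⟨z, hz⟩ := c.exists_z hG xb hxb hs hc
  have h1 := c.bot_mem hG xb hxb hc z hz ⊥ rfl
  have h2 := (c.mem_WO_iff _ _ (Scheme.Spec_stalkClosedPointTo_fromSpecStalk xb) _).1 h1
  rw [c.mem_WO_iff _ _ (Scheme.SpecMap_stalkSpecializes_fromSpecStalk (hsp _))]
  refine c.WO_gen _ _ _ ?_ h2
  intro F hF
  rw [PrimeSpectrum.comap_asIdeal, Ideal.mem_comap, hq, MvPolynomial.mem_map_C_iff] at hF
  rw [PrimeSpectrum.comap_asIdeal, Ideal.mem_comap]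
  change _ ∈ (⊥ : Ideal _)
  rw [Ideal.mem_bot]
  ext m
  rw [MvPolynomial.coeff_map, MvPolynomial.coeff_zero]
  by_contra hne
  have hu : IsUnit ((Scheme.stalkClosedPointTo xb).hom (F.coeff m)) := IsUnit.mk0 _ hne
  have hu' : IsUnit (F.coeff m) := isUnit_of_map_unit _ _ hu
  have h3 := hF m
  rw [MvPolynomial.coeff_map] at h3
  exact (IsLocalRing.mem_maximalIdeal _).1 h3 (hu'.map _)

end Chart
end

noncomputable section
namespace Alg
open Polynomial

/-- substitution of polynomials -/
def subst {k B : Type*} [CommRing k] [CommRing B] {n : ℕ} (φ : k →+* B) (τ : Fin n → k[X]) :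
    MvPolynomial (Fin n) B →+* B[X] := MvPolynomial.eval₂Hom Polynomial.C (fun i => (τ i).map φ)

theorem subst_map {k B B' : Type*} [CommRing k] [CommRing B] [CommRing B'] {n : ℕ} (φ : k →+* B)
    (ψ : B →+* B') (τ : Fin n → k[X]) (F : MvPolynomial (Fin n) B) :
    (subst φ τ F).map ψ = subst (ψ.comp φ) τ (MvPolynomial.map ψ F) := by
  have : (Polynomial.mapRingHom ψ).comp (subst φ τ) =
      (subst (ψ.comp φ) τ).comp (MvPolynomial.map ψ) := by
    ext x <;> simp [subst, Polynomial.map_map]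
  exact congr($this F)

theorem subst_C_mul {k B : Type*} [CommRing k] [CommRing B] {n : ℕ} (φ : k →+* B) (τ : Fin n → k[X])
    (b : B) (F : MvPolynomial (Fin n) B) :
    subst φ τ (MvPolynomial.C b * F) = Polynomial.C b * subst φ τ F := by
  simp [subst]

theorem subst_eval {k B F : Type*} [CommRing k] [CommRing B] [CommRing F] {n : ℕ} (φ : k →+* B)
    (ψ : B →+* F) (τ : Fin n → k[X]) (Q : MvPolynomial (Fin n) B) (θ : F) :
    ((subst φ τ Q).map ψ).eval θ =
      MvPolynomial.eval₂ ψ (fun i => (τ i).eval₂ (ψ.comp φ) θ) Q := by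
  have : ((Polynomial.evalRingHom θ).comp ((Polynomial.mapRingHom ψ).comp (subst φ τ))) =
      MvPolynomial.eval₂Hom ψ (fun i => (τ i).eval₂ (ψ.comp φ) θ) := by
    ext x
    · simp [subst]
    · simp [subst, Polynomial.map_map, Polynomial.eval_map]
  exact congr($this Q)

/-- norm form -/
def nf {k B : Type*} [CommRing k] [CommRing B] {n m : ℕ} (φ : k →+* B) (τ : Fin n → k[X])
    (M : Matrix (Fin m) (Fin m) k) (F : MvPolynomial (Fin n) B) : B :=
  (aeval (M.map φ) (subst φ τ F)).det

theorem aeval_map_mat {B B' : Type*} [CommRing B] [CommRing B'] {m : ℕ} (ψ : B →+* B')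
    (M : Matrix (Fin m) (Fin m) B) (g : B[X]) :
    (aeval M g).map ψ = aeval (M.map ψ) (g.map ψ) := by
  have : (ψ.mapMatrix).comp (aeval M : B[X] →ₐ[B] _).toRingHom =
      (aeval (M.map ψ) : B'[X] →ₐ[B'] _).toRingHom.comp (Polynomial.mapRingHom ψ) := by
    apply Polynomial.ringHom_ext
    · intro a
      ext i j
      simp [Matrix.algebraMap_matrix_apply, apply_ite ψ]
    · simp
  exact congr($this g)

theorem nf_map {k B B' : Type*} [CommRing k] [CommRing B] [CommRing B'] {n m : ℕ} (φ : k →+* B)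
    (ψ : B →+* B') (τ : Fin n → k[X]) (M : Matrix (Fin m) (Fin m) k) (F : MvPolynomial (Fin n) B) :
    ψ (nf φ τ M F) = nf (ψ.comp φ) τ M (MvPolynomial.map ψ F) := by
  rw [nf, nf, RingHom.map_det, RingHom.mapMatrix_apply, aeval_map_mat, subst_map, Matrix.map_map]
  rfl

theorem nf_C_mul {k B : Type*} [CommRing k] [CommRing B] {n m : ℕ} (φ : k →+* B)
    (τ : Fin n → k[X]) (M : Matrix (Fin m) (Fin m) k) (b : B) (F : MvPolynomial (Fin n) B) :
    nf φ τ M (MvPolynomial.C b * F) = b ^ m * nf φ τ M F := by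
  rw [nf, nf, subst_C_mul, map_mul, aeval_C, Algebra.algebraMap_eq_smul_one, smul_mul_assoc,
    one_mul, Matrix.det_smul, Fintype.card_fin]

theorem nf_ne_zero {k F : Type*} [CommRing k] [Field F] {n m : ℕ} (φ : k →+* F)
    (τ : Fin n → k[X]) (M : Matrix (Fin m) (Fin m) k) (Q : MvPolynomial (Fin n) F)
    (h : IsCoprime (M.charpoly.map φ) (subst φ τ Q)) : nf φ τ M Q ≠ 0 := by
  obtain ⟨u, v, e⟩ := h
  have h1 : aeval (M.map φ) (M.charpoly.map φ) = 0 := by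
    rw [← Matrix.charpoly_map]; exact Matrix.aeval_self_charpoly _
  have := congrArg (aeval (M.map φ)) e
  rw [map_add, map_mul, map_mul, h1, mul_zero, zero_add, map_one] at this
  have h2 := congrArg Matrix.det this
  rw [Matrix.det_mul, Matrix.det_one] at h2
  exact right_ne_zero_of_mul (by rw [nf] at *; rw [h2]; exact one_ne_zero)

theorem eval_ne_of_nf {k F : Type*} [CommRing k] [Field F] {n m : ℕ} (φ : k →+* F)
    (τ : Fin n → k[X]) (M : Matrix (Fin m) (Fin m) k) (Q : MvPolynomial (Fin n) F)
    (θ : F) (hθ : M.charpoly.eval₂ φ θ = 0) (h : nf φ τ M Q ≠ 0) : (subst φ τ Q).eval θ ≠ 0 := by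
  intro h0
  rw [← Polynomial.eval_map, ← Matrix.charpoly_map, Matrix.eval_charpoly] at hθ
  obtain ⟨v, hv, e⟩ := Matrix.exists_mulVec_eq_zero_iff.mpr hθ
  apply h
  refine Matrix.exists_mulVec_eq_zero_iff.mp ⟨v, hv, ?_⟩
  obtain ⟨g, hg⟩ := Polynomial.dvd_iff_isRoot.mpr h0
  rw [hg, mul_comm, map_mul, ← Matrix.mulVec_mulVec]
  have : (aeval (M.map φ) (X - C θ)).mulVec v = 0 := by
    rw [map_sub, aeval_X, aeval_C]
    have e2 : (M.map φ - algebraMap F (Matrix (Fin m) (Fin m) F) θ) =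
      -(Matrix.scalar (Fin m) θ - M.map φ) := by
      rw [neg_sub]; rfl
    rw [e2, Matrix.neg_mulVec, e, neg_zero]
  rw [this, Matrix.mulVec_zero]

theorem exists_coprime {k κ : Type*} [Field k] [Field κ] (φ : k →+* κ) (g : κ[X]) (hg : g ≠ 0) :
    ∃ q : k[X], q.Monic ∧ 0 < q.natDegree ∧ IsCoprime (q.map φ) g := by
  classical
  have hd : ∀ π : κ[X], ∃ d : k[X], d ≠ 0 ∧ ((∃ e : k[X], e ≠ 0 ∧ π ∣ e.map φ) → π ∣ d.map φ) := by
    intro π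
    by_cases h : ∃ e : k[X], e ≠ 0 ∧ π ∣ e.map φ
    · obtain ⟨e, h1, h2⟩ := h
      exact ⟨e, h1, fun _ => h2⟩
    · exact ⟨1, one_ne_zero, fun h' => (h h').elim⟩
  choose d hd0 hd1 using hd
  let S := (UniqueFactorizationMonoid.normalizedFactors g).toFinset
  let D := ∏ π ∈ S, d π
  have hD : D ≠ 0 := Finset.prod_ne_zero_iff.mpr fun π _ => hd0 π
  let q0 := X * D + 1
  have hdeg : 0 < q0.natDegree := by
    have : q0.natDegree = (X * D).natDegree := natDegree_add_C (a := 1)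
    rw [this, natDegree_X_mul hD]; omega
  have hq0 : q0 ≠ 0 := by rintro h; rw [h] at hdeg; simp at hdeg
  have hcop : IsCoprime (q0.map φ) g := by
    refine isCoprime_of_irreducible_dvd (fun h => hg h.2) ?_
    intro π hπ h1 h2
    obtain ⟨π', h3, h4⟩ := UniqueFactorizationMonoid.exists_mem_normalizedFactors_of_dvd hg hπ h2
    have h5 : π' ∣ q0.map φ := h4.symm.dvd.trans h1
    have h6 := hd1 π' ⟨q0, hq0, h5⟩
    have h7 : π' ∣ (X * D).map φ := by
      rw [Polynomial.map_mul]
      refine Dvd.dvd.mul_left (h6.trans ?_) _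
      exact map_dvd (Polynomial.mapRingHom φ) (Finset.dvd_prod_of_mem d (Multiset.mem_toFinset.mpr h3))
    have h8 : π' ∣ 1 := by
      have := dvd_sub h5 h7
      rwa [← Polynomial.map_sub, add_sub_cancel_left, Polynomial.map_one] at this
    exact hπ.not_isUnit (h4.isUnit_iff.mpr (isUnit_of_dvd_one h8))
  refine ⟨q0 * C q0.leadingCoeff⁻¹, monic_mul_leadingCoeff_inv hq0, ?_, ?_⟩
  · rwa [natDegree_mul_leadingCoeff_inv _ hq0]
  · rw [Polynomial.map_mul]
    refine IsCoprime.mul_left hcop ?_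
    have hu : IsUnit ((C q0.leadingCoeff⁻¹).map φ) := by
      rw [Polynomial.map_C, Polynomial.isUnit_C]
      exact (IsUnit.mk0 _ (inv_ne_zero (leadingCoeff_ne_zero.mpr hq0))).map φ
    obtain ⟨v, hv⟩ := hu.exists_left_inv
    exact ⟨v, 0, by rw [hv, zero_mul, add_zero]⟩

theorem exists_subst {k κ : Type*} [Field k] [Field κ] {n : ℕ} (φ : k →+* κ)
    (Q : MvPolynomial (Fin n) κ) (hQ : Q ≠ 0) : ∃ τ : Fin n → k[X], subst φ τ Q ≠ 0 := by
  by_contra! hcon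
  apply hQ
  apply MvPolynomial.map_injective (C : κ →+* κ[X]) C_injective
  rw [map_zero]
  refine MvPolynomial.funext_set (fun _ => Set.range fun i : ℕ => (X ^ i : κ[X]))
    (fun _ => Set.infinite_range_of_injective ?_) ?_
  · intro a b h
    have := congrArg natDegree h
    simpa using this
  · intro x hx
    choose w hw using fun i => hx i trivial
    have := hcon (fun i => X ^ (w i))
    rw [map_zero, MvPolynomial.eval_map, ← this]
    simp only [subst, Polynomial.map_pow, Polynomial.map_X]
    have e : x = fun i => X ^ w i := funext fun i => (hw i).symm
    rw [e]; rfl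

theorem exists_mat {k : Type u} [Field k] (q : k[X]) (hq : q.Monic) (h0 : 0 < q.natDegree) :
    ∃ (m : ℕ) (M : Matrix (Fin m) (Fin m) k), 0 < m ∧ M.charpoly = q := by
  let b := AdjoinRoot.powerBasis' hq
  refine ⟨b.dim, Algebra.leftMulMatrix b.basis b.gen, h0, ?_⟩
  rw [charpoly_leftMulMatrix]
  exact AdjoinRoot.minpoly_powerBasis_gen_of_monic hq

end Alg
end

noncomputable section
namespace Rat
variable {Z : Scheme.{u}} [IsIntegral Z] {I : Type*} (p : I → Z.functionField)

theorem Good.swap {i j : I} {x : Z} (hi : Good p i x) (hj : Good p j x) (m : ℕ)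
    (h : Z.functionField) (hx : p i ^ m / h ∈ loc Z x) : p j ^ m / h ∈ loc Z x := by
  have := mul_mem (pow_mem (hi.2 j) m) hx
  have e : (p j / p i) ^ m * (p i ^ m / h) = p j ^ m / h := by
    have := hi.1
    rcases eq_or_ne h 0 with rfl | h0
    · simp
    · rw [← mul_div_assoc, ← mul_pow, div_mul_cancel₀ _ this]
  rwa [e] at this

theorem isOpen_good [Finite I] (i : I) : IsOpen {x : Z | Good p i x} := by
  by_cases h0 : p i = 0
  · convert isOpen_empty
    ext x; simp [Good, h0]
  have : {x : Z | Good p i x} = ⋂ j, {x | p j / p i ∈ loc Z x} := by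
    ext x; simp [Good, h0]
  rw [this]
  refine isOpen_iInter_of_finite fun j => ?_
  rw [isOpen_iff_forall_mem_open]
  intro x hx
  obtain ⟨V, hxV, s, hs⟩ := exists_nhd hx
  exact ⟨V, fun y hy => hs.mem_loc hy, V.2, hxV⟩

theorem isOpen_locus [Finite I] (m : ℕ) (h : Z.functionField) :
    IsOpen {x : Z | ∃ i, Good p i x ∧ h ≠ 0 ∧ p i ^ m / h ∈ loc Z x} := by
  rw [isOpen_iff_forall_mem_open]
  rintro x ⟨i, hi, h0, hx⟩
  obtain ⟨V, hxV, s, hs⟩ := exists_nhd hx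
  exact ⟨V ∩ {x : Z | Good p i x}, fun y hy => ⟨i, hy.2, h0, hs.mem_loc hy.1⟩,
    V.2.inter (isOpen_good p i), hxV, hi⟩

end Rat

namespace Chart
variable {k : Type u} [Field k] {G : GroupSchemeOver k} {X : SchemeOver k}
    {α : ActionOver G X} (c : Chart α)

theorem sc_gen [IsIntegral X.carrier] (x : X.carrier) :
    (algebraMap (X.carrier.presheaf.stalk x) X.carrier.functionField).comp
      (sc (X := X) (X.carrier.fromSpecStalk x)) =
      sc (X := X) (X.carrier.fromSpecStalk (genericPoint X.carrier)) := by
  rw [← Scheme.SpecMap_stalkSpecializes_fromSpecStalk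
    ((genericPoint_spec X.carrier).specializes (Set.mem_univ x)), sc_comp]
  rfl

theorem exists_Q [IsIntegral X.carrier] {n : ℕ} (P : MvPolynomial (Fin n) X.carrier.functionField)
    (x : X.carrier) (a) (ha : ∀ b, P.coeff b / P.coeff a ∈ Rat.loc X.carrier x) :
    ∃ Q : MvPolynomial (Fin n) (X.carrier.presheaf.stalk x),
      MvPolynomial.map (algebraMap _ X.carrier.functionField) Q =
        MvPolynomial.C (P.coeff a)⁻¹ * P := by
  have : MvPolynomial.C (P.coeff a)⁻¹ * P ∈ Set.range (MvPolynomial.map (σ := Fin n)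
      (algebraMap (X.carrier.presheaf.stalk x) X.carrier.functionField)) := by
    rw [MvPolynomial.mem_range_map_iff_coeffs_subset]
    intro b hb
    rw [SetLike.mem_coe, MvPolynomial.mem_coeffs_iff] at hb
    obtain ⟨d, -, rfl⟩ := hb
    rw [MvPolynomial.coeff_C_mul, inv_mul_eq_div]
    exact ha d
  exact this

theorem nf_Q [IsIntegral X.carrier] {n m : ℕ} (P : MvPolynomial (Fin n) X.carrier.functionField)
    (x : X.carrier) (a) (Q : MvPolynomial (Fin n) (X.carrier.presheaf.stalk x))
    (hQ : MvPolynomial.map (algebraMap _ X.carrier.functionField) Q =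
        MvPolynomial.C (P.coeff a)⁻¹ * P) (τ : Fin n → Polynomial k) (M : Matrix (Fin m) (Fin m) k) :
    algebraMap _ X.carrier.functionField
      (Alg.nf (sc (X := X) (X.carrier.fromSpecStalk x)) τ M Q) =
    Alg.nf (B := X.carrier.functionField)
      (sc (X := X) (X.carrier.fromSpecStalk (genericPoint X.carrier))) τ M P / P.coeff a ^ m := by
  rw [Alg.nf_map, hQ, sc_gen]
  rw [Alg.nf_C_mul, inv_pow, inv_mul_eq_div]

theorem isUnit_iff [IsIntegral X.carrier] (x : X.carrier) (u : X.carrier.presheaf.stalk x)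
    (h q : X.carrier.functionField) (hq : q ≠ 0)
    (e : algebraMap _ X.carrier.functionField u = h / q) :
    IsUnit u ↔ h ≠ 0 ∧ q / h ∈ Rat.loc X.carrier x := by
  constructor
  · rintro ⟨u, rfl⟩
    have h0 : h / q ≠ 0 := by
      rw [← e]; exact ((u.isUnit).map (algebraMap _ X.carrier.functionField)).ne_zero
    refine ⟨fun h => h0 (by simp [h]), ⟨(↑u⁻¹ : X.carrier.presheaf.stalk x), ?_⟩⟩
    rw [← inv_div, ← e]
    exact eq_inv_of_mul_eq_one_left (by rw [← map_mul]; simp)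
  · rintro ⟨h0, v, hv⟩
    refine IsUnit.of_mul_eq_one v (Rat.inj x ?_)
    rw [map_mul, e, hv, map_one]
    field_simp

theorem exists_M [IsIntegral X.carrier] {n : ℕ} (P : MvPolynomial (Fin n) X.carrier.functionField)
    (x : X.carrier) (a) (h0 : P.coeff a ≠ 0) (Q : MvPolynomial (Fin n) (X.carrier.presheaf.stalk x))
    (hQ : MvPolynomial.map (algebraMap _ X.carrier.functionField) Q =
        MvPolynomial.C (P.coeff a)⁻¹ * P) :
    ∃ (τ : Fin n → Polynomial k) (m : ℕ) (M : Matrix (Fin m) (Fin m) k), 0 < m ∧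
      IsUnit (Alg.nf (sc (X := X) (X.carrier.fromSpecStalk x)) τ M Q) := by
  obtain ⟨φ, hφ⟩ : ∃ φ, φ = (IsLocalRing.residue (X.carrier.presheaf.stalk x)).comp
    (sc (X := X) (X.carrier.fromSpecStalk x)) := ⟨_, rfl⟩
  have ha : Q.coeff a = 1 := by
    apply Rat.inj x
    rw [← MvPolynomial.coeff_map, hQ, MvPolynomial.coeff_C_mul, inv_mul_cancel₀ h0, map_one]
  have hQ0 : MvPolynomial.map (IsLocalRing.residue (X.carrier.presheaf.stalk x)) Q ≠ 0 := by
    intro e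
    have := congr_arg (MvPolynomial.coeff a) e
    rw [MvPolynomial.coeff_map, ha, map_one] at this
    simp at this
  obtain ⟨τ, hτ⟩ := Alg.exists_subst φ _ hQ0
  obtain ⟨q, hq, hd, hc⟩ := Alg.exists_coprime φ _ hτ
  obtain ⟨m, M, hm, rfl⟩ := Alg.exists_mat q hq hd
  refine ⟨τ, m, M, hm, ?_⟩
  have := Alg.nf_ne_zero φ τ M _ hc
  rw [hφ, ← Alg.nf_map] at this
  rwa [← IsLocalRing.residue_ne_zero_iff_isUnit]

end Chart
end

noncomputable section
namespace Chart
variable {k : Type u} [Field k] {G : GroupSchemeOver k} {X : SchemeOver k}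
    {α : ActionOver G X} {c : Chart α}

theorem coeff_of_map [IsIntegral X.carrier] {n : ℕ}
    {P : MvPolynomial (Fin n) X.carrier.functionField}
    {y : X.carrier} {a} {Q : MvPolynomial (Fin n) (X.carrier.presheaf.stalk y)}
    (hQ : MvPolynomial.map (algebraMap _ X.carrier.functionField) Q =
        MvPolynomial.C (P.coeff a)⁻¹ * P) (b) :
    algebraMap _ X.carrier.functionField (Q.coeff b) = P.coeff b / P.coeff a := by
  rw [← MvPolynomial.coeff_map, hQ, MvPolynomial.coeff_C_mul, inv_mul_eq_div]

/-- substitution -/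
def vm {n : ℕ} {L : Type*} [CommRing L] (e : k →+* L) (τ : Fin n → Polynomial k) (r : L) :
    MvPolynomial (Fin n) k →+* L :=
  MvPolynomial.eval₂Hom e (fun i => (τ i).eval₂ e r)

theorem mem_W_field [IsIntegral X.carrier] [IsLocallyNoetherian X.carrier] [IsSeparated X.str]
    (hn : IsNormalScheme X.carrier) (hg : c.Gen)
    {P : MvPolynomial (Fin c.n) X.carrier.functionField} (hP : c.IsEq P)
    {F : CommRingCat.{u}} (hF : IsField F) (y : X.carrier) (ψ : X.carrier.presheaf.stalk y ⟶ F)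
    (a) (ha : P.coeff a ≠ 0)
    (Q : MvPolynomial (Fin c.n) (X.carrier.presheaf.stalk y))
    (hQ : MvPolynomial.map (algebraMap _ X.carrier.functionField) Q =
        MvPolynomial.C (P.coeff a)⁻¹ * P) (τ : Fin c.n → Polynomial k) {m : ℕ}
    (M : Matrix (Fin m) (Fin m) k)
    (hu : IsUnit (Alg.nf (sc (X := X) (X.carrier.fromSpecStalk y)) τ M Q))
    (ξ : Spec F ⟶ X.carrier) (hξ : Spec.map ψ ≫ X.carrier.fromSpecStalk y = ξ)
    (r : F) (hr : M.charpoly.eval₂ (sc ξ) r = 0) (v : Spec F ⟶ c.S)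
    (hv : v = Spec.map (CommRingCat.ofHom (vm (sc ξ) τ r)))
    (h : v ≫ c.ρ = ξ ≫ X.str) (p : Spec F) : p ∈ c.W v ξ h := by
  letI : Field F := hF.toField
  have hsc : sc ξ = ψ.hom.comp (sc (X := X) (X.carrier.fromSpecStalk y)) := by
    rw [← hξ, sc_comp]
  have h1 : Spec.map (CommRingCat.ofHom (MvPolynomial.eval₂Hom ψ.hom
      (fun i => (τ i).eval₂ (sc ξ) r))) ≫ c.tm (X.carrier.fromSpecStalk y) = v := by
    rw [hv, tm, ← Spec.map_comp, ← CommRingCat.ofHom_comp]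
    congr 2
    ext x
    · simp [vm, hsc]
    · simp [vm]
  have h2 : Spec.map (CommRingCat.ofHom (MvPolynomial.eval₂Hom ψ.hom
      (fun i => (τ i).eval₂ (sc ξ) r))) ≫ c.xm (X.carrier.fromSpecStalk y) = ξ := by
    rw [xm, ← Category.assoc, ← Spec.map_comp, ← CommRingCat.ofHom_comp, ← hξ]
    congr 2
    ext x
    simp
  rw [c.mem_W_iff (c.tm_compat _) _ h h1 h2]
  refine (hP.good2 hn hg y Q a ha (coeff_of_map hQ) _).2 ?_
  change ¬ (MvPolynomial.eval₂Hom ψ.hom (fun i => (τ i).eval₂ (sc ξ) r)) Q ∈ p.asIdeal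
  have hp : p.asIdeal = ⊥ := (Ideal.eq_bot_or_top p.asIdeal).resolve_right p.2.ne_top
  rw [hp, Ideal.mem_bot, MvPolynomial.coe_eval₂Hom, hsc, ← Alg.subst_eval]
  rw [hsc] at hr
  rw [Alg.subst_map]
  refine Alg.eval_ne_of_nf _ τ M _ r hr ?_
  rw [← Alg.nf_map]
  exact (hu.map ψ.hom).ne_zero

end Chart
end

noncomputable section
namespace Chart
variable {k : Type u} [Field k] {G : GroupSchemeOver k} {X : SchemeOver k}
    {α : ActionOver G X} {c : Chart α}

theorem vm_comp {n : ℕ} {L L' : Type*} [CommRing L] [CommRing L'] (e : k →+* L)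
    (τ : Fin n → Polynomial k) (r : L) (ψ : L →+* L') :
    ψ.comp (vm e τ r) = vm (ψ.comp e) τ (ψ r) := by
  ext x
  · simp [vm]
  · simp [vm, Polynomial.hom_eval₂]

theorem ι_surj (c : Chart α) : Surjective c.ι := by
  refine ⟨fun p => ?_⟩
  haveI : Algebra.IsIntegral (MvPolynomial (Fin c.n) k) c.A := inferInstance
  haveI : FaithfulSMul (MvPolynomial (Fin c.n) k) c.A :=
    (faithfulSMul_iff_algebraMap_injective _ _).2 c.inj
  exact Algebra.IsIntegral.comap_surjective (MvPolynomial (Fin c.n) k) c.A p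

theorem exists_pt (c : Chart α) (τ : Fin c.n → Polynomial k) {m : ℕ} (hm : 0 < m)
    (M : Matrix (Fin m) (Fin m) k) :
    ∃ (L : CommRingCat.{u}) (_ : IsField L) (e : k →+* L) (r : L)
      (g : Spec L ⟶ Spec (CommRingCat.of c.A)), M.charpoly.eval₂ e r = 0 ∧
      g ≫ c.ι = Spec.map (CommRingCat.ofHom (vm e τ r)) := by
  obtain ⟨r, hr⟩ := IsAlgClosed.exists_eval₂_eq_zero (algebraMap k (AlgebraicClosure k)) M.charpoly
    (by rw [Matrix.charpoly_degree_eq_dim]; simp; omega)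
  obtain ⟨v, hv⟩ : ∃ v : Spec (CommRingCat.of (AlgebraicClosure k)) ⟶ c.S,
    v = Spec.map (CommRingCat.ofHom (vm (algebraMap k (AlgebraicClosure k)) τ r)) := ⟨_, rfl⟩
  obtain ⟨p⟩ : Nonempty (Spec (CommRingCat.of (AlgebraicClosure k))) :=
    inferInstanceAs (Nonempty (PrimeSpectrum (AlgebraicClosure k)))
  obtain ⟨q, hq⟩ := c.ι_surj.surj (v p)
  obtain ⟨z, -, -⟩ := Scheme.Pullback.exists_preimage_pullback (f := v) (g := c.ι) p q hq.symm
  obtain ⟨w, hw⟩ : ∃ w, w = (pullback v c.ι).fromSpecResidueField z := ⟨_, rfl⟩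
  obtain ⟨ψ, hψ⟩ : ∃ ψ, Spec.map ψ = w ≫ pullback.fst v c.ι := ⟨_, Spec.map_preimage _⟩
  refine ⟨(pullback v c.ι).residueField z, Field.toIsField _, ψ.hom.comp
    (algebraMap k (AlgebraicClosure k)), ψ.hom r, w ≫ pullback.snd v c.ι, ?_, ?_⟩
  · rw [← Polynomial.hom_eval₂, hr, map_zero]
  · rw [Category.assoc, ← pullback.condition, ← Category.assoc, ← hψ, ← vm_comp]
    refine (congrArg (Spec.map ψ ≫ ·) hv).trans ?_
    exact (Spec.map_comp _ _).symm

/-- the unit locus of the equation -/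
def UL [IsIntegral X.carrier] {n : ℕ} (P : MvPolynomial (Fin n) X.carrier.functionField)
    (τ : Fin n → Polynomial k) {m : ℕ} (M : Matrix (Fin m) (Fin m) k) (y : X.carrier) : Prop :=
  ∃ a, P.coeff a ≠ 0 ∧ ∃ Q : MvPolynomial (Fin n) (X.carrier.presheaf.stalk y),
    MvPolynomial.map (algebraMap _ X.carrier.functionField) Q = MvPolynomial.C (P.coeff a)⁻¹ * P ∧
    IsUnit (Alg.nf (sc (X := X) (X.carrier.fromSpecStalk y)) τ M Q)

theorem act_mem [IsIntegral X.carrier] [IsLocallyNoetherian X.carrier] [IsSeparated X.str]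
    (hn : IsNormalScheme X.carrier) (hg : c.Gen)
    {P : MvPolynomial (Fin c.n) X.carrier.functionField} (hP : c.IsEq P)
    (τ : Fin c.n → Polynomial k) {m : ℕ} (M : Matrix (Fin m) (Fin m) k)
    {L : CommRingCat.{u}} (e : k →+* L) (r : L)
    (g : Spec L ⟶ Spec (CommRingCat.of c.A)) (hr : M.charpoly.eval₂ e r = 0)
    (hge : g ≫ c.ι = Spec.map (CommRingCat.ofHom (vm e τ r)))
    {T : Scheme.{u}} (ξ : T ⟶ X.carrier) (θ : T ⟶ Spec L)
    (hξ : ∀ t, UL P τ M (ξ t)) (hθ : θ ≫ Spec.map (CommRingCat.ofHom e) = ξ ≫ X.str)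
    (h : (θ ≫ g ≫ c.j) ≫ G.str = ξ ≫ X.str) (t : T) :
    α.act (θ ≫ g ≫ c.j) ξ h t ∈ c.U := by
  obtain ⟨p⟩ : Nonempty (Spec (T.residueField t)) :=
    inferInstanceAs (Nonempty (PrimeSpectrum (T.residueField t)))
  obtain ⟨w, hw⟩ : ∃ w, w = T.fromSpecResidueField t := ⟨_, rfl⟩
  obtain ⟨ψ, hψ⟩ : ∃ ψ, Spec.map ψ = w ≫ θ := ⟨_, Spec.map_preimage _⟩
  obtain ⟨ξ', hξ'⟩ : ∃ ξ' : Spec (T.residueField t) ⟶ X.carrier, ξ' = w ≫ ξ := ⟨_, rfl⟩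
  have hwp : w p = t := by rw [hw]; exact Scheme.fromSpecResidueField_apply _ _
  have hs : sc ξ' = ψ.hom.comp e := by
    have : Spec.preimage (ξ' ≫ X.str) = CommRingCat.ofHom e ≫ ψ := by
      apply Spec.map_injective
      rw [Spec.map_preimage, Spec.map_comp, hψ, hξ', Category.assoc, Category.assoc, hθ]
    rw [sc, this]; rfl
  obtain ⟨y, hy⟩ : ∃ y, y = ξ' (IsLocalRing.closedPoint (T.residueField t)) := ⟨_, rfl⟩
  have hyt : y = ξ t := by
    obtain ⟨p', hp'⟩ : ∃ p' : Spec (T.residueField t),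
      p' = IsLocalRing.closedPoint (T.residueField t) := ⟨_, rfl⟩
    rw [hy]
    refine (congrArg ξ' hp'.symm).trans ?_
    rw [hξ', Scheme.Hom.comp_apply, hw, Scheme.fromSpecResidueField_apply]
  have hU := hξ t
  rw [← hyt] at hU
  obtain ⟨a, ha, Q, hQ, hu⟩ := hU
  obtain ⟨χ, hχ⟩ : ∃ χ : X.carrier.presheaf.stalk y ⟶ T.residueField t,
      Spec.map χ ≫ X.carrier.fromSpecStalk y = ξ' := by
    subst hy
    exact ⟨_, Scheme.Spec_stalkClosedPointTo_fromSpecStalk ξ'⟩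
  have hv : w ≫ θ ≫ g ≫ c.ι = Spec.map (CommRingCat.ofHom (vm (sc ξ') τ (ψ.hom r))) := by
    rw [← Category.assoc, ← hψ, hge, ← Spec.map_comp, hs, ← vm_comp]
    rfl
  have h3 : (w ≫ θ ≫ g ≫ c.ι) ≫ c.ρ = ξ' ≫ X.str := by
    have := congr(w ≫ $h)
    simpa [hξ', c.j_str'] using this
  have := (mem_W_field hn hg hP (Field.toIsField _) y χ a ha Q hQ τ M hu ξ' hχ (ψ.hom r)
    (by rw [hs, ← Polynomial.hom_eval₂, hr, map_zero]) _ hv h3 p).2 _ (𝟙 _) (w ≫ θ ≫ g)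
    (by simp) p (by simp)
  rw [← hwp, ← Scheme.Hom.comp_apply, α.act_natural _ _ _ _ (by
      rw [Category.assoc, h]; simp only [Category.assoc])]
  refine mem_of_eq (α.act_congr (by simp) (by simp [hξ']) _ _) this

end Chart
end

noncomputable section
namespace Chart
variable {k : Type u} [Field k] {G : GroupSchemeOver k} {X : SchemeOver k}

/-- translation -/
def tr (α : ActionOver G X) {B : Scheme.{u}} (s : B ⟶ Spk k) (γ : B ⟶ G.carrier)
    (h : γ ≫ G.str = s) : pullback X.str s ⟶ pullback X.str s :=
  pullback.lift (α.act (pullback.snd _ _ ≫ γ) (pullback.fst X.str s)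
    (by rw [Category.assoc, h, pullback.condition])) (pullback.snd _ _)
    (by rw [α.act_str, pullback.condition])

theorem tr_inv (α : ActionOver G X) {B : Scheme.{u}} (s : B ⟶ Spk k) (γ : B ⟶ G.carrier)
    (h : γ ≫ G.str = s) (h' : G.inv γ ≫ G.str = s) :
    tr α s γ h ≫ tr α s (G.inv γ) h' = 𝟙 _ := by
  have e0 : (pullback.snd X.str s ≫ γ) ≫ G.str = pullback.fst X.str s ≫ X.str := by
    rw [Category.assoc, h, pullback.condition]
  have e1 : G.inv (pullback.snd X.str s ≫ γ) ≫ G.str = (pullback.snd X.str s ≫ γ) ≫ G.str :=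
    G.inv_str _
  apply pullback.hom_ext
  · rw [Category.assoc, tr, tr, pullback.lift_fst, Category.id_comp]
    rw [α.act_natural _ _ _ _ (by
      simp only [Category.assoc, pullback.lift_fst_assoc, pullback.lift_snd_assoc]
      rw [α.act_str, h', pullback.condition])]
    have h3 : G.mul (G.inv (pullback.snd X.str s ≫ γ)) (pullback.snd X.str s ≫ γ) e1 ≫ G.str =
        pullback.fst X.str s ≫ X.str := by rw [G.mul_str, e1, e0]
    have h4 : G.inv (pullback.snd X.str s ≫ γ) ≫ G.str =
        α.act (pullback.snd X.str s ≫ γ) (pullback.fst X.str s) e0 ≫ X.str := by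
      rw [α.act_str, e1, e0]
    have := α.mul_act (G.inv (pullback.snd X.str s ≫ γ)) (pullback.snd X.str s ≫ γ)
      (pullback.fst X.str s) e1 h3 e0 h4
    refine (α.act_congr ?_ ?_ _ h4).trans (this.symm.trans ?_)
    · rw [pullback.lift_snd_assoc, G.inv_natural]
    · rw [pullback.lift_fst]
    · have h5 : (pullback.fst X.str s ≫ X.str ≫ G.one) ≫ G.str = pullback.fst X.str s ≫ X.str := by
        simp only [Category.assoc, G.one_str, Category.comp_id]
      refine (α.act_congr ?_ rfl _ h5).trans (α.one_act _ _)
      rw [G.inv_mul, ← Category.assoc, e0, Category.assoc]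
  · rw [Category.assoc, tr, tr, pullback.lift_snd, pullback.lift_snd, Category.id_comp]

theorem isIso_tr (α : ActionOver G X) {B : Scheme.{u}} (s : B ⟶ Spk k) (γ : B ⟶ G.carrier)
    (h : γ ≫ G.str = s) : IsIso (tr α s γ h) := by
  have h' : G.inv γ ≫ G.str = s := by rw [G.inv_str, h]
  have h'' : G.inv (G.inv γ) ≫ G.str = s := by rw [G.inv_str, h']
  have e1 := tr_inv α s γ h h'
  have e2 := tr_inv α s _ h' h''
  have : IsIso (tr α s _ h') := ⟨_, e2, by
    have : tr α s γ h = tr α s _ h'' := by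
      rw [← Category.comp_id (tr α s γ h), ← e2, ← Category.assoc, e1, Category.id_comp]
    rw [← this, e1]⟩
  have : IsIso (tr α s γ h ≫ tr α s _ h') := by rw [e1]; infer_instance
  exact IsIso.of_isIso_comp_right (tr α s γ h) (tr α s _ h')

theorem exists_map (V : X.carrier.Opens) {B : Scheme.{u}} (s : B ⟶ Spk k) :
    ∃ i : pullback (V.ι ≫ X.str) s ⟶ pullback X.str s,
      i ≫ pullback.fst _ _ = pullback.fst _ _ ≫ V.ι ∧ i ≫ pullback.snd _ _ = pullback.snd _ _ ∧
      IsOpenImmersion i := by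
  refine ⟨pullback.map _ _ _ _ V.ι (𝟙 _) (𝟙 _) (by simp) (by simp), ?_, ?_, inferInstance⟩
  · rw [pullback.map, pullback.lift_fst]
  · rw [pullback.map, pullback.lift_snd, Category.comp_id]

theorem quasiAffine_L (α : ActionOver G X)
    (V U : X.carrier.Opens) [CompactSpace V] (hU : IsAffineOpen U)
    {L : CommRingCat.{u}} (s : Spec L ⟶ Spk k) (γ : Spec L ⟶ G.carrier)
    (h : γ ≫ G.str = s)
    (H : ∀ h t, α.act (pullback.snd (V.ι ≫ X.str) s ≫ γ)
      (pullback.fst (V.ι ≫ X.str) s ≫ V.ι) h t ∈ U) :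
    (pullback (V.ι ≫ X.str) s).IsQuasiAffine := by
  have h1 : (pullback.snd (V.ι ≫ X.str) s ≫ γ) ≫ G.str =
      (pullback.fst (V.ι ≫ X.str) s ≫ V.ι) ≫ X.str := by
    rw [Category.assoc, h, Category.assoc, pullback.condition]
  obtain ⟨a, ha⟩ : ∃ a, a = α.act (pullback.snd (V.ι ≫ X.str) s ≫ γ)
      (pullback.fst (V.ι ≫ X.str) s ≫ V.ι) h1 := ⟨_, rfl⟩
  have ha' : Set.range a ⊆ Set.range U.ι := by
    rw [Scheme.Opens.range_ι]
    rintro _ ⟨t, rfl⟩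
    rw [ha]
    exact H h1 t
  have hstr : IsOpenImmersion.lift U.ι a ha' ≫ U.ι ≫ X.str = pullback.snd _ _ ≫ s := by
    rw [IsOpenImmersion.lift_fac_assoc, ha, α.act_str, Category.assoc, pullback.condition]
  haveI := isIso_tr α s γ h
  obtain ⟨iV, hV1, hV2, hV3⟩ := exists_map V s
  obtain ⟨iU, hU1, hU2, hU3⟩ := exists_map U s
  obtain ⟨f, hf1, hf2⟩ : ∃ f : pullback (V.ι ≫ X.str) s ⟶ pullback (U.ι ≫ X.str) s,
    f ≫ pullback.fst _ _ = IsOpenImmersion.lift U.ι a ha' ∧ f ≫ pullback.snd _ _ =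
      pullback.snd _ _ := ⟨pullback.lift _ _ hstr, pullback.lift_fst _ _ _, pullback.lift_snd _ _ _⟩
  have e : f ≫ iU = iV ≫ tr α s γ h := by
    apply pullback.hom_ext
    · rw [Category.assoc, hU1, ← Category.assoc, hf1, IsOpenImmersion.lift_fac, Category.assoc, tr,
        pullback.lift_fst, ha, α.act_natural _ _ _ _ (by
          rw [← Category.assoc, hV2, hV1]; exact h1)]
      refine α.act_congr ?_ hV1.symm _ _
      rw [← Category.assoc, hV2]
    · rw [Category.assoc, hU2, hf2, Category.assoc, tr, pullback.lift_snd, hV2]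
  have : IsOpenImmersion (f ≫ iU) := by rw [e]; infer_instance
  have : IsOpenImmersion f := IsOpenImmersion.of_comp f iU
  haveI : IsAffine U.toScheme := hU
  haveI : QuasiCompact s := inferInstance
  haveI : CompactSpace (pullback (V.ι ≫ X.str) s : Scheme.{u}) := inferInstance
  exact Scheme.IsQuasiAffine.of_isImmersion f

theorem quasiAffine_descent {Y : Scheme.{u}} [CompactSpace Y] [QuasiSeparatedSpace Y]
    (y : Y ⟶ Spk k) {L : CommRingCat.{u}} (hL : IsField L) (s : Spec L ⟶ Spk k)
    (h : (pullback y s).IsQuasiAffine) : Y.IsQuasiAffine := by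
  haveI : Nontrivial L := hL.nontrivial
  haveI : Nonempty (Spec L) := inferInstanceAs (Nonempty (PrimeSpectrum L))
  have hs1 : Flat s := by
    obtain ⟨ψ, rfl⟩ := Spec.map_surjective s
    rw [Flat.SpecMap_iff]
    letI := ψ.hom.toAlgebra
    exact (inferInstanceAs (Module.Flat k L))
  have hs2 : Surjective s := by
    refine ⟨fun p => ?_⟩
    obtain ⟨q⟩ := ‹Nonempty (Spec L)›
    haveI : Subsingleton (Spk k) := inferInstanceAs (Subsingleton (PrimeSpectrum k))
    exact ⟨q, Subsingleton.elim _ _⟩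
  have hs : Spec.map s.appTop = inv (Spec L).toSpecΓ ≫ s ≫ (Spk k).toSpecΓ := by
    rw [IsIso.eq_inv_comp, Scheme.toSpecΓ_naturality]
  have hs3 : Flat (Spec.map s.appTop) := by rw [hs]; infer_instance
  have hs4 : Surjective (Spec.map s.appTop) := by rw [hs]; infer_instance
  have H := IsPullback.of_hasPullback y s
  have P1 := isIso_pushoutSection_of_isQuasiSeparated_of_flat_right H (US := ⊤) (UT := ⊤) (UX := ⊤)
    (UY := ⊤) le_top le_top (by simp) (isAffineOpen_top _) (isAffineOpen_top _)
    isCompact_univ isQuasiSeparated_univ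
  have P1' := (isIso_pushoutSection_iff ..).1 P1
  have P2 : IsPullback (Spec.map (pullback.fst y s).appTop) (Spec.map (pullback.snd y s).appTop)
      (Spec.map y.appTop) (Spec.map s.appTop) := by
    refine isPullback_SpecMap_of_isPushout _ _ _ _ ?_
    convert P1' using 1 <;> exact (Scheme.Hom.appLE_eq_app _).symm
  have P3 : IsPullback (pullback.fst y s) (pullback y s).toSpecΓ Y.toSpecΓ
      (Spec.map (pullback.fst y s).appTop) := by
    refine IsPullback.of_bot ?_ (Scheme.toSpecΓ_naturality _) P2
    rw [← Scheme.toSpecΓ_naturality, ← Scheme.toSpecΓ_naturality]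
    exact H.paste_vert (IsPullback.of_vert_isIso ⟨Scheme.toSpecΓ_naturality _⟩)
  have hb1 : Flat (Spec.map (pullback.fst y s).appTop) :=
    MorphismProperty.of_isPullback P2.flip hs3
  have hb2 : Surjective (Spec.map (pullback.fst y s).appTop) :=
    MorphismProperty.of_isPullback P2.flip hs4
  have : IsOpenImmersion Y.toSpecΓ :=
    MorphismProperty.of_isPullback_of_descendsAlong (P := @IsOpenImmersion)
      (Q := @Surjective ⊓ @Flat ⊓ @QuasiCompact) P3.flip ⟨⟨hb2, hb1⟩, inferInstance⟩ inferInstance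
  exact { }
end Chart
end

noncomputable section
namespace Rat
variable {Z : Scheme.{u}} [IsIntegral Z]

theorem exists_basic (V : Z.Opens) (hq : V.toScheme.IsQuasiAffine) (z : Z) (hz : z ∈ V) :
    ∃ b : Γ(Z, V), z ∈ Z.basicOpen b ∧ IsAffineOpen (Z.basicOpen b) := by
  obtain ⟨_, ⟨r, hr, rfl⟩, hzr, -⟩ := TopologicalSpace.Opens.isBasis_iff_nbhd.1
    (Scheme.IsQuasiAffine.isBasis_basicOpen V.toScheme) (U := ⊤) (x := ⟨z, hz⟩) trivial
  obtain ⟨b, rfl⟩ : ∃ b, r = V.topIso.inv b := ⟨V.topIso.hom r, by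
    rw [← CommRingCat.comp_apply, Iso.hom_inv_id]; rfl⟩
  refine ⟨b, ?_, ?_⟩
  · rw [← Scheme.Opens.ι_image_basicOpen_topIso_inv (U := V)]
    exact ⟨_, hzr, rfl⟩
  · rw [← Scheme.Opens.ι_image_basicOpen_topIso_inv (U := V)]
    exact hr.image_of_isOpenImmersion _

theorem extend [IsNoetherian Z] (V W : Z.Opens) (h β : Z.functionField) (h0 : h ≠ 0)
    (hW : ∀ x ∈ W, h ∈ loc Z x) (hV : ∀ x ∈ W, h⁻¹ ∈ loc Z x → β ∈ loc Z x) :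
    ∃ n : ℕ, ∀ x ∈ W, β * h ^ n ∈ loc Z x := by
  obtain ⟨s, hs⟩ := exists_val W h hW
  have hle : Z.basicOpen s ≤ W := Z.basicOpen_le s
  obtain ⟨t, ht⟩ := exists_val (Z.basicOpen s) β (fun x hx => hV x (hle hx)
    ((hs.mem_basicOpen (hle hx)).1 hx).2)
  obtain ⟨n, y, hy⟩ := exists_eq_pow_mul_of_isCompact_of_isQuasiSeparated Z W
    (TopologicalSpace.NoetherianSpace.isCompact _) 
    (fun U V _ _ _ _ _ _ => TopologicalSpace.NoetherianSpace.isCompact _) s t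
  refine ⟨n, fun x hx => ?_⟩
  have hv := val_self y hx
  obtain ⟨γ, hγ⟩ : ∃ γ, γ = algebraMap (Z.presheaf.stalk x) Z.functionField
    (Z.presheaf.germ W x hx y) := ⟨_, rfl⟩
  rw [← hγ] at hv
  have hgW : genericPoint Z ∈ W :=
    ((genericPoint_spec Z).specializes (Set.mem_univ x)).mem_open W.2 hx
  have hg : genericPoint Z ∈ Z.basicOpen s := by
    rw [hs.mem_basicOpen hgW]
    refine ⟨h0, h⁻¹, ?_⟩
    change (Z.presheaf.stalkSpecializes _).hom h⁻¹ = h⁻¹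
    rw [TopCat.Presheaf.stalkSpecializes_refl]
    rfl
  have h1 := hv.res hle
  have h2 := ((hs.res hle).pow n).mul ht
  have : γ = h ^ n * β := (h1 _ hg).symm.trans ((congrArg _ (congrArg _ hy)).trans (h2 _ hg))
  rw [mul_comm, ← this]
  exact hv.mem_loc hx

variable {I : Type*} (p : I → Z.functionField)

theorem H_of_quasiAffine [Finite I] [IsNoetherian Z] (hp : ∀ x : Z, ∃ i, Good p i x) (m : ℕ)
    (hm : 0 < m) (h : Z.functionField) (V : Z.Opens)
    (hall : ∀ x i, Good p i x → h / p i ^ m ∈ loc Z x)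
    (hV : ∀ x i, Good p i x → (x ∈ V ↔ h ≠ 0 ∧ p i ^ m / h ∈ loc Z x))
    (hq : V.toScheme.IsQuasiAffine) (z : Z) (hz : z ∈ V) :
    ∃ m : ℕ, 0 < m ∧ ∃ h : Z.functionField,
      (∀ x i, Good p i x → h / p i ^ m ∈ loc Z x) ∧
      ∃ U : Z.Opens, IsAffineOpen U ∧ z ∈ U ∧ ∀ x i, Good p i x →
        (x ∈ U ↔ h ≠ 0 ∧ p i ^ m / h ∈ loc Z x) := by
  obtain ⟨b, hzb, hb⟩ := exists_basic V hq z hz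
  obtain ⟨β, hβ⟩ : ∃ β, Val b β := ⟨_, val_self b hz⟩
  obtain ⟨i0, hi0⟩ := hp z
  have h0 : h ≠ 0 := ((hV z i0 hi0).1 hz).1
  have hn : ∀ i, ∃ n : ℕ, ∀ x, Good p i x → β * (h / p i ^ m) ^ n ∈ loc Z x := by
    intro i
    by_cases hpi : p i = 0
    · exact ⟨0, fun x hx => (hx.1 hpi).elim⟩
    exact extend V ⟨_, isOpen_good p i⟩ (h / p i ^ m) β (div_ne_zero h0 (pow_ne_zero _ hpi))
      (fun x hx => hall x i hx) (fun x hx h' => hβ.mem_loc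
        ((hV x i hx).2 ⟨h0, by rwa [inv_div] at h'⟩))
  choose n hn using hn
  obtain ⟨N, hN⟩ := (Set.finite_range n).bddAbove
  have hN' : ∀ x i, Good p i x → β * (h / p i ^ m) ^ N ∈ loc Z x := by
    intro x i hx
    have := mul_mem (hn i x hx) (pow_mem (hall x i hx) (N - n i))
    rwa [mul_assoc, ← pow_add, Nat.add_sub_cancel' (hN ⟨i, rfl⟩)] at this
  refine ⟨m * (N + 1), by positivity, β * h ^ (N + 1), ?_, Z.basicOpen b, hb, hzb, ?_⟩
  · intro x i hx
    have := mul_mem (hN' x i hx) (hall x i hx)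
    rwa [mul_assoc, ← pow_succ, div_pow, ← pow_mul, ← mul_div_assoc] at this
  · intro x i hx
    obtain ⟨q, hq⟩ : ∃ q, q = p i ^ m := ⟨_, rfl⟩
    have hq0 : q ≠ 0 := by rw [hq]; exact pow_ne_zero _ hx.1
    have h1 := hN' x i hx
    have h2 := hall x i hx
    have h3 := hV x i hx
    rw [← hq] at h1 h2 h3
    rw [pow_mul, ← hq]
    constructor
    · intro hxb
      have hxV : x ∈ V := Z.basicOpen_le b hxb
      obtain ⟨hb0, hb1⟩ := (hβ.mem_basicOpen hxV).1 hxb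
      refine ⟨mul_ne_zero hb0 (pow_ne_zero _ h0), ?_⟩
      have := mul_mem hb1 (pow_mem (h3.1 hxV).2 (N + 1))
      convert this using 1
      rw [div_pow]; field_simp
    · rintro ⟨hne, hmem⟩
      have hb0 : β ≠ 0 := left_ne_zero_of_mul hne
      have hxV : x ∈ V := h3.2 ⟨h0, by
        convert mul_mem hmem h1 using 1
        rw [div_pow, pow_succ, pow_succ]; field_simp⟩
      refine (hβ.mem_basicOpen hxV).2 ⟨hb0, ?_⟩
      convert mul_mem hmem (pow_mem h2 (N + 1)) using 1
      rw [div_pow]; field_simp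

end Rat
end

noncomputable section
namespace Chart
variable {k : Type u} [Field k] {G : GroupSchemeOver k} {X : SchemeOver k}
    {α : ActionOver G X} {c : Chart α}

theorem quasiAffine_UL [IsIntegral X.carrier] [IsNoetherian X.carrier] [IsSeparated X.str]
    (hn : IsNormalScheme X.carrier) (hg : c.Gen)
    {P : MvPolynomial (Fin c.n) X.carrier.functionField} (hP : c.IsEq P)
    (τ : Fin c.n → Polynomial k) {m : ℕ} (hm : 0 < m) (M : Matrix (Fin m) (Fin m) k)
    (V : X.carrier.Opens) (hV : ∀ y ∈ V, UL P τ M y) : V.toScheme.IsQuasiAffine := by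
  obtain ⟨L, hL, e, r, g, hr, hge⟩ := c.exists_pt τ hm M
  have hs : (g ≫ c.j) ≫ G.str = Spec.map (CommRingCat.ofHom e) := by
    rw [Category.assoc, c.j_str', ← Category.assoc, hge, ρ, ← Spec.map_comp,
      ← CommRingCat.ofHom_comp]
    congr 2
    ext x
    simp [vm]
  haveI : CompactSpace V := isCompact_iff_compactSpace.1
    (TopologicalSpace.NoetherianSpace.isCompact _)
  haveI : CompactSpace V.toScheme := this
  refine quasiAffine_descent (V.ι ≫ X.str) hL (Spec.map (CommRingCat.ofHom e)) ?_
  refine quasiAffine_L α V c.U c.aff _ (g ≫ c.j) hs fun h t => ?_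
  refine act_mem hn hg hP τ M e r g hr hge _ (pullback.snd _ _) (fun t => hV _ ?_) ?_ h t
  · rw [Scheme.Hom.comp_apply]
    exact Subtype.prop _
  · rw [Category.assoc, ← pullback.condition]

theorem exists_ample [IsIntegral X.carrier] [IsNoetherian X.carrier] [IsSeparated X.str]
    (hn : IsNormalScheme X.carrier) (hg : c.Gen) : ∃ L : LineBundle X.carrier, IsAmple L := by
  obtain ⟨P, hP⟩ := c.exists_P hg
  obtain ⟨p, hp⟩ : ∃ p : P.support → X.carrier.functionField, p = fun a => P.coeff a.1 := ⟨_, rfl⟩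
  have hgood : ∀ x i, Rat.Good p i x → P.coeff i.1 ≠ 0 ∧
      ∀ b, P.coeff b / P.coeff i.1 ∈ Rat.loc X.carrier x := by
    rintro x i ⟨h1, h2⟩
    subst hp
    refine ⟨h1, fun b => ?_⟩
    by_cases hb : b ∈ P.support
    · exact h2 ⟨b, hb⟩
    · rw [MvPolynomial.notMem_support_iff.1 hb, zero_div]
      exact zero_mem _
  have hcov : ∀ x, ∃ i, Rat.Good p i x := by
    intro x
    obtain ⟨a, h1, h2⟩ := hP.good1 hn hg x
    subst hp
    exact ⟨⟨a, MvPolynomial.mem_support_iff.2 h1⟩, h1, fun b => h2 _⟩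
  refine Rat.exists_ample p hcov fun z => ?_
  obtain ⟨i0, hi0⟩ := hcov z
  obtain ⟨Q, hQ⟩ := exists_Q P z i0.1 (hgood z i0 hi0).2
  obtain ⟨τ, m, M, hm, hu⟩ := exists_M P z i0.1 (hgood z i0 hi0).1 Q hQ
  obtain ⟨h, hh⟩ : ∃ h, h = Alg.nf (B := X.carrier.functionField)
      (sc (X := X) (X.carrier.fromSpecStalk (genericPoint X.carrier))) τ M P := ⟨_, rfl⟩
  have hpi : ∀ i, p i = P.coeff i.1 := fun i => by rw [hp]
  have hU0 : ∀ x i, Rat.Good p i x → ∀ Q : MvPolynomial (Fin c.n) (X.carrier.presheaf.stalk x),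
      MvPolynomial.map (algebraMap _ X.carrier.functionField) Q =
        MvPolynomial.C (P.coeff i.1)⁻¹ * P → (algebraMap _ X.carrier.functionField
      (Alg.nf (sc (X := X) (X.carrier.fromSpecStalk x)) τ M Q) = h / p i ^ m ∧
      (IsUnit (Alg.nf (sc (X := X) (X.carrier.fromSpecStalk x)) τ M Q) ↔
        h ≠ 0 ∧ p i ^ m / h ∈ Rat.loc X.carrier x)) := by
    intro x i hx Q hQ
    have := nf_Q P x i.1 Q hQ τ M
    rw [← hh, ← hpi] at this
    exact ⟨this, isUnit_iff x _ _ _ (pow_ne_zero _ hx.1) this⟩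
  refine Rat.H_of_quasiAffine p hcov m hm h ⟨_, Rat.isOpen_locus p m h⟩ ?_ ?_ ?_ z ?_
  · intro x i hx
    obtain ⟨Q, hQ⟩ := exists_Q P x i.1 (hgood x i hx).2
    exact ⟨_, (hU0 x i hx Q hQ).1⟩
  · intro x i hx
    refine ⟨?_, fun h' => ⟨i, hx, h'⟩⟩
    rintro ⟨j, hj, h0, h1⟩
    exact ⟨h0, hj.swap p hx m h h1⟩
  · refine quasiAffine_UL hn hg hP τ hm M _ ?_
    rintro y ⟨i, hy, h'⟩
    obtain ⟨Q, hQ⟩ := exists_Q P y i.1 (hgood y i hy).2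
    exact ⟨i.1, (hgood y i hy).1, Q, hQ, (hU0 y i hy Q hQ).2.2 h'⟩
  · exact ⟨i0, hi0, (hU0 z i0 hi0 Q hQ).2.1 hu⟩
end Chart
end

noncomputable section
namespace Alg
open TensorProduct in
theorem generic_free (R A : Type u) [CommRing R] [IsDomain R] [IsNoetherianRing R] [CommRing A]
    [Algebra R A] [Module.Finite R A] :
    ∃ f : R, f ≠ 0 ∧ ∀ (M : Type u) [CommRing M] [Algebra R M], IsUnit (algebraMap R M f) →
      Module.Free M (M ⊗[R] A) := by
  letI : Field (Localization (nonZeroDivisors R)) := inferInstanceAs (Field (FractionRing R))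
  haveI : Module.FinitePresentation R A := Module.finitePresentation_of_finite R A
  obtain ⟨r, hr, hfree, -⟩ := Module.FinitePresentation.exists_free_localizedModule_powers
    (nonZeroDivisors R) (LocalizedModule.mkLinearMap (nonZeroDivisors R) A)
    (Localization (nonZeroDivisors R))
  refine ⟨r, nonZeroDivisors.ne_zero hr, fun M _ _ hu => ?_⟩
  letI : Algebra (Localization (.powers r)) M :=
    (IsLocalization.Away.lift (S := Localization (.powers r)) r hu).toAlgebra
  haveI : IsScalarTower R (Localization (.powers r)) M := by
    refine IsScalarTower.of_algebraMap_eq fun x => ?_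
    exact (IsLocalization.Away.lift_eq (S := Localization (.powers r)) r hu x).symm
  have e : Localization (.powers r) ⊗[R] A ≃ₗ[Localization (.powers r)]
      LocalizedModule.Away r A :=
    (IsLocalizedModule.isBaseChange (.powers r) (Localization (.powers r))
      (LocalizedModule.mkLinearMap (.powers r) A)).equiv
  haveI : Module.Free (Localization (.powers r)) (Localization (.powers r) ⊗[R] A) :=
    Module.Free.of_equiv e.symm
  exact Module.Free.of_equiv
    (TensorProduct.AlgebraTensorModule.cancelBaseChange R (Localization (.powers r)) M M A)
end Alg

namespace Chart
variable {k : Type u} [Field k] {G : GroupSchemeOver k} {X : SchemeOver k}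

theorem exists_chart (α : ActionOver G X) (hG : G.IsAlgebraic) (U : X.carrier.Opens)
    (hU : IsAffineOpen U) : ∃ c : Chart α, c.U = U := by
  obtain ⟨p⟩ : Nonempty (Spk k) := inferInstanceAs (Nonempty (PrimeSpectrum k))
  obtain ⟨V, hV, hpV, -⟩ := exists_isAffineOpen_mem_and_subset (U := ⊤) (x := G.one p) trivial
  haveI : LocallyOfFiniteType G.str := hG.1
  obtain ⟨ψ, hψ⟩ : ∃ ψ : CommRingCat.of k ⟶ Γ(G.carrier, V), Spec.map ψ = hV.fromSpec ≫ G.str :=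
    ⟨_, Spec.map_preimage _⟩
  have hft : ψ.hom.FiniteType := by
    refine (HasRingHomProperty.Spec_iff (P := @LocallyOfFiniteType)).1 ?_
    rw [hψ]; infer_instance
  letI := ψ.hom.toAlgebra
  haveI : Algebra.FiniteType k Γ(G.carrier, V) := hft
  haveI : Nonempty V := ⟨⟨_, hpV⟩⟩
  haveI : Nontrivial Γ(G.carrier, V) := Scheme.component_nontrivial _ V
  obtain ⟨n, φ, hφ, hfin⟩ := exists_finite_inj_algHom_of_fg k Γ(G.carrier, V)
  letI := φ.toRingHom.toAlgebra
  haveI : Module.Finite (MvPolynomial (Fin n) k) Γ(G.carrier, V) := hfin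
  obtain ⟨f, hf, hfree⟩ := Alg.generic_free (MvPolynomial (Fin n) k) Γ(G.carrier, V)
  refine ⟨{ n := n, A := Γ(G.carrier, V), inj := hφ, j := hV.fromSpec, j_str := ?_, f := f
            f_ne := hf, free := hfree, U := U, aff := hU, jopen := ?_ }, rfl⟩
  · exact (inferInstance : IsOpenImmersion hV.fromSpec)
  · refine hψ.symm.trans ?_
    rw [← Spec.map_comp, ← CommRingCat.ofHom_comp]
    congr 1
    ext x
    exact (φ.commutes x).symm
end Chart
end

noncomputable section
namespace Chart
variable {k : Type u} [Field k] {G : GroupSchemeOver k} {X : SchemeOver k}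

theorem isOpen_range_orb (α : ActionOver G X) (U : X.carrier.Opens) :
    IsOpen (Set.range (orb α U)) := by
  obtain ⟨i, hi1, hi2, hi⟩ := exists_map (X := X) U G.str
  obtain ⟨τ, hτ⟩ : ∃ τ, τ = tr α G.str (𝟙 _) (Category.id_comp _) := ⟨_, rfl⟩
  haveI : IsIso τ := hτ ▸ isIso_tr α G.str (𝟙 _) (Category.id_comp _)
  have e : orb α U = (pullbackSymmetry G.str (U.ι ≫ X.str)).hom ≫ i ≫ τ ≫ pullback.fst _ _ := by
    have h0 : τ ≫ pullback.fst _ _ = α.act (pullback.snd _ _ ≫ 𝟙 _) (pullback.fst X.str G.str)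
       (by rw [Category.comp_id, pullback.condition]) := by
      rw [hτ, tr, pullback.lift_fst]
    have h1 : (((pullbackSymmetry G.str (U.ι ≫ X.str)).hom ≫ i) ≫ pullback.snd _ _ ≫ 𝟙 _) =
        pullback.fst _ _ := by
      rw [Category.comp_id, Category.assoc, hi2, pullbackSymmetry_hom_comp_snd]
    have h2 : (((pullbackSymmetry G.str (U.ι ≫ X.str)).hom ≫ i) ≫ pullback.fst _ _) =
        pullback.snd _ _ ≫ U.ι := by
      rw [Category.assoc, hi1, pullbackSymmetry_hom_comp_fst_assoc]
    rw [h0, ← Category.assoc, α.act_natural _ _ _ _ (by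
      rw [h1, h2, pullback.condition, Category.assoc])]
    exact α.act_congr h1.symm h2.symm _ _
  haveI : UniversallyOpen G.str := inferInstance
  haveI : UniversallyOpen (orb α U) := by rw [e]; infer_instance
  exact (orb α U).isOpenMap.isOpen_range

/-- the saturation -/
def sat (α : ActionOver G X) (U : X.carrier.Opens) : X.carrier.Opens :=
  ⟨Set.range (orb α U), isOpen_range_orb α U⟩

theorem le_sat (α : ActionOver G X) (U : X.carrier.Opens) : U ≤ sat α U := by
  intro x hx
  have h : (U.ι ≫ X.str ≫ G.one) ≫ G.str = 𝟙 _ ≫ U.ι ≫ X.str := by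
    simp only [Category.assoc, G.one_str, Category.comp_id, Category.id_comp]
  obtain ⟨s, hs⟩ : ∃ s, s = pullback.lift _ _ h := ⟨_, rfl⟩
  have h1 : s ≫ pullback.fst _ _ = U.ι ≫ X.str ≫ G.one := by rw [hs, pullback.lift_fst]
  have h2 : s ≫ pullback.snd _ _ ≫ U.ι = U.ι := by
    rw [hs, pullback.lift_snd_assoc, Category.id_comp]
  have h3 : (U.ι ≫ X.str ≫ G.one) ≫ G.str = U.ι ≫ X.str := by
    simp only [Category.assoc, G.one_str, Category.comp_id]
  have e : s ≫ orb α U = U.ι := by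
    rw [orb, α.act_natural _ _ _ _ (by rw [h1, h2, h3])]
    exact (α.act_congr h1 h2 _ h3).trans (α.one_act _ _)
  obtain ⟨w, rfl⟩ : ∃ w, U.ι w = x := ⟨⟨x, hx⟩, rfl⟩
  refine ⟨s w, ?_⟩
  rw [← Scheme.Hom.comp_apply, e]

theorem sat_stable (α : ActionOver G X) (U : X.carrier.Opens) : α.Stable (sat α U) := by
  intro T g x h hx
  rintro _ ⟨t, rfl⟩
  obtain ⟨p, hp⟩ := hx ⟨t, rfl⟩
  obtain ⟨P, a, b, y, hab, hy⟩ : ∃ (P : Scheme.{u}) (a : P ⟶ pullback G.str (U.ι ≫ X.str))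
      (b : P ⟶ T) (y : P), a ≫ orb α U = b ≫ x ∧ b y = t := by
    obtain ⟨y, -, hy⟩ := Scheme.Pullback.exists_preimage_pullback (f := orb α U) (g := x) p t hp
    exact ⟨_, _, _, y, pullback.condition, hy⟩
  obtain ⟨g', hg'⟩ : ∃ g', g' = a ≫ pullback.fst G.str (U.ι ≫ X.str) := ⟨_, rfl⟩
  obtain ⟨v, hv⟩ : ∃ v, v = a ≫ pullback.snd G.str (U.ι ≫ X.str) := ⟨_, rfl⟩
  have hgv : g' ≫ G.str = (v ≫ U.ι) ≫ X.str := by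
    rw [hg', hv]; simp only [Category.assoc, pullback.condition]
  have e2 : α.act g' (v ≫ U.ι) hgv = b ≫ x := by
    rw [← hab, orb]
    refine (α.act_congr hg' ?_ _ ?_).trans (α.act_natural a _ _ _ _).symm
    · rw [hv, Category.assoc]
    · rw [Category.assoc, pullback.condition]; simp only [Category.assoc]
  have e3 : (b ≫ g) ≫ G.str = g' ≫ G.str := by
    rw [hgv, ← α.act_str _ _ hgv, e2, Category.assoc, h, Category.assoc]
  have h3 : G.mul (b ≫ g) g' e3 ≫ G.str = (v ≫ U.ι) ≫ X.str := by
    rw [G.mul_str, e3, hgv]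
  have h4 : (b ≫ g) ≫ G.str = α.act g' (v ≫ U.ι) hgv ≫ X.str := by
    rw [α.act_str, e3, hgv]
  have e4 := α.mul_act (b ≫ g) g' (v ≫ U.ι) e3 h3 hgv h4
  have h5 : G.mul (b ≫ g) g' e3 ≫ G.str = v ≫ U.ι ≫ X.str := by rw [h3, Category.assoc]
  obtain ⟨s, hs⟩ : ∃ s, s = pullback.lift _ _ h5 := ⟨_, rfl⟩
  have h1 : s ≫ pullback.fst _ _ = G.mul (b ≫ g) g' e3 := by rw [hs, pullback.lift_fst]
  have h2 : s ≫ pullback.snd _ _ ≫ U.ι = v ≫ U.ι := by rw [hs, pullback.lift_snd_assoc]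
  have h6 : (b ≫ g) ≫ G.str = (b ≫ x) ≫ X.str := by simp only [Category.assoc, h]
  have e : s ≫ orb α U = b ≫ α.act g x h := by
    rw [orb, α.act_natural _ _ _ _ (by rw [h1, h2, h3]), α.act_natural b _ _ _ h6]
    exact (α.act_congr h1 h2 _ h3).trans (e4.trans (α.act_congr rfl e2 _ _))
  refine ⟨s y, ?_⟩
  rw [← Scheme.Hom.comp_apply, e, Scheme.Hom.comp_apply, hy]
end Chart
end

noncomputable section
namespace Chart
variable {k : Type u} [Field k] {G : GroupSchemeOver k} {X : SchemeOver k}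

theorem exists_restr (α : ActionOver G X) (Y : SchemeOver k) (ι : Y.carrier ⟶ X.carrier)
    [IsOpenImmersion ι] (e : ι ≫ X.str = Y.str)
    (hst : ∀ {T : Scheme.{u}} (g : T ⟶ G.carrier) (x : T ⟶ X.carrier) (h),
      Set.range x ⊆ Set.range ι → Set.range (α.act g x h) ⊆ Set.range ι) :
    ∃ β : ActionOver G Y, ∀ {T : Scheme.{u}} (g : T ⟶ G.carrier) (y : T ⟶ Y.carrier) (h h'),
      β.act g y h ≫ ι = α.act g (y ≫ ι) h' := by
  have H : ∀ {T : Scheme.{u}} (g : T ⟶ G.carrier) (y : T ⟶ Y.carrier),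
      g ≫ G.str = y ≫ Y.str → g ≫ G.str = (y ≫ ι) ≫ X.str := by
    intro T g y h; rw [h, Category.assoc, e]
  have R : ∀ {T : Scheme.{u}} (g : T ⟶ G.carrier) (y : T ⟶ Y.carrier)
      (h : g ≫ G.str = y ≫ Y.str), ∃ z : T ⟶ Y.carrier, z ≫ ι = α.act g (y ≫ ι) (H g y h) := by
    intro T g y h
    have := hst g (y ≫ ι) (H g y h) (by
      rintro _ ⟨t, rfl⟩; exact ⟨y t, (Scheme.Hom.comp_apply _ _ _).symm⟩)
    exact ⟨IsOpenImmersion.lift ι _ this, IsOpenImmersion.lift_fac _ _ _⟩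
  choose act hact using @R
  refine ⟨{ act := act, act_str := ?_, act_natural := ?_, one_act := ?_, mul_act := ?_ }, ?_⟩
  · intro T g x h
    rw [← e, ← Category.assoc, hact, α.act_str, Category.assoc]
  · intro T' T f g x h h'
    rw [← cancel_mono ι, Category.assoc, hact, hact, α.act_natural _ _ _ _ (by
      have := H _ _ h'; simpa only [Category.assoc] using this)]
    exact α.act_congr rfl (Category.assoc _ _ _).symm _ _
  · intro T x h
    rw [← cancel_mono ι, hact]
    refine (α.act_congr ?_ rfl _ ?_).trans (α.one_act _ ?_)
    · simp only [← e, Category.assoc]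
    all_goals simp only [Category.assoc, G.one_str, Category.comp_id]
  · intro T g g' x h₁ h₂ h₃ h₄
    rw [← cancel_mono ι, hact, hact]
    have h5 := H _ _ h₄
    rw [hact] at h5
    refine (α.mul_act g g' (x ≫ ι) h₁ (H _ _ h₂) (H _ _ h₃) h5).trans ?_
    exact α.act_congr rfl (hact _ _ _).symm _ _
  · intro T g y h h'
    exact hact g y h

theorem orb_surj (α : ActionOver G X) (Y : SchemeOver k) (ι : Y.carrier ⟶ X.carrier)
    [IsOpenImmersion ι] (e : ι ≫ X.str = Y.str) (β : ActionOver G Y)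
    (hβ : ∀ {T : Scheme.{u}} (g : T ⟶ G.carrier) (y : T ⟶ Y.carrier) (h h'),
      β.act g y h ≫ ι = α.act g (y ≫ ι) h') (U : X.carrier.Opens)
    (hr : Set.range ι = (sat α U : Set X.carrier)) (y : Y.carrier) :
    ∃ p, orb β (ι ⁻¹ᵁ U) p = y := by
  obtain ⟨p, hp⟩ : ι y ∈ Set.range (orb α U) := by
    have : ι y ∈ Set.range ι := ⟨y, rfl⟩
    rw [hr] at this; exact this
  obtain ⟨a, ha⟩ : ∃ a : U.toScheme ⟶ Y.carrier, a ≫ ι = U.ι := by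
    refine ⟨IsOpenImmersion.lift ι U.ι ?_, IsOpenImmersion.lift_fac _ _ _⟩
    rw [Scheme.Opens.range_ι, hr]
    exact le_sat α U
  obtain ⟨b, hb⟩ : ∃ b : U.toScheme ⟶ (ι ⁻¹ᵁ U).toScheme, b ≫ (ι ⁻¹ᵁ U).ι = a := by
    refine ⟨IsOpenImmersion.lift (ι ⁻¹ᵁ U).ι a ?_, IsOpenImmersion.lift_fac _ _ _⟩
    rw [Scheme.Opens.range_ι]
    rintro _ ⟨t, rfl⟩
    show ι (a t) ∈ U
    rw [← Scheme.Hom.comp_apply, ha]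
    exact t.2
  have h : pullback.fst G.str (U.ι ≫ X.str) ≫ G.str =
      (pullback.snd _ _ ≫ b) ≫ (ι ⁻¹ᵁ U).ι ≫ Y.str := by
    rw [pullback.condition, ← e, Category.assoc, reassoc_of% hb, reassoc_of% ha]
  obtain ⟨s, hs⟩ : ∃ s, s = pullback.lift _ _ h := ⟨_, rfl⟩
  have h1 : s ≫ pullback.fst _ _ = pullback.fst _ _ := by rw [hs, pullback.lift_fst]
  have h2 : s ≫ pullback.snd _ _ ≫ (ι ⁻¹ᵁ U).ι ≫ ι = pullback.snd _ _ ≫ U.ι := by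
    rw [hs, pullback.lift_snd_assoc, Category.assoc, reassoc_of% hb, ha]
  have h3 : pullback.fst G.str ((ι ⁻¹ᵁ U).ι ≫ Y.str) ≫ G.str =
    ((pullback.snd _ _ ≫ (ι ⁻¹ᵁ U).ι) ≫ ι) ≫ X.str := by
    rw [Category.assoc, e, pullback.condition, Category.assoc]
  have E : s ≫ orb β (ι ⁻¹ᵁ U) ≫ ι = orb α U := by
    rw [orb, hβ _ _ _ h3, orb, α.act_natural _ _ _ _ (by
      rw [Category.assoc, h3]; simp only [Category.assoc])]
    exact α.act_congr h1 (by simp only [Category.assoc]; exact h2) _ _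
  refine ⟨s p, ?_⟩
  apply ι.isOpenEmbedding.injective
  rw [← hp, ← E]
  simp only [Scheme.Hom.comp_apply]
end Chart
end

noncomputable section
namespace Chart
variable {k : Type u} [Field k] {G : GroupSchemeOver k} {X : SchemeOver k}

theorem normal_ofOpens (W : X.carrier.Opens) (hn : IsNormalScheme X.carrier) :
    IsNormalScheme (X.ofOpens W).carrier := by
  intro x
  obtain ⟨ι, hι⟩ : ∃ ι : (X.ofOpens W).carrier ⟶ X.carrier, ι = W.ι := ⟨_, rfl⟩
  haveI : IsOpenImmersion ι := by subst hι; exact (inferInstance : IsOpenImmersion W.ι)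
  obtain ⟨h1, h2⟩ := hn (ι x)
  have e : X.carrier.presheaf.stalk (ι x) ≃+* (X.ofOpens W).carrier.presheaf.stalk x :=
    (asIso (ι.stalkMap x)).commRingCatIsoToRingEquiv
  haveI : IsDomain ((X.ofOpens W).carrier.presheaf.stalk x) := MulEquiv.isDomain _ e.symm.toMulEquiv
  exact ⟨this, IsIntegrallyClosed.of_equiv e⟩

theorem main_aux (hG : G.IsAlgebraic) [ConnectedSpace G.carrier] (hX : X.IsVariety)
    (hn : IsNormalScheme X.carrier) (α : ActionOver G X) (x : X.carrier) :
    ∃ U : X.carrier.Opens, x ∈ U ∧ α.Stable U ∧ (X.ofOpens U).IsQuasiProjective := by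
  obtain ⟨hX1, hX2, hX3, hX4⟩ := hX
  obtain ⟨U, hU, hxU, -⟩ := exists_isAffineOpen_mem_and_subset (U := ⊤) (x := x) trivial
  obtain ⟨W, hW⟩ : ∃ W, W = sat α U := ⟨_, rfl⟩
  have hle : U ≤ W := hW ▸ le_sat α U
  have hst : α.Stable W := hW ▸ sat_stable α U
  refine ⟨W, hle hxU, hst, ?_⟩
  have hnY := normal_ofOpens W hn
  obtain ⟨Y, hY⟩ : ∃ Y, Y = X.ofOpens W := ⟨_, rfl⟩
  haveI : Nonempty W := ⟨⟨x, hle hxU⟩⟩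
  haveI : IsLocallyNoetherian (Spk k) := 
    (inferInstance : IsLocallyNoetherian (Spec (CommRingCat.of k)))
  haveI : IsLocallyNoetherian X.carrier := LocallyOfFiniteType.isLocallyNoetherian X.str
  haveI : CompactSpace X.carrier := QuasiCompact.compactSpace_of_compactSpace X.str
  haveI : IsNoetherian X.carrier := {}
  have hYi : IsIntegral Y.carrier := by subst hY; exact (inferInstance : IsIntegral W.toScheme)
  have hYs : IsSeparated Y.str := by
    subst hY; exact (inferInstance : IsSeparated (W.ι ≫ X.str))
  have hYl : LocallyOfFiniteType Y.str := by
    subst hY; exact (inferInstance : LocallyOfFiniteType (W.ι ≫ X.str))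
  have hYq : QuasiCompact Y.str := by
    subst hY; exact (inferInstance : QuasiCompact (W.ι ≫ X.str))
  obtain ⟨ι, hι, e, hr⟩ : ∃ ι : Y.carrier ⟶ X.carrier, IsOpenImmersion ι ∧ ι ≫ X.str = Y.str ∧
      Set.range ι = (W : Set X.carrier) := by
    subst hY
    exact ⟨W.ι, (inferInstance : IsOpenImmersion W.ι), rfl, Scheme.Opens.range_ι W⟩
  rw [← hY] at hnY ⊢
  haveI : IsLocallyNoetherian Y.carrier := LocallyOfFiniteType.isLocallyNoetherian Y.str
  haveI : CompactSpace Y.carrier := QuasiCompact.compactSpace_of_compactSpace Y.str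
  haveI : IsNoetherian Y.carrier := {}
  obtain ⟨β, hβ⟩ := exists_restr α Y ι e (by
    intro T g x h hx
    rw [hr] at hx ⊢
    exact hst g x h hx)
  have hV : IsAffineOpen (ι ⁻¹ᵁ U) := by
    refine (IsAffineOpen.preimage_of_isOpenImmersion hU ι ?_)
    intro z hz
    have : z ∈ Set.range ι := by rw [hr]; exact hle hz
    exact this
  obtain ⟨c, hc⟩ := exists_chart β hG (ι ⁻¹ᵁ U) hV
  have hs : ∀ y, ∃ p, orb β c.U p = y := by
    rw [hc]
    exact orb_surj α Y ι e β hβ U (hr.trans (by rw [hW]))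
  exact ⟨hYs, ⟨hYl, hYq⟩, exists_ample hnY (gen_of_surj (c := c) hG hs)⟩
end Chart
end

/-- Let `k` be a field and `G` a connected algebraic group over `k`. Then
every normal `G`-variety `X` over `k` is covered by open `G`-stable subvarieties that are
quasi-projective over `k`. -/
theorem normal_G_variety_covered_by_stable_quasiprojective_opens
    {k : Type u} [Field k] (G : GroupSchemeOver k) (hGalg : G.IsAlgebraic)
    (hGconn : ConnectedSpace G.carrier)
    (X : SchemeOver k) (hXvar : X.IsVariety) (hXnorm : IsNormalScheme X.carrier)
    (α : ActionOver G X) :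
    ∀ x : X.carrier, ∃ U : X.carrier.Opens,
      x ∈ U ∧ α.Stable U ∧ (X.ofOpens U).IsQuasiProjective := by
  intro x
  exact Chart.main_aux hGalg hXvar hXnorm α x
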